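/- Let (X, μ, G) be an ergodic, type III, non-amenable, locally countable, acyclic Borel graph on a standard measure space with σ-finite μ, and let d ∈ {2, 3, …} ∪ {∞}. Then there exists a Borel action of the free group F_d on X which is essentially free, such that E_G = E_{F_d} almost everywhere, and such that for almost every component of the Schreier graph of the action, no end of that component is vanishing. -/

import Mathlib

open MeasureTheory Set Filter
open scoped ENNReal ENat Topology

noncomputable section

variable {X : Type*}

/-- The integral of `f` over the set of edges `A` against the "left" measure `ν_l`
determined by `μ`:  `∫ₐ f dν_l = ∫ₓ Σ_{y : (x,y) ∈ A} f(x,y) dμ(x)`. -/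
def lintL [MeasurableSpace X] (μ : Measure X) (f : X × X → ℝ≥0∞) (A : Set (X × X)) : ℝ≥0∞ :=
  ∫⁻ x, ∑' y : {y : X // (x, y) ∈ A}, f (x, (y : X)) ∂μ

/-- The integral of `f` over the set of edges `A` against the "right" measure `ν_r`
determined by `μ`:  `∫ₐ f dν_r = ∫ₓ Σ_{y : (y,x) ∈ A} f(y,x) dμ(x)`. -/
def lintR [MeasurableSpace X] (μ : Measure X) (f : X × X → ℝ≥0∞) (A : Set (X × X)) : ℝ≥0∞ :=
  ∫⁻ x, ∑' y : {y : X // (y, x) ∈ A}, f ((y : X), x) ∂μ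

/-- `ν_l(A) = ∫ₓ |{y : (x,y) ∈ A}| dμ(x)`. -/
def nuL [MeasurableSpace X] (μ : Measure X) (A : Set (X × X)) : ℝ≥0∞ :=
  lintL μ (fun _ => 1) A

/-- `ν_r(A) = ∫ₓ |{y : (y,x) ∈ A}| dμ(x)`. -/
def nuR [MeasurableSpace X] (μ : Measure X) (A : Set (X × X)) : ℝ≥0∞ :=
  lintR μ (fun _ => 1) A

/-- `E` is measure-class-preserving w.r.t. `μ`: `ν_l` and `ν_r` are mutually absolutely
continuous on Borel subsets of `E`. -/
def MCP [MeasurableSpace X] (μ : Measure X) (E : Set (X × X)) : Prop :=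
  ∀ A : Set (X × X), A ⊆ E → MeasurableSet A → (nuL μ A = 0 ↔ nuR μ A = 0)

/-- `E` is measure-preserving w.r.t. `μ`: `ν_l = ν_r` on Borel subsets of `E`. -/
def MPrel [MeasurableSpace X] (μ : Measure X) (E : Set (X × X)) : Prop :=
  ∀ A : Set (X × X), A ⊆ E → MeasurableSet A → nuL μ A = nuR μ A

/-- A countable Borel equivalence relation: a Borel equivalence relation all of whose
classes are countable. -/
def IsCBER [MeasurableSpace X] (E : Set (X × X)) : Prop :=
  MeasurableSet E ∧ Equivalence (fun x y => (x, y) ∈ E) ∧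
    ∀ x : X, {y | (x, y) ∈ E}.Countable

/-- The `E`-saturation of a set `A`. -/
def ESat (E : Set (X × X)) (A : Set X) : Set X :=
  {x | ∃ y ∈ A, (x, y) ∈ E}

/-- `E` is ergodic w.r.t. `μ`: every non-null Borel set is a complete section. -/
def ErgodicRel [MeasurableSpace X] (μ : Measure X) (E : Set (X × X)) : Prop :=
  ∀ A : Set X, MeasurableSet A → μ A ≠ 0 → μ (ESat E A)ᶜ = 0

/-- `E` is properly ergodic: ergodic, and `μ` is not concentrated on a single `E`-class. -/
def ProperlyErgodicRel [MeasurableSpace X] (μ : Measure X) (E : Set (X × X)) : Prop :=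
  ErgodicRel μ E ∧ ∀ x : X, μ {y | (x, y) ∉ E} ≠ 0

/-- `μ'` is `E`-invariant: every Borel bijection between Borel subsets whose graph is
contained in `E` pushes the restricted measure forward to the restricted measure. -/
def InvariantUnder [MeasurableSpace X] (μ' : Measure X) (E : Set (X × X)) : Prop :=
  ∀ (f : X → X) (A : Set X), Measurable f → MeasurableSet A → Set.InjOn f A →
    (∀ x ∈ A, (x, f x) ∈ E) →
    Measure.map f (μ'.restrict A) = μ'.restrict (f '' A)

/-- Mutual absolute continuity of measures. -/
def EquivMeasure [MeasurableSpace X] (μ' μ : Measure X) : Prop :=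
  μ' ≪ μ ∧ μ ≪ μ'

/-- Type II: `μ` is non-atomic and some σ-finite measure equivalent to `μ` is `E`-invariant. -/
def IsTypeII [MeasurableSpace X] (μ : Measure X) (E : Set (X × X)) : Prop :=
  NoAtoms μ ∧
    ∃ μ' : Measure X, SigmaFinite μ' ∧ EquivMeasure μ' μ ∧ InvariantUnder μ' E

/-- Type III: no σ-finite measure equivalent to `μ` is `E`-invariant. -/
def IsTypeIII [MeasurableSpace X] (μ : Measure X) (E : Set (X × X)) : Prop :=
  ¬ ∃ μ' : Measure X, SigmaFinite μ' ∧ EquivMeasure μ' μ ∧ InvariantUnder μ' E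

/-- `w` is (a pointwise-cocycle version of) the Radon–Nikodym cocycle `𝔴 = dν_l/dν_r` of the
mcp relation `E`: it is Borel, takes values in `(0,∞)` on `E`, satisfies the cocycle identity,
and `ν_l(A) = ∫_A w dν_r` for every Borel `A ⊆ E`. -/
def IsRNCocycle [MeasurableSpace X] (μ : Measure X) (E : Set (X × X))
    (w : X × X → ℝ≥0∞) : Prop :=
  Measurable w ∧
  (∀ e ∈ E, w e ≠ 0 ∧ w e ≠ ∞) ∧
  (∀ x y z : X, (y, x) ∈ E → (z, y) ∈ E → w (z, y) * w (y, x) = w (z, x)) ∧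
  (∀ x : X, w (x, x) = 1) ∧
  ∀ A : Set (X × X), A ⊆ E → MeasurableSet A → nuL μ A = lintR μ w A

/-- The connectedness relation of a graph `G`: `x` and `y` are related iff they are joined
by a path of edges of `G`. -/
def connRel (G : Set (X × X)) : Set (X × X) :=
  {p | Relation.ReflTransGen (fun a b => (a, b) ∈ G) p.1 p.2}

/-- The symmetrization of a directed graph. -/
def symmCl (G : Set (X × X)) : Set (X × X) :=
  {p | p ∈ G ∨ (p.2, p.1) ∈ G}

/-- The graph distance in `G` (with value `⊤` between distinct components). -/
def gdist (G : Set (X × X)) (x y : X) : ℕ∞ :=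
  sInf ((fun m : ℕ => (m : ℕ∞)) ''
    {m : ℕ | ∃ c : ℕ → X, c 0 = x ∧ c m = y ∧ ∀ i < m, (c i, c (i + 1)) ∈ G})

/-- For a directed edge `(x,y)` of an acyclic graph `G`, the half-space
`N_{(x,y)} = {z : d_G(y,z) < d_G(x,z)}`. -/
def halfSpace (G : Set (X × X)) (x y : X) : Set X :=
  {z | gdist G y z < gdist G x z}

/-- A geodesic ray in `G`. -/
def IsGeodesicRay (G : Set (X × X)) (r : ℕ → X) : Prop :=
  (∀ i : ℕ, (r i, r (i + 1)) ∈ G) ∧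
    ∀ i j : ℕ, i ≤ j → gdist G (r i) (r j) = ((j - i : ℕ) : ℕ∞)

/-- The end represented by the geodesic ray `r` is vanishing w.r.t. the cocycle `w`:
`sup {w(y, r 0) : y ∈ N_{(r i, r (i+1))}} → 0` as `i → ∞`. -/
def VanishingEnd (w : X × X → ℝ≥0∞) (G : Set (X × X)) (r : ℕ → X) : Prop :=
  Tendsto (fun i : ℕ => ⨆ y ∈ halfSpace G (r i) (r (i + 1)), w (y, r 0))
    atTop (nhds 0)

/-- A (symmetric) graph is acyclic if it has no injective cycle of length `≥ 3`. -/
def AcyclicGraph (G : Set (X × X)) : Prop :=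
  ∀ (n : ℕ) (c : ℕ → X), 2 < n → (∀ i < n, (c i, c ((i + 1) % n)) ∈ G) →
    ¬ Function.Injective fun i : Fin n => c (i : ℕ)

/-- Amenability of a locally countable Borel graph `G` (w.r.t. the measure `μ`):
there are Borel a.e.-averaging functions `λ_n` on the connectedness relation of `G`. -/
def AmenableGraph [MeasurableSpace X] (μ : Measure X) (G : Set (X × X)) : Prop :=
  ∃ lam : ℕ → X × X → ℝ,
    (∀ n, Measurable (lam n)) ∧
    (∀ n e, 0 ≤ lam n e) ∧
    (∀ᵐ x ∂μ, ∀ n : ℕ, ∑' y : {y : X // (x, y) ∈ connRel G}, lam n (x, (y : X)) = 1) ∧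
    nuL μ {e ∈ G | ¬ Tendsto
        (fun n : ℕ => ∑' z : {z : X // (e.1, z) ∈ connRel G},
          |lam n (e.1, (z : X)) - lam n (e.2, (z : X))|)
        atTop (nhds 0)} = 0

/-- The Schreier graph of an action of a free group, with respect to the free basis. -/
def schreier {ι : Type*} [MeasurableSpace X] (φ : FreeGroup ι →* Equiv.Perm X) :
    Set (X × X) :=
  {p | p.1 ≠ p.2 ∧ ∃ s : ι,
    φ (FreeGroup.of s) p.1 = p.2 ∨ φ (FreeGroup.of s) p.2 = p.1}

set_option linter.unusedSectionVars false
set_option linter.unusedSimpArgs false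

theorem exhaust {X : Type*} [MeasurableSpace X] (μ : Measure X) [IsFiniteMeasure μ]
    (P : Set X → Prop) (h0 : P ∅)
    (hU : ∀ f : ℕ → Set X, (∀ n, MeasurableSet (f n)) → (∀ n, P (f n)) → P (⋃ n, f n)) :
    ∃ W, MeasurableSet W ∧ P W ∧ ∀ W', MeasurableSet W' → P W' → μ (W' \ W) = 0 := by
  let S : Set ℝ≥0∞ := {c | ∃ W, MeasurableSet W ∧ P W ∧ μ W = c}
  have hne : S.Nonempty := ⟨0, ∅, MeasurableSet.empty, h0, by simp⟩
  obtain ⟨u, -, hu1, hu2⟩ := exists_seq_tendsto_sSup hne (OrderTop.bddAbove S)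
  choose W hWm hWP hWu using hu2
  refine ⟨⋃ n, W n, .iUnion hWm, hU W hWm hWP, fun W' hW' hP' => ?_⟩
  have h1 : sSup S ≤ μ (⋃ n, W n) := by
    refine le_of_tendsto' hu1 (fun n => ?_)
    rw [← hWu n]; exact measure_mono (subset_iUnion W n)
  have h2 : μ (W' ∪ ⋃ n, W n) ≤ sSup S := by
    refine le_sSup ⟨_, hW'.union (.iUnion hWm), ?_, rfl⟩
    have := hU (fun n => Nat.casesOn n W' W) (fun n => by cases n; exacts [hW', hWm _])
      (fun n => by cases n; exacts [hP', hWP _])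
    convert this using 1
    ext x; simp only [mem_union, mem_iUnion]
    constructor
    · rintro (h | ⟨n, h⟩)
      · exact ⟨0, h⟩
      · exact ⟨n+1, h⟩
    · rintro ⟨n, h⟩
      cases n with
      | zero => exact Or.inl h
      | succ n => exact Or.inr ⟨n, h⟩
  have h3 : μ (W' ∪ ⋃ n, W n) = μ (W' \ ⋃ n, W n) + μ (⋃ n, W n) := by
    rw [← measure_union disjoint_sdiff_left (.iUnion hWm), sdiff_union_self]
  have h4 := h2.trans h1
  rw [h3] at h4
  have : μ (W' \ ⋃ n, W n) + μ (⋃ n, W n) ≤ 0 + μ (⋃ n, W n) := by simpa using h4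
  exact le_antisymm ((ENNReal.add_le_add_iff_right (measure_ne_top _ _)).1 this) zero_le

def cyl (s : List ℕ) : Set (ℕ → ℕ) := {β | ∀ i, i < s.length → β i = s.getD i 0}

theorem cyl_mono {s t : List ℕ} (h : s <+: t) : cyl t ⊆ cyl s := by
  intro β hβ i hi
  rw [hβ i (hi.trans_le h.length_le)]
  obtain ⟨u, rfl⟩ := h
  exact List.getD_append _ _ _ _ hi

theorem cyl_nhds {α : ℕ → ℕ} {V : Set (ℕ → ℕ)} (hV : V ∈ 𝓝 α) :
    ∃ n, ∀ s : List ℕ, n ≤ s.length → α ∈ cyl s → cyl s ⊆ V := by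
  rw [nhds_pi, Filter.mem_pi'] at hV
  obtain ⟨I, t, ht, hV⟩ := hV
  refine ⟨I.sup id + 1, fun s hs hα β hβ => hV ?_⟩
  intro i hi
  have : i < s.length := by
    have : i ≤ I.sup id := Finset.le_sup (f := id) hi
    omega
  rw [hβ i this, ← hα i this]
  exact mem_of_mem_nhds (ht i)

theorem getD_chain (T : ℕ → List ℕ) (hT : ∀ n, T n <+: T (n+1)) (hl : ∀ n, n ≤ (T n).length) (n : ℕ) :
    (fun i => (T (i+1)).getD i 0) ∈ cyl (T n) := by
  have hmono : ∀ n m, n ≤ m → T n <+: T m := by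
    intro n m h
    induction h with
    | refl => exact List.prefix_refl _
    | step _ ih => exact ih.trans (hT _)
  intro i hi
  have key : ∀ a b : List ℕ, a <+: b → i < a.length → b.getD i 0 = a.getD i 0 := by
    rintro a _ ⟨u, rfl⟩ h
    exact List.getD_append _ _ _ _ h
  rcases le_total (i+1) n with h | h
  · exact (key _ _ (hmono _ _ h) (hl (i+1))).symm
  · exact key _ _ (hmono _ _ h) hi

theorem mem_cyl_ofFn (β : ℕ → ℕ) (n : ℕ) : β ∈ cyl (List.ofFn (fun i : Fin n => β i)) := by
  intro i hi
  simp at hi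
  simp [List.getD_eq_getElem?_getD, hi]

theorem prefix_ofFn {β : ℕ → ℕ} {s : List ℕ} (h : β ∈ cyl s) {n : ℕ} (hn : s.length ≤ n) :
    s <+: List.ofFn (fun i : Fin n => β i) := by
  rw [List.prefix_iff_eq_take]
  apply List.ext_getElem
  · simp [hn]
  · intro i h1 h2
    have := h i h1
    simp [List.getD_eq_getElem?_getD, h1] at this
    simp [this]

section LN
variable {X Y : Type*} [MeasurableSpace X] [TopologicalSpace X] [T2Space X]
  [SecondCountableTopology X] [OpensMeasurableSpace X] [BorelSpace X]
  [MeasurableSpace Y] [TopologicalSpace Y] [T2Space Y] [RegularSpace Y] [RegularSpace X] [BorelSpace Y]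

def LNsmall (μ : Measure X) (F : (ℕ → ℕ) → X × Y) (s : List ℕ) (W : Set X) : Prop :=
  ∃ g : ℕ → X → Y, (∀ i, Measurable (g i)) ∧
    ∀ᵐ x ∂μ, x ∈ W → ∀ β ∈ cyl s, (F β).1 = x → ∃ i, g i x = (F β).2

theorem LNsmall.iUnion {μ : Measure X} {F : (ℕ → ℕ) → X × Y} {s : List ℕ} {W : ℕ → Set X}
    (h : ∀ n, LNsmall μ F s (W n)) : LNsmall μ F s (⋃ n, W n) := by
  choose g hg1 hg2 using h
  refine ⟨fun k => g k.unpair.1 k.unpair.2, fun i => hg1 _ _, ?_⟩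
  filter_upwards [ae_all_iff.2 hg2] with x hx hxW β hβ hp
  obtain ⟨n, hn⟩ := mem_iUnion.1 hxW
  obtain ⟨i, hi⟩ := hx n hn β hβ hp
  exact ⟨Nat.pair n i, by simpa using hi⟩

/-- small via countably many small covers -/
theorem LNsmall.cover {μ : Measure X} {F : (ℕ → ℕ) → X × Y} {s : List ℕ} {W : Set X}
    (V : List ℕ → Set X) (hV : ∀ t, LNsmall μ F t (V t)) (f : X → Y) (hf : Measurable f)
    (h : ∀ᵐ x ∂μ, x ∈ W → ∀ β ∈ cyl s, (F β).1 = x → (f x = (F β).2 ∨ ∃ t, β ∈ cyl t ∧ x ∈ V t)) :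
    LNsmall μ F s W := by
  choose g hg1 hg2 using hV
  refine ⟨fun k => Nat.casesOn k f (fun k => match (Encodable.decode k.unpair.1 : Option (List ℕ)) with
    | none => f
    | some t => g t k.unpair.2), fun i => ?_, ?_⟩
  · cases i with
    | zero => exact hf
    | succ k =>
      dsimp only
      split
      · exact hf
      · exact hg1 _ _
  · filter_upwards [ae_all_iff.2 hg2, h] with x hx hh hxW β hβ hp
    rcases hh hxW β hβ hp with h1 | ⟨t, ht, hxt⟩
    · exact ⟨0, h1⟩
    · obtain ⟨i, hi⟩ := hx t hxt β ht hp
      exact ⟨Nat.pair (Encodable.encode t) i + 1, by simpa using hi⟩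

theorem LN_aux (μ : Measure X) [IsFiniteMeasure μ] (F : (ℕ → ℕ) → X × Y) (hF : Continuous F)
    (hc : ∀ x, {z ∈ range F | z.1 = x}.Countable) :
    ∃ g : ℕ → X → Y, (∀ i, Measurable (g i)) ∧
    ∀ᵐ x ∂μ, ∀ β, (F β).1 = x → ∃ i, g i x = (F β).2 := by
  classical
  have f0 : Y := (F 0).2
  have hex : ∀ s, ∃ W, MeasurableSet W ∧ LNsmall μ F s W ∧
      ∀ W', MeasurableSet W' → LNsmall μ F s W' → μ (W' \ W) = 0 := fun s =>
    exhaust μ (LNsmall μ F s) ⟨fun _ _ => f0, fun _ => measurable_const, by simp⟩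
      (fun f _ h => LNsmall.iUnion h)
  choose W hWm hWs hWmax using hex
  have hmax : ∀ s W', MeasurableSet W' → LNsmall μ F s W' → ∀ᵐ x ∂μ, x ∈ W' → x ∈ W s := by
    intro s W' h1 h2
    have := hWmax s W' h1 h2
    rw [ae_iff]
    convert this using 2
    ext x; simp
  -- (i)
  have hi : ∀ᵐ x ∂μ, ∀ s, x ∉ W s → ∃ n : ℕ, x ∉ W (s ++ [n]) := by
    rw [ae_all_iff]; intro s
    have := hmax s (⋂ n : ℕ, W (s ++ [n])) (.iInter fun n => hWm _) (by
      refine LNsmall.cover W hWs (fun _ => f0) measurable_const (.of_forall ?_)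
      intro x hx β hβ hp
      refine Or.inr ⟨s ++ [β s.length], ?_, mem_iInter.1 hx _⟩
      intro i hi
      simp at hi
      rcases Nat.lt_or_eq_of_le hi with h | h
      · rw [hβ i h]; exact (List.getD_append _ _ _ _ h).symm
      · subst h; simp)
    filter_upwards [this] with x hx hs
    by_contra! hcon
    exact hs (hx (mem_iInter.2 hcon))
  -- separation of points by cylinders
  have hsep : ∀ α β : ℕ → ℕ, F α ≠ F β → ∃ n, ∀ s t : List ℕ, n ≤ s.length → n ≤ t.length → α ∈ cyl s →
      β ∈ cyl t → Disjoint (closure (F '' cyl s)) (closure (F '' cyl t)) := by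
    intro α β hne
    obtain ⟨U, hαU, hU, V, hβV, hV, hUV⟩ := exists_open_nhds_disjoint_closure hne
    obtain ⟨n1, h1⟩ := cyl_nhds (hF.continuousAt.preimage_mem_nhds (hU.mem_nhds hαU))
    obtain ⟨n2, h2⟩ := cyl_nhds (hF.continuousAt.preimage_mem_nhds (hV.mem_nhds hβV))
    refine ⟨max n1 n2, fun s t hs ht hα hβ => hUV.mono (closure_mono ?_) (closure_mono ?_)⟩
    · exact image_subset_iff.2 (h1 s (by omega) hα)
    · exact image_subset_iff.2 (h2 t (by omega) hβ)
  -- (ii)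
  let Dj : List ℕ → List ℕ → Prop := fun t t' => Disjoint (closure (F '' cyl t)) (closure (F '' cyl t'))
  have hii : ∀ᵐ x ∂μ, ∀ s, x ∉ W s → ∃ t t', s <+: t ∧ s <+: t' ∧ x ∉ W t ∧ x ∉ W t' ∧ Dj t t' := by
    rw [ae_all_iff]; intro s
    let W' : Set X := {x | ¬ ∃ t t', s <+: t ∧ s <+: t' ∧ x ∉ W t ∧ x ∉ W t' ∧ Dj t t'}
    have hW' : MeasurableSet W' := by
      have : W' = (⋃ t, ⋃ t', {x | s <+: t ∧ s <+: t' ∧ x ∉ W t ∧ x ∉ W t' ∧ Dj t t'})ᶜ := by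
        ext x; simp only [W', mem_compl_iff, mem_iUnion]; rfl
      rw [this]
      refine (MeasurableSet.iUnion fun t => MeasurableSet.iUnion fun t' => ?_).compl
      exact (MeasurableSet.const _).inter ((MeasurableSet.const _).inter ((hWm t).compl.inter
        ((hWm t').compl.inter (MeasurableSet.const _))))
    letI : MeasurableSpace (List ℕ) := ⊤
    haveI : MeasurableSingletonClass (List ℕ) := ⟨fun _ => trivial⟩
    let nx : X × List ℕ → List ℕ := fun p => p.2 ++ [if h : ∃ k, p.1 ∉ W (p.2 ++ [k]) then Nat.find h else 0]
    have hnx : Measurable nx := by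
      refine measurable_from_prod_countable_left fun t => ?_
      have hm : Measurable (fun x : X => Nat.find (p := fun k => x ∉ W (t ++ [k]) ∨ ∀ j, x ∈ W (t ++ [j])) (by
          by_cases h : ∃ k, x ∉ W (t ++ [k])
          · exact ⟨_, Or.inl h.choose_spec⟩
          · push Not at h
            exact ⟨0, Or.inr h⟩)) := by
        refine measurable_find _ (fun k => ?_)
        have h2 : MeasurableSet {x | ∀ j, x ∈ W (t ++ [j])} := by
          rw [ofPred_forall]
          exact .iInter fun j => hWm _
        exact (hWm _).compl.union h2
      have : (fun x => nx (x, t)) = (fun k => t ++ [k]) ∘ (fun x : X => Nat.find (p := fun k => x ∉ W (t ++ [k]) ∨ ∀ j, x ∈ W (t ++ [j])) (by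
          by_cases h : ∃ k, x ∉ W (t ++ [k])
          · exact ⟨_, Or.inl h.choose_spec⟩
          · push Not at h
            exact ⟨0, Or.inr h⟩)) := by
        funext x
        simp only [nx, Function.comp]
        congr 2
        split_ifs with h
        · have h' : ¬ ∀ j, x ∈ W (t ++ [j]) := by simpa using h
          simp [h']
        · push Not at h
          symm
          rw [Nat.find_eq_zero]
          exact Or.inr h
      rw [this]
      exact measurable_from_top.comp hm
    let T : ℕ → X → List ℕ := fun n x => Nat.rec s (fun _ t => nx (x, t)) n
    have hT0 : ∀ x, T 0 x = s := fun x => rfl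
    have hTs : ∀ n x, T (n+1) x = nx (x, T n x) := fun n x => rfl
    have hTm : ∀ n, Measurable (T n) := by
      intro n
      induction n with
      | zero => exact measurable_const
      | succ n ih => exact hnx.comp (measurable_id.prodMk ih)
    have hTp : ∀ x n, T n x <+: T (n+1) x := fun x n => by
      rw [hTs]; exact List.prefix_append _ _
    have hTl : ∀ x n, n ≤ (T n x).length := fun x n => by
      induction n with
      | zero => simp
      | succ n ih => rw [hTs]; simp [nx]; exact ih
    have hTL : ∀ x n, s <+: T n x := fun x n => by
      induction n with
      | zero => exact List.prefix_refl _
      | succ n ih => exact ih.trans (hTp x n)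
    let α : X → ℕ → ℕ := fun x i => (T (i+1) x).getD i 0
    have hαm : Measurable α := measurable_pi_iff.2 fun i =>
      (measurable_from_top (f := fun t : List ℕ => t.getD i 0)).comp (hTm (i+1))
    have hsm := hmax s (W' ∩ (W s)ᶜ) (hW'.inter (hWm s).compl) (by
      refine LNsmall.cover W hWs (fun x => (F (α x)).2) (measurable_snd.comp
        ((hF.measurable).comp hαm)) ?_
      filter_upwards [hi] with x hx hxW β hβ hp
      have hTW : ∀ n, x ∉ W (T n x) := by
        intro n
        induction n with
        | zero => exact hxW.2
        | succ n ih =>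
          rw [hTs]
          have := hx _ ih
          simp only [nx, this, dif_pos]
          exact Nat.find_spec this
      by_contra! hcon
      obtain ⟨h1, h2⟩ := hcon
      have hne : F (α x) ≠ F β := fun h => h1 (by rw [h])
      obtain ⟨n, hn⟩ := hsep _ _ hne
      refine hxW.1 ⟨T n x, List.ofFn (fun i : Fin (max n s.length) => β i), hTL x n, prefix_ofFn hβ (by simp),
        hTW n, h2 _ (mem_cyl_ofFn _ _), hn _ _ (hTl x n) (by simp) (getD_chain (fun n => T n x) (hTp x) (hTl x) n)
          (mem_cyl_ofFn _ _)⟩)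
    filter_upwards [hsm] with x hx hxs
    by_contra hcon
    exact hxs (hx ⟨hcon, hxs⟩)
  -- (iii)
  have hiii : ∀ᵐ x ∂μ, ∀ B : TopologicalSpace.countableBasis X, ∀ s, x ∈ (B : Set X) →
      (∀ β ∈ cyl s, (F β).1 ∉ (B : Set X)) → x ∈ W s := by
    haveI := (TopologicalSpace.countable_countableBasis X).to_subtype
    rw [ae_all_iff]; intro B
    rw [ae_all_iff]; intro s
    by_cases h : ∀ β ∈ cyl s, (F β).1 ∉ (B : Set X)
    · filter_upwards [hmax s B (TopologicalSpace.isOpen_of_mem_countableBasis B.2).measurableSet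
        ⟨fun _ _ => f0, fun _ => measurable_const, .of_forall
          fun x hx β hβ hp => absurd (hp ▸ hx) (h β hβ)⟩] with x hx hxB _
      exact hx hxB
    · exact .of_forall fun x _ h' => absurd h' h
  obtain ⟨g, hg1, hg2⟩ := hWs []
  refine ⟨g, hg1, ?_⟩
  filter_upwards [hi, hii, hiii, hg2] with x h1 h2 h3 h4 β hβ
  by_cases hx : x ∈ W []
  · exact h4 hx β (fun i hi => absurd hi (by simp)) hβ
  exfalso
  have hCne : {z ∈ range F | z.1 = x}.Nonempty := ⟨F β, ⟨β, rfl⟩, hβ⟩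
  obtain ⟨z, hz⟩ := (hc x).exists_eq_range hCne
  have step : ∀ (s : {s : List ℕ // x ∉ W s}) (n : ℕ), ∃ t : {s : List ℕ // x ∉ W s}, s.1 <+: t.1 ∧
      s.1.length < t.1.length ∧ z n ∉ closure (F '' cyl t.1) := by
    rintro ⟨s, hs⟩ n
    have : ∃ t, s <+: t ∧ x ∉ W t ∧ z n ∉ closure (F '' cyl t) := by
      obtain ⟨t, t', ht, ht', htW, htW', hd⟩ := h2 s hs
      by_cases hzn : z n ∈ closure (F '' cyl t)
      · exact ⟨t', ht', htW', fun h => disjoint_left.1 hd hzn h⟩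
      · exact ⟨t, ht, htW, hzn⟩
    obtain ⟨t, ht, htW, hzn⟩ := this
    obtain ⟨k, hk⟩ := h1 t htW
    refine ⟨⟨t ++ [k], hk⟩, ht.trans (List.prefix_append _ _), ?_, fun h => hzn ?_⟩
    · have := ht.length_le
      simp; omega
    · exact closure_mono (image_mono (cyl_mono (List.prefix_append _ _))) h
  choose st hst1 hst2 hst3 using step
  let S : ℕ → {s : List ℕ // x ∉ W s} := fun n => Nat.rec ⟨[], hx⟩ (fun n s => st s n) n
  have hSs : ∀ n, S (n+1) = st (S n) n := fun n => rfl
  have hSl : ∀ n, n ≤ (S n).1.length := by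
    intro n
    induction n with
    | zero => simp
    | succ n ih => rw [hSs]; have := hst2 (S n) n; omega
  have hα := getD_chain (fun n => (S n).1) (fun n => by rw [hSs]; exact hst1 _ _) hSl
  set α : ℕ → ℕ := (fun i => ((S (i+1)).1).getD i 0)
  have hαx : (F α).1 = x := by
    by_contra hne
    obtain ⟨U, V, hU, hV, hxU, hαV, hUV⟩ := t2_separation (Ne.symm hne)
    obtain ⟨B, hB, hxB, hBU⟩ := (TopologicalSpace.isBasis_countableBasis X).exists_subset_of_mem_open hxU hU
    obtain ⟨n, hn⟩ := cyl_nhds ((hF.fst.continuousAt (x := α)).preimage_mem_nhds (hV.mem_nhds hαV))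
    have hsub := hn (S n).1 (hSl n) (hα n)
    exact (S n).2 (h3 ⟨B, hB⟩ _ hxB (fun β hβ hh => disjoint_left.1 hUV (hBU hh) (hsub hβ)))
  have : F α ∈ range z := by rw [← hz]; exact ⟨⟨α, rfl⟩, hαx⟩
  obtain ⟨n, hn⟩ := this
  have := hst3 (S n) n
  rw [hn] at this
  exact this (subset_closure ⟨α, hα (n+1), rfl⟩)

end LN

/-- a.e. Lusin-Novikov -/
theorem LN {X Y : Type*} [MeasurableSpace X] [StandardBorelSpace X] [MeasurableSpace Y]
    [StandardBorelSpace Y] [Nonempty Y] (μ : Measure X) [IsFiniteMeasure μ] (A : Set (X × Y))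
    (hA : MeasurableSet A) (hc : ∀ x, {y | (x, y) ∈ A}.Countable) :
    ∃ g : ℕ → X → Y, (∀ i, Measurable (g i)) ∧
    ∀ᵐ x ∂μ, ∀ y, (x, y) ∈ A → ∃ i, g i x = y := by
  letI := upgradeStandardBorel X
  letI := upgradeStandardBorel Y
  have := hA.analyticSet
  rw [AnalyticSet] at this
  rcases this with rfl | ⟨F, hF, hFA⟩
  · exact ⟨fun _ _ => Classical.arbitrary Y, fun _ => measurable_const, .of_forall fun x y h => absurd h (by simp)⟩
  · obtain ⟨g, hg, h⟩ := LN_aux μ F hF (fun x => by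
      rw [hFA]
      refine ((hc x).image (fun y => (x, y))).mono ?_
      rintro ⟨u, v⟩ ⟨h1, h2⟩
      simp only at h2
      subst h2
      exact ⟨v, h1, rfl⟩)
    refine ⟨g, hg, ?_⟩
    filter_upwards [h] with x hx y hy
    rw [← hFA] at hy
    obtain ⟨β, hβ⟩ := hy
    have := hx β (by rw [hβ])
    rwa [hβ] at this

open Classical in
/-- 0-1 valued indicator of a proposition -/
def bi (p : Prop) : ℝ≥0∞ := if p then 1 else 0
theorem bi_pos {p : Prop} (h : p) : bi p = 1 := if_pos h
theorem bi_neg {p : Prop} (h : ¬ p) : bi p = 0 := if_neg h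
theorem bi_le (p : Prop) : bi p ≤ 1 := by unfold bi; split_ifs <;> simp
theorem bi_mono {p q : Prop} (h : p → q) : bi p ≤ bi q := by
  by_cases hp : p
  · rw [bi_pos hp, bi_pos (h hp)]
  · rw [bi_neg hp]; exact zero_le
theorem bi_congr {p q : Prop} (h : p ↔ q) : bi p = bi q := by rw [propext h]
theorem bi_and {p q : Prop} : bi (p ∧ q) = bi p * bi q := by
  by_cases hp : p <;> by_cases hq : q <;> simp [bi, hp, hq]
theorem bi_meas {Z : Type*} [MeasurableSpace Z] {p : Z → Prop} (h : MeasurableSet {z | p z}) :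
    Measurable (fun z => bi (p z)) := by
  classical exact Measurable.ite h measurable_const measurable_const
theorem lintegral_bi {Z : Type*} [MeasurableSpace Z] (m : Measure Z) {p : Z → Prop}
    (h : MeasurableSet {z | p z}) : ∫⁻ z, bi (p z) ∂m = m {z | p z} := by
  rw [← lintegral_indicator_one h]
  refine lintegral_congr fun z => ?_
  by_cases hz : p z
  · rw [bi_pos hz, indicator_of_mem (by exact hz)]; rfl
  · rw [bi_neg hz, indicator_of_notMem (by exact hz)]

structure CB {X : Type*} [MeasurableSpace X] (m : Measure X) where
  E : X → X → Prop
  g : ℕ → X → X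
  w : X → X → ℝ≥0∞
  eqv : Equivalence E
  hE : ∀ x y, E x y ↔ ∃ i, g i x = y
  gm : ∀ i, Measurable (g i)
  wm : Measurable (fun p : X × X => w p.1 p.2)
  w0 : ∀ x y, E x y → w x y ≠ 0
  wt : ∀ x y, E x y → w x y ≠ ∞
  wc : ∀ x y z, E x y → E y z → w z y * w y x = w z x
  mt : ∀ F : X → X → ℝ≥0∞, Measurable (fun p : X × X => F p.1 p.2) → (∀ x y, ¬ E x y → F x y = 0) →
    ∫⁻ x, ∑' y, F x y ∂m = ∫⁻ x, ∑' y, F y x * w y x ∂m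

namespace CB
variable {X : Type*} [MeasurableSpace X] [StandardBorelSpace X] {m : Measure X} (S : CB m)

theorem Eg (i : ℕ) (x : X) : S.E x (S.g i x) := (S.hE _ _).2 ⟨i, rfl⟩
theorem rfl' (x : X) : S.E x x := S.eqv.refl x
theorem sm {x y : X} (h : S.E x y) : S.E y x := S.eqv.symm h
theorem tr {x y z : X} (h : S.E x y) (h' : S.E y z) : S.E x z := S.eqv.trans h h'

theorem Emeas : MeasurableSet {p : X × X | S.E p.1 p.2} := by
  have : {p : X × X | S.E p.1 p.2} = ⋃ i, {p : X × X | S.g i p.1 = p.2} := by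
    ext p; simp [S.hE]
  rw [this]
  exact .iUnion fun i => measurableSet_eq_fun ((S.gm i).comp measurable_fst) measurable_snd

theorem w1 (x : X) : S.w x x = 1 := by
  have h := S.wc x x x (S.rfl' x) (S.rfl' x)
  have h0 := S.w0 x x (S.rfl' x)
  have ht := S.wt x x (S.rfl' x)
  have := (ENNReal.mul_right_inj h0 ht).1 (h.trans (mul_one _).symm)
  exact this

theorem ex_meas {P : X → X → Prop} (hP : MeasurableSet {p : X × X | P p.1 p.2}) :
    MeasurableSet {x | ∃ y, S.E x y ∧ P x y} := by
  have : {x | ∃ y, S.E x y ∧ P x y} = ⋃ i, (fun x => (x, S.g i x)) ⁻¹' {p : X × X | P p.1 p.2} := by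
    ext x; simp only [mem_setOf_eq, mem_iUnion, mem_preimage]
    constructor
    · rintro ⟨y, h, hp⟩
      obtain ⟨i, rfl⟩ := (S.hE _ _).1 h
      exact ⟨i, hp⟩
    · rintro ⟨i, h⟩
      exact ⟨_, S.Eg i x, h⟩
  rw [this]
  exact .iUnion fun i => (measurable_id.prodMk (S.gm i)) hP

theorem all_meas {P : X → X → Prop} (hP : MeasurableSet {p : X × X | P p.1 p.2}) :
    MeasurableSet {x | ∀ y, S.E x y → P x y} := by
  have := (S.ex_meas (P := fun x y => ¬ P x y) hP.compl).compl
  convert this using 1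
  ext x; simp

open Classical in
theorem tsum_eq (F : X → X → ℝ≥0∞) (hF : ∀ x y, ¬ S.E x y → F x y = 0) (x : X) :
    ∑' y, F x y = ∑' i, if (∀ j < i, S.g j x ≠ S.g i x) then F x (S.g i x) else 0 := by
  let I : Set ℕ := {i | ∀ j < i, S.g j x ≠ S.g i x}
  have hinj : Function.Injective (fun i : I => S.g i x) := by
    rintro ⟨i, hi⟩ ⟨j, hj⟩ h
    simp only at h
    rcases lt_trichotomy i j with h1 | h1 | h1
    · exact absurd h (hj i h1)
    · exact Subtype.ext h1
    · exact absurd h.symm (hi j h1)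
  have hsup : Function.support (F x) ⊆ range (fun i : I => S.g i x) := by
    intro y hy
    have hE : S.E x y := by
      by_contra h
      exact hy (hF x y h)
    have hex := (S.hE _ _).1 hE
    refine ⟨⟨Nat.find hex, fun j hj h => Nat.find_min hex hj (h.trans (Nat.find_spec hex))⟩, Nat.find_spec hex⟩
  rw [← hinj.tsum_eq hsup]
  rw [tsum_subtype I (fun i => F x (S.g i x))]
  refine tsum_congr fun i => ?_
  simp only [indicator_apply, I, mem_setOf_eq]

theorem tsum_meas {F : X → X → ℝ≥0∞} (hm : Measurable (fun p : X × X => F p.1 p.2))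
    (hF : ∀ x y, ¬ S.E x y → F x y = 0) : Measurable (fun x => ∑' y, F x y) := by
  classical
  simp_rw [S.tsum_eq F hF]
  refine Measurable.ennreal_tsum fun i => ?_
  refine Measurable.ite ?_ (hm.comp (measurable_id.prodMk (S.gm i))) measurable_const
  have : {x | ∀ j < i, S.g j x ≠ S.g i x} = ⋂ j, ⋂ (_ : j < i), {x | S.g j x = S.g i x}ᶜ := by
    ext; simp
  rw [this]
  exact .iInter fun j => .iInter fun _ => (measurableSet_eq_fun (S.gm j) (S.gm i)).compl

theorem measE {p : X → X → Prop} (h : MeasurableSet {q : X × X | p q.1 q.2}) :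
    MeasurableSet {q : X × X | S.E q.1 q.2 ∧ p q.1 q.2} := S.Emeas.inter h

/-- null saturation -/
theorem sat_null {N : Set X} (hN : m N = 0) : m {x | ∃ y, S.E x y ∧ y ∈ N} = 0 := by
  classical
  obtain ⟨N', hNN', hN'm, hN'0⟩ := exists_measurable_superset_of_null hN
  refine measure_mono_null (t := {x | ∃ y, S.E x y ∧ y ∈ N'}) (fun x ⟨y, h, hy⟩ => ⟨y, h, hNN' hy⟩) ?_
  have hPm : MeasurableSet {q : X × X | S.E q.1 q.2 ∧ q.2 ∈ N'} :=
    S.measE (p := fun x y => y ∈ N') (measurable_snd hN'm)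
  let F : X → X → ℝ≥0∞ := fun x y => bi (S.E x y ∧ y ∈ N')
  have hFm : Measurable (fun p : X × X => F p.1 p.2) := bi_meas hPm
  have hF0 : ∀ x y, ¬ S.E x y → F x y = 0 := fun x y h => by simp [F, bi, h]
  have h := S.mt F hFm hF0
  have h2 : ∫⁻ x, ∑' y, F y x * S.w y x ∂m = 0 := by
    rw [← lintegral_zero (μ := m)]
    apply lintegral_congr_ae
    have : ∀ᵐ x ∂m, x ∉ N' := by rw [ae_iff]; simpa using hN'0
    filter_upwards [this] with x hx
    simp [F, bi, hx]
  rw [h2, lintegral_eq_zero_iff (S.tsum_meas hFm hF0)] at h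
  rw [← nonpos_iff_eq_zero]
  refine (measure_mono ?_).trans (nonpos_iff_eq_zero.2 (ae_iff.1 h))
  rintro x ⟨y, hxy, hy⟩ hz
  have := ENNReal.tsum_eq_zero.1 hz y
  simp [F, bi, hxy, hy] at this

theorem ae_all {p : X → Prop} (h : ∀ᵐ x ∂m, p x) : ∀ᵐ x ∂m, ∀ y, S.E x y → p y := by
  rw [ae_iff] at h ⊢
  convert S.sat_null h using 2
  ext x; simp

theorem Einj {f : X → X} {A : Set X} (hf : Measurable f) (hA : MeasurableSet A) (hi : InjOn f A) :
    MeasurableSet (f '' A) := hA.image_of_measurable_injOn hf hi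

theorem measure_image {f : X → X} {A : Set X} (hf : Measurable f) (hA : MeasurableSet A)
    (hi : InjOn f A) (hE : ∀ x ∈ A, S.E x (f x)) : m (f '' A) = ∫⁻ x in A, S.w (f x) x ∂m := by
  classical
  have hPm : MeasurableSet {q : X × X | q.2 ∈ A ∧ f q.2 = q.1} :=
    (measurable_snd hA).inter (measurableSet_eq_fun (hf.comp measurable_snd) measurable_fst)
  have h := S.mt (fun x y => bi (y ∈ A ∧ f y = x))
    (bi_meas hPm) (fun x y hxy => by
      rw [bi_neg]; rintro ⟨h1, rfl⟩; exact hxy (S.sm (hE y h1)))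
  have e1 : ∀ x, (∑' y, bi (y ∈ A ∧ f y = x)) = (f '' A).indicator 1 x := by
    intro x
    by_cases hx : x ∈ f '' A
    · obtain ⟨y, hy, rfl⟩ := hx
      rw [tsum_eq_single y, indicator_of_mem (mem_image_of_mem f hy)]
      · simp [hy, bi]
      · intro z hz
        rw [bi_neg]
        rintro ⟨h1, h2⟩
        exact hz (hi h1 hy h2)
    · rw [indicator_of_notMem hx, ENNReal.tsum_eq_zero]
      intro y
      rw [bi_neg]
      rintro ⟨h1, h2⟩
      exact hx ⟨y, h1, h2⟩
  have e2 : ∀ x, (∑' y, bi (x ∈ A ∧ f x = y) * S.w y x) = A.indicator (fun x => S.w (f x) x) x := by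
    intro x
    by_cases hx : x ∈ A
    · rw [tsum_eq_single (f x), indicator_of_mem hx]
      · simp [hx, bi]
      · intro z hz
        rw [bi_neg, zero_mul]
        rintro ⟨h1, h2⟩
        exact hz h2.symm
    · simp [hx, bi]
  simp_rw [e1, e2] at h
  rw [lintegral_indicator hA, lintegral_indicator (Einj hf hA hi)] at h
  simpa using h

/-- sub-relations -/
def sub (R : X → X → Prop) (hR : Equivalence R) (hm : MeasurableSet {p : X × X | R p.1 p.2})
    (hRE : ∀ x y, R x y → S.E x y) : CB m := by
  classical exact {
  E := R
  g := fun i x => if R x (S.g i x) then S.g i x else x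
  w := S.w
  eqv := hR
  hE := fun x y => by
    constructor
    · intro h
      obtain ⟨i, rfl⟩ := (S.hE _ _).1 (hRE x y h)
      exact ⟨i, by rw [if_pos h]⟩
    · rintro ⟨i, h⟩
      split_ifs at h with h1
      · rwa [← h]
      · rw [← h]; exact hR.refl x
  gm := fun i => Measurable.ite ((measurable_id.prodMk (S.gm i)) hm) (S.gm i) measurable_id
  wm := S.wm
  w0 := fun x y h => S.w0 x y (hRE x y h)
  wt := fun x y h => S.wt x y (hRE x y h)
  wc := fun x y z h h' => S.wc x y z (hRE _ _ h) (hRE _ _ h')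
  mt := fun F hF h0 => S.mt F hF (fun x y h => h0 x y fun h' => h (hRE _ _ h')) }

def erg (S : CB m) : Prop :=
  ∀ Z, MeasurableSet Z → (∀ x y, S.E x y → x ∈ Z → y ∈ Z) → m Z = 0 ∨ m Zᶜ = 0

def hasS (S : CB m) : Prop := ∃ s : X → ℝ≥0∞, Measurable s ∧ ∀ᵐ x ∂m, s x ≠ 0 ∧ s x ≠ ∞ ∧
  ∀ y, S.E x y → s y * S.w y x = s x

/-- a measurable "nonnull" set of pairs contains the graph of a partial injection -/
theorem exists_pair {P : X → X → Prop} 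
    (h : m {x | ∃ y, S.E x y ∧ P x y} ≠ 0) :
    ∃ i j, m {x | P x (S.g i x) ∧ S.g j (S.g i x) = x} ≠ 0 := by
  by_contra! hcon
  apply h
  refine measure_mono_null (t := ⋃ i, ⋃ j, {x | P x (S.g i x) ∧ S.g j (S.g i x) = x}) ?_
    (measure_iUnion_null fun i => measure_iUnion_null fun j => hcon i j)
  rintro x ⟨y, hxy, hp⟩
  obtain ⟨i, rfl⟩ := (S.hE _ _).1 hxy
  obtain ⟨j, hj⟩ := (S.hE _ _).1 (S.sm hxy)
  exact mem_iUnion.2 ⟨i, mem_iUnion.2 ⟨j, hp, hj⟩⟩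

theorem injOn_pair (i j : ℕ) : InjOn (S.g i) {x | S.g j (S.g i x) = x} := by
  intro x hx y hy h
  have hx' : S.g j (S.g i x) = x := hx
  have hy' : S.g j (S.g i y) = y := hy
  rw [← hx', h, hy']

end CB

namespace CB
variable {X : Type*} [MeasurableSpace X] [StandardBorelSpace X] {m : Measure X} (S : CB m)

theorem push {f : X → X} (hf : Measurable f) (hE : ∀ x, S.E x (f x)) {u : X → ℝ≥0∞} (hu : Measurable u) :
    ∫⁻ x, u x ∂m = ∫⁻ b, ∑' x, u x * bi (f x = b) * S.w x b ∂m := by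
  have h := S.mt (fun x y => u x * bi (f x = y)) ((hu.comp measurable_fst).mul
    (bi_meas (p := fun q : X × X => f q.1 = q.2) (measurableSet_eq_fun (hf.comp measurable_fst) measurable_snd)))
    (fun x y hxy => by rw [bi_neg, mul_zero]; rintro rfl; exact hxy (hE x))
  rw [← h]
  refine lintegral_congr fun x => ?_
  rw [tsum_eq_single (f x), bi_pos rfl, mul_one]
  intro y hy
  rw [bi_neg (Ne.symm hy), mul_zero]

def mass (f : X → X) (P : Set X) (b : X) : ℝ≥0∞ := ∑' x, bi (x ∈ P) * bi (f x = b) * S.w x b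

theorem mass_meas {f : X → X} (hf : Measurable f) (hE : ∀ x, S.E x (f x)) {P : Set X} (hP : MeasurableSet P) :
    Measurable (S.mass f P) := by
  refine S.tsum_meas (F := fun b x => bi (x ∈ P) * bi (f x = b) * S.w x b) ?_ ?_
  · refine ((bi_meas (p := fun q : X × X => q.2 ∈ P) (measurable_snd hP)).mul (bi_meas (p := fun q : X × X => f q.2 = q.1)
      (measurableSet_eq_fun (hf.comp measurable_snd) measurable_fst))).mul ?_
    exact S.wm.comp measurable_swap
  · intro b x h
    rw [bi_neg (p := f x = b), mul_zero, zero_mul]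
    rintro rfl; exact h (S.sm (hE x))

theorem mass_mono {f f' : X → X} {P P' : Set X} {b : X} (h : ∀ x, x ∈ P → f x = b → x ∈ P' ∧ f' x = b) :
    S.mass f P b ≤ S.mass f' P' b := by
  refine ENNReal.tsum_le_tsum fun x => ?_
  refine mul_le_mul_left ?_ _
  rw [← bi_and, ← bi_and]
  exact bi_mono fun ⟨h1, h2⟩ => h x h1 h2

theorem mass_int {f : X → X} (hf : Measurable f) (hE : ∀ x, S.E x (f x)) {P B : Set X}
    (hP : MeasurableSet P) (hB : MeasurableSet B) :
    m {x | x ∈ P ∧ f x ∈ B} = ∫⁻ b in B, S.mass f P b ∂m := by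
  have hm : MeasurableSet {x | x ∈ P ∧ f x ∈ B} := hP.inter (hf hB)
  rw [← lintegral_bi m hm, S.push hf hE (bi_meas hm), ← lintegral_indicator hB]
  refine lintegral_congr fun b => ?_
  by_cases hb : b ∈ B
  · rw [indicator_of_mem hb]
    refine tsum_congr fun x => ?_
    congr 1
    rw [← bi_and, ← bi_and]
    apply bi_congr
    constructor
    · rintro ⟨⟨h1, h2⟩, h3⟩; exact ⟨h1, h3⟩
    · rintro ⟨h1, rfl⟩; exact ⟨⟨h1, hb⟩, rfl⟩
  · rw [indicator_of_notMem hb, ENNReal.tsum_eq_zero]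
    intro x
    rw [← bi_and, bi_neg, zero_mul]
    rintro ⟨⟨h1, h2⟩, rfl⟩; exact hb h2

structure Cell (G : X → X → Prop) (r : X → X) : Prop where
  meas : Measurable r
  idem : ∀ x, r (r x) = r x
  conn : ∀ x, Relation.ReflTransGen (fun u v => G u v ∧ r u = r v) x (r x)

theorem rtg_mono {α : Type*} {R R' : α → α → Prop} (h : ∀ a b, R a b → R' a b) {x y : α}
    (hx : Relation.ReflTransGen R x y) : Relation.ReflTransGen R' x y := by
  induction hx with
  | refl => exact .refl
  | tail _ h' ih => exact ih.tail (h _ _ h')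

theorem rtg_E {G : X → X → Prop} (hG : ∀ x y, G x y → S.E x y) {x y : X}
    (h : Relation.ReflTransGen G x y) : S.E x y := by
  induction h with
  | refl => exact S.rfl' x
  | tail _ h ih => exact S.tr ih (hG _ _ h)

theorem Cell.hE {G : X → X → Prop} {r : X → X} (hr : Cell G r) (hG : ∀ x y, G x y → S.E x y) (x : X) :
    S.E x (r x) := S.rtg_E hG (rtg_mono (fun _ _ h => h.1) (hr.conn x))

theorem rtg_symm {α : Type*} {R : α → α → Prop} (h : ∀ x y, R x y → R y x) {x y : α}
    (hx : Relation.ReflTransGen R x y) : Relation.ReflTransGen R y x :=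
by
  induction hx with
  | refl => exact .refl
  | tail _ h' ih => exact .head (h _ _ h') ih

theorem gain1 {G : X → X → Prop} (hG : ∀ x y, G x y → S.E x y) (hGs : ∀ x y, G x y → G y x)
    {r : X → X} (hr : Cell G r) {Z : Set X} (hZm : MeasurableSet Z) (hZr : ∀ x, x ∈ Z ↔ r x ∈ Z)
    {D : Set X} (hDm : MeasurableSet D) {θ : X → X} (hθ : Measurable θ)
    (hD1 : ∀ x ∈ D, x ∈ Z) (hD2 : ∀ x ∈ D, θ x ∉ Z) (hD3 : ∀ x ∈ D, G x (θ x)) (hinj : InjOn θ D)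
    (hmass : ∀ x ∈ D, S.mass r univ (r x) * S.w (r x) (r (θ x)) ≤ S.mass r univ (r (θ x))) :
    ∃ r', Cell G r' ∧ (∀ x, r' (r x) = r' x) ∧ ∀ Z', MeasurableSet Z' → (∀ x, x ∈ Z' ↔ r' x ∈ Z') →
      ∫⁻ x in D, min 1 (S.w (θ x) x) ∂m ≤ 4 * m (symmDiff Z Z') := by
  classical
  have hrE := hr.hE S hG
  set M := S.mass r univ with hM
  have hMm : Measurable M := S.mass_meas hr.meas hrE .univ
  let Def : ℕ → X → Prop := fun k a => (a ∈ Z ∧ r a = a ∧ S.g k.unpair.1 a ∉ Z ∧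
    r (S.g k.unpair.1 a) = S.g k.unpair.1 a ∧ S.g k.unpair.2 (S.g k.unpair.1 a) = a ∧
    M a * S.w a (S.g k.unpair.1 a) ≤ M (S.g k.unpair.1 a)) ∧
    ∃ x, S.E a x ∧ (x ∈ D ∧ r x = a ∧ r (θ x) = S.g k.unpair.1 a)
  have hDefm : ∀ k, MeasurableSet {a | Def k a} := by
    intro k
    have hg := S.gm k.unpair.1
    refine MeasurableSet.inter (hZm.inter ((measurableSet_eq_fun hr.meas measurable_id).inter
      ((hg hZm.compl).inter ((measurableSet_eq_fun (hr.meas.comp hg) hg).inter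
      ((measurableSet_eq_fun ((S.gm _).comp hg) measurable_id).inter
        (measurableSet_le (hMm.mul (S.wm.comp (measurable_id.prodMk hg))) (hMm.comp hg))))))) ?_
    exact S.ex_meas (P := fun a x => x ∈ D ∧ r x = a ∧ r (θ x) = S.g k.unpair.1 a)
      ((measurable_snd hDm).inter ((measurableSet_eq_fun (hr.meas.comp measurable_snd) measurable_fst).inter
        (measurableSet_eq_fun (hr.meas.comp (hθ.comp measurable_snd)) (hg.comp measurable_fst))))
  let step : ℕ → (X → X) → X → X := fun k ρ x =>
    if Def k (ρ x) ∧ S.mass ρ Z (S.g k.unpair.1 (ρ x)) ≤ M (S.g k.unpair.1 (ρ x)) then S.g k.unpair.1 (ρ x) else ρ x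
  let rk : ℕ → X → X := fun n => Nat.rec r (fun k ρ => step k ρ) n
  have rk0 : rk 0 = r := rfl
  have rks : ∀ k, rk (k+1) = step k (rk k) := fun k => rfl
  have rkstep : ∀ k x, ((Def k (rk k x) ∧ S.mass (rk k) Z (S.g k.unpair.1 (rk k x)) ≤ M (S.g k.unpair.1 (rk k x))) ∧
      rk (k+1) x = S.g k.unpair.1 (rk k x)) ∨ (¬ (Def k (rk k x) ∧ S.mass (rk k) Z (S.g k.unpair.1 (rk k x)) ≤ M (S.g k.unpair.1 (rk k x))) ∧
      rk (k+1) x = rk k x) := by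
    intro k x
    rcases Classical.em (Def k (rk k x) ∧ S.mass (rk k) Z (S.g k.unpair.1 (rk k x)) ≤ M (S.g k.unpair.1 (rk k x))) with h | h
    · exact Or.inl ⟨h, by rw [rks]; simp only [step]; rw [if_pos h]⟩
    · exact Or.inr ⟨h, by rw [rks]; simp only [step]; rw [if_neg h]⟩
  have rkE : ∀ k x, S.E x (rk k x) := by
    intro k
    induction k with
    | zero => exact hrE
    | succ k ih =>
      intro x
      rcases rkstep k x with ⟨h1, e⟩ | ⟨h1, e⟩ <;> rw [e]
      · exact S.tr (ih x) (S.Eg _ _)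
      · exact ih x
  have rkm : ∀ k, Measurable (rk k) := by
    intro k
    induction k with
    | zero => exact hr.meas
    | succ k ih =>
      rw [rks]
      have hg := (S.gm k.unpair.1).comp ih
      refine Measurable.ite ((ih (hDefm k)).inter (measurableSet_le
        ((S.mass_meas ih (rkE k) hZm).comp hg) (hMm.comp hg))) hg ih
  have rkr : ∀ k x, rk k (r x) = rk k x := by
    intro k
    induction k with
    | zero => exact hr.idem
    | succ k ih => intro x; rw [rks]; simp only [step]; rw [ih]
  have rkc : ∀ k x, rk k x ∉ Z → rk (k+1) x = rk k x := by
    intro k x h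
    rcases rkstep k x with ⟨h1, e⟩ | ⟨h1, e⟩
    · exact absurd h1.1.1.1 h
    · exact e
  have rkZ : ∀ k x, rk k x ∈ Z → rk k x = r x := by
    intro k
    induction k with
    | zero => intro x _; rfl
    | succ k ih =>
      intro x h
      rcases rkstep k x with ⟨h1, e⟩ | ⟨h1, e⟩ <;> rw [e] at h ⊢
      · exact absurd h h1.1.1.2.2.1
      · exact ih x h
  have rkn : ∀ k x, x ∉ Z → rk k x = r x := by
    intro k x hx
    induction k with
    | zero => rfl
    | succ k ih => rw [rkc k x, ih]; rw [ih]; exact fun h => hx ((hZr x).2 h)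
  have rkroot : ∀ k x, r (rk k x) = rk k x := by
    intro k
    induction k with
    | zero => exact hr.idem
    | succ k ih =>
      intro x
      rcases rkstep k x with ⟨h1, e⟩ | ⟨h1, e⟩ <;> rw [e]
      · exact h1.1.1.2.2.2.1
      · exact ih x
  have rkcon : ∀ k x, x ∈ Z → rk k x ∉ Z → ∃ x0 ∈ D, r x0 = r x ∧ r (θ x0) = rk k x := by
    intro k x hx
    induction k with
    | zero => intro h; exact absurd ((hZr x).1 hx) h
    | succ k ih =>
      intro h
      by_cases hk : rk k x ∈ Z
      · have e := rkZ k x hk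
        rcases rkstep k x with ⟨h1, e'⟩ | ⟨h1, e'⟩ <;> rw [e'] at h ⊢
        · obtain ⟨x0, -, h2, h3, h4⟩ := h1.1.2
          exact ⟨x0, h2, h3.trans e, h4⟩
        · exact absurd hk h
      · rw [rkc k x hk]; exact ih hk
  have rkmono : ∀ k l x, k ≤ l → rk k x ∉ Z → rk l x = rk k x := by
    intro k l x hkl h
    induction hkl with
    | refl => rfl
    | step _ ih => rw [rkc _ x (by rw [ih]; exact h), ih]
  have load : ∀ k b, b ∉ Z → S.mass (rk k) Z b ≤ 2 * M b := by
    intro k b hb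
    induction k with
    | zero =>
      have : S.mass (rk 0) Z b = 0 := by
        refine ENNReal.tsum_eq_zero.2 fun x => ?_
        rw [← bi_and, bi_neg, zero_mul]
        rintro ⟨h1, rfl⟩
        exact hb ((hZr x).1 h1)
      rw [this]; exact zero_le
    | succ k ih =>
      by_cases hex : ∃ x, rk k x ∈ Z ∧ rk (k+1) x = b
      · obtain ⟨x, hxZ, hxb⟩ := hex
        have hcond : Def k (rk k x) ∧ S.mass (rk k) Z (S.g k.unpair.1 (rk k x)) ≤ M (S.g k.unpair.1 (rk k x))
            ∧ S.g k.unpair.1 (rk k x) = b := by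
          rcases rkstep k x with ⟨h1, e⟩ | ⟨h1, e⟩ <;> rw [e] at hxb
          · exact ⟨h1.1, h1.2, hxb⟩
          · exact absurd (hxb ▸ hxZ) hb
        obtain ⟨hd, hl, hgb⟩ := hcond
        set a := rk k x
        rw [hgb] at hl
        have hab : S.g k.unpair.2 b = a := by rw [← hgb]; exact hd.1.2.2.2.2.1
        have hEab : S.E b a := by rw [← hab]; exact S.Eg _ _
        have hMa : M a * S.w a b ≤ M b := by
          have := hd.1.2.2.2.2.2
          rwa [hgb] at this
        calc S.mass (rk (k+1)) Z b ≤ S.mass (rk k) Z b + M a * S.w a b := by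
              rw [hM]; unfold CB.mass
              rw [← ENNReal.tsum_mul_right, ← ENNReal.tsum_add]
              refine ENNReal.tsum_le_tsum fun z => ?_
              by_cases hz : z ∈ Z ∧ rk (k+1) z = b
              · obtain ⟨hz1, hz2⟩ := hz
                rw [bi_pos hz1, bi_pos hz2]
                by_cases hz3 : rk k z ∈ Z
                · have e1 : S.g k.unpair.2 (S.g k.unpair.1 (rk k z)) = rk k z ∧ S.g k.unpair.1 (rk k z) = b := by
                    rcases rkstep k z with ⟨h1, e⟩ | ⟨h1, e⟩ <;> rw [e] at hz2
                    · exact ⟨h1.1.1.2.2.2.2.1, hz2⟩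
                    · exact absurd (hz2 ▸ hz3) hb
                  have e2 : r z = a := by
                    rw [← rkZ k z hz3, ← hab, ← e1.1, e1.2]
                  rw [bi_pos (p := r z = a) e2, bi_pos (p := z ∈ univ) trivial, one_mul, one_mul, one_mul]
                  simp only [one_mul]
                  rw [S.wc b a z hEab (by rw [← e2]; exact S.sm (hrE z))]
                  exact le_add_self
                · rw [rkc k z hz3] at hz2
                  rw [bi_pos hz2]
                  exact le_self_add
              · rw [← bi_and, bi_neg hz, zero_mul]; exact zero_le
          _ ≤ M b + M b := add_le_add hl hMa
          _ = 2 * M b := (two_mul _).symm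
      · refine le_trans (S.mass_mono fun z hz1 hz2 => ⟨hz1, ?_⟩) ih
        by_cases hz3 : rk k z ∈ Z
        · exact absurd ⟨z, hz3, hz2⟩ hex
        · rw [← rkc k z hz3, hz2]
  -- the limit
  let r' : X → X := fun x => if h : ∃ k, rk k x ∉ Z then rk h.choose x else r x
  have r'1 : ∀ k x, rk k x ∉ Z → r' x = rk k x := by
    intro k x h
    have hex : ∃ k, rk k x ∉ Z := ⟨k, h⟩
    simp only [r', dif_pos hex]
    rcases le_total k hex.choose with hh | hh
    · exact rkmono _ _ _ hh h
    · exact (rkmono _ _ _ hh hex.choose_spec).symm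
  have r'2 : ∀ x, (∀ k, rk k x ∈ Z) → r' x = r x := by
    intro x h
    simp only [r']
    rw [dif_neg]; push Not; exact h
  have r'm : Measurable r' := by
    intro B hB
    have : r' ⁻¹' B = (⋃ k, rk k ⁻¹' (Zᶜ ∩ B)) ∪ ((⋂ k, rk k ⁻¹' Z) ∩ r ⁻¹' B) := by
      ext x
      simp only [mem_preimage, mem_union, mem_iUnion, mem_inter_iff, mem_iInter, mem_compl_iff]
      by_cases h : ∃ k, rk k x ∉ Z
      · obtain ⟨k, hk⟩ := h
        rw [r'1 k x hk]
        constructor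
        · intro h; exact Or.inl ⟨k, hk, h⟩
        · rintro (⟨l, h1, h2⟩ | ⟨h1, _⟩)
          · rw [← r'1 k x hk, r'1 l x h1]; exact h2
          · exact absurd (h1 k) hk
      · push Not at h
        rw [r'2 x h]
        constructor
        · intro h'; exact Or.inr ⟨h, h'⟩
        · rintro (⟨l, h1, h2⟩ | ⟨_, h2⟩)
          · exact absurd (h l) h1
          · exact h2
    rw [this]
    exact (MeasurableSet.iUnion fun k => rkm k (hZm.compl.inter hB)).union
      ((MeasurableSet.iInter fun k => rkm k hZm).inter (hr.meas hB))
  have r'r : ∀ x, r' (r x) = r' x := by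
    intro x
    by_cases h : ∃ k, rk k x ∉ Z
    · obtain ⟨k, hk⟩ := h
      rw [r'1 k x hk, r'1 k (r x) (by rwa [rkr]), rkr]
    · push Not at h
      rw [r'2 x h, r'2 (r x) (by simpa [rkr] using h), hr.idem]
  have r'n : ∀ x, x ∉ Z → r' x = r x := by
    intro x hx
    rw [r'1 0 x]; rfl
    exact fun h => hx ((hZr x).2 h)
  have r'i : ∀ x, r' (r' x) = r' x := by
    intro x
    by_cases h : ∃ k, rk k x ∉ Z
    · obtain ⟨k, hk⟩ := h
      rw [r'1 k x hk, r'n _ hk, rkroot]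
    · push Not at h
      conv_lhs => rw [r'2 x h]
      exact r'r x
  have r'E : ∀ x, S.E x (r' x) := by
    intro x
    by_cases h : ∃ k, rk k x ∉ Z
    · obtain ⟨k, hk⟩ := h
      rw [r'1 k x hk]; exact rkE k x
    · push Not at h
      rw [r'2 x h]; exact hrE x
  have rr' : ∀ {u v}, r u = r v → r' u = r' v := fun {u v} h => by rw [← r'r u, h, r'r v]
  have conn1 : ∀ x, Relation.ReflTransGen (fun u v => G u v ∧ r' u = r' v) x (r x) := fun x =>
    rtg_mono (fun u v h => ⟨h.1, rr' h.2⟩) (hr.conn x)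
  have conn2 : ∀ x, Relation.ReflTransGen (fun u v => G u v ∧ r' u = r' v) (r x) x := fun x =>
    rtg_symm (fun u v h => ⟨hGs _ _ h.1, h.2.symm⟩) (conn1 x)
  refine ⟨r', ⟨r'm, r'i, ?_⟩, r'r, ?_⟩
  · intro x
    by_cases hx : x ∈ Z
    swap
    · rw [r'n x hx]; exact conn1 x
    by_cases h : ∃ k, rk k x ∉ Z
    · obtain ⟨k, hk⟩ := h
      have e := r'1 k x hk
      obtain ⟨x0, hx0, h1, h2⟩ := rkcon k x hx hk
      rw [e]
      have p1 := conn1 x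
      have p2 := conn2 x0
      have p3 := conn1 (θ x0)
      rw [h1] at p2
      rw [h2] at p3
      refine (p1.trans p2).trans (Relation.ReflTransGen.head ⟨hD3 x0 hx0, ?_⟩ p3)
      rw [rr' h1, e, r'n _ (hD2 x0 hx0), h2]
    · push Not at h
      rw [r'2 x h]; exact conn1 x
  -- mass of r'
  have loadmono : ∀ k b, b ∉ Z → S.mass (rk k) Z b ≤ S.mass r' Z b := fun k b hb =>
    S.mass_mono fun x h1 h2 => ⟨h1, by rw [r'1 k x (by rw [h2]; exact hb), h2]⟩
  have load' : ∀ b, b ∉ Z → S.mass r' Z b ≤ 2 * M b := by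
    intro b hb
    unfold CB.mass
    rw [ENNReal.tsum_eq_iSup_sum]
    refine iSup_le fun s => ?_
    have : ∃ k, ∀ x ∈ s, r' x = b → rk k x = b := by
      have h1 : ∀ x, r' x = b → ∃ k, rk k x = b := by
        intro x hx
        by_cases h : ∃ k, rk k x ∉ Z
        · obtain ⟨k, hk⟩ := h
          exact ⟨k, by rw [← r'1 k x hk, hx]⟩
        · push Not at h
          exact ⟨0, by rw [← hx, r'2 x h]; rfl⟩
      let κ : X → ℕ := fun x => if h : r' x = b then (h1 x h).choose else 0
      refine ⟨s.sup κ, fun x hx h => ?_⟩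
      have hκ : rk (κ x) x = b := by simp only [κ, dif_pos h]; exact (h1 x h).choose_spec
      rw [rkmono _ _ x (Finset.le_sup hx) (by rw [hκ]; exact hb), hκ]
    obtain ⟨k, hk⟩ := this
    refine le_trans ?_ (load k b hb)
    refine le_trans (Finset.sum_le_sum fun x hx => ?_) (ENNReal.sum_le_tsum s)
    gcongr
    exact bi_mono (hk x hx)
  intro Z' hZ'm hZ'
  have hYs : m {x | x ∈ Z ∧ r' x ∈ Zᶜ} = ∫⁻ b in Zᶜ, S.mass r' Z b ∂m := S.mass_int r'm r'E hZm hZm.compl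
  set Ys := {x | x ∈ Z ∧ r' x ∈ Zᶜ}
  have hYsm : MeasurableSet Ys := hZm.inter (r'm hZm.compl)
  have hmm := S.mass_meas r'm r'E hZm
  set Sat : Set X := {b | b ∉ Z ∧ M b ≤ S.mass r' Z b} with hSat
  have hSatm : MeasurableSet Sat := hZm.compl.inter (measurableSet_le hMm hmm)
  have hYsat := S.mass_int hr.meas hrE hZm.compl hSatm
  set Ysat := {x | x ∈ Zᶜ ∧ r x ∈ Sat}
  have hYsatm : MeasurableSet Ysat := hZm.compl.inter (hr.meas hSatm)
  have i1 : m Ysat ≤ m Ys := by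
    rw [hYsat, hYs]
    refine le_trans (setLIntegral_mono hmm (fun b hb => ?_)) (lintegral_mono_set (fun b hb => hb.1))
    exact le_trans (S.mass_mono fun x _ h => ⟨trivial, h⟩) hb.2
  have i2 : ∫⁻ x in D, min 1 (S.w (θ x) x) ∂m ≤ m Ys + m Ysat := by
    have hsub : D ⊆ Ys ∪ (D ∩ θ ⁻¹' Ysat) := by
      intro x hx
      by_cases hxs : x ∈ Ys
      · exact Or.inl hxs
      right
      refine ⟨hx, hD2 x hx, ?_, ?_⟩
      · exact fun h => hD2 x hx ((hZr _).2 h)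
      have hall : ∀ k, rk k x ∈ Z := by
        by_contra! h
        obtain ⟨k, hk⟩ := h
        exact hxs ⟨hD1 x hx, by rw [r'1 k x hk]; exact hk⟩
      have hab : S.E (r x) (r (θ x)) := S.tr (S.sm (hrE x)) (S.tr (hG _ _ (hD3 x hx)) (hrE _))
      obtain ⟨i, hi⟩ := (S.hE _ _).1 hab
      obtain ⟨j, hj⟩ := (S.hE _ _).1 (S.sm hab)
      have hbZ : r (θ x) ∉ Z := fun h => hD2 x hx ((hZr _).2 h)
      have hk := hall (Nat.pair i j + 1)
      have ek := rkZ _ x (hall (Nat.pair i j))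
      rcases rkstep (Nat.pair i j) x with ⟨hc, e⟩ | ⟨hc, e⟩
      · rw [e, ek, Nat.unpair_pair] at hk
        dsimp only at hk
        rw [hi] at hk
        exact absurd hk hbZ
      · rw [ek, Nat.unpair_pair] at hc
        dsimp only at hc
        rw [hi] at hc
        have hdef : Def (Nat.pair i j) (r x) := by
          simp only [Def, Nat.unpair_pair, hi, hj]
          exact ⟨⟨(hZr x).1 (hD1 x hx), hr.idem x, hbZ, hr.idem _, trivial, hmass x hx⟩, x, S.sm (hrE x), hx, rfl, rfl⟩
        have := not_le.1 (fun h => hc ⟨hdef, h⟩)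
        exact this.le.trans (loadmono _ _ hbZ)
    have hA : MeasurableSet (D ∩ θ ⁻¹' Ysat) := hDm.inter (hθ hYsatm)
    calc ∫⁻ x in D, min 1 (S.w (θ x) x) ∂m ≤ ∫⁻ x in Ys ∪ (D ∩ θ ⁻¹' Ysat), min 1 (S.w (θ x) x) ∂m :=
          lintegral_mono_set hsub
      _ ≤ ∫⁻ x in Ys, min 1 (S.w (θ x) x) ∂m + ∫⁻ x in D ∩ θ ⁻¹' Ysat, min 1 (S.w (θ x) x) ∂m :=
          lintegral_union_le _ _ _
      _ ≤ ∫⁻ x in Ys, 1 ∂m + ∫⁻ x in D ∩ θ ⁻¹' Ysat, S.w (θ x) x ∂m := by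
          gcongr
          · exact min_le_left _ _
          · exact min_le_right _ _
      _ ≤ m Ys + m Ysat := by
          rw [← S.measure_image hθ hA (hinj.mono inter_subset_left) (fun x hx => hG _ _ (hD3 x hx.1))]
          gcongr
          · simp
          · rintro _ ⟨x, hx, rfl⟩; exact hx.2
  have i3 : m Ys ≤ 2 * m (symmDiff Z Z') := by
    have hB : (Zᶜ : Set X) ⊆ (Zᶜ ∩ Z') ∪ (Zᶜ ∩ Z'ᶜ) := by
      intro x hx
      by_cases h : x ∈ Z'
      · exact Or.inl ⟨hx, h⟩
      · exact Or.inr ⟨hx, h⟩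
    have j1 : ∫⁻ b in Zᶜ ∩ Z', S.mass r' Z b ∂m ≤ 2 * m (Z' \ Z) := by
      have : m {x | x ∈ Zᶜ ∧ r x ∈ Zᶜ ∩ Z'} ≤ m (Z' \ Z) := by
        refine measure_mono ?_
        rintro x ⟨h1, h2, h3⟩
        refine ⟨?_, h1⟩
        rw [hZ', ← r'r, ← hZ']; exact h3
      refine le_trans ?_ (mul_le_mul_right this 2)
      rw [S.mass_int hr.meas hrE hZm.compl (hZm.compl.inter hZ'm), ← lintegral_const_mul _ (S.mass_meas hr.meas hrE hZm.compl)]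
      refine setLIntegral_mono ((S.mass_meas hr.meas hrE hZm.compl).const_mul _) (fun b hb => (load' b hb.1).trans ?_)
      gcongr
      refine S.mass_mono fun x _ h => ⟨?_, h⟩
      intro hx
      rw [hZr, h] at hx
      exact hb.1 hx
    have j2 : ∫⁻ b in Zᶜ ∩ Z'ᶜ, S.mass r' Z b ∂m ≤ m (Z \ Z') := by
      rw [← S.mass_int r'm r'E hZm (hZm.compl.inter hZ'm.compl)]
      refine measure_mono ?_
      rintro x ⟨h1, h2, h3⟩
      refine ⟨h1, fun h => h3 ((hZ' x).1 h)⟩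
    have j3 : m (symmDiff Z Z') = m (Z \ Z') + m (Z' \ Z) := by
      rw [Set.symmDiff_def, measure_union disjoint_sdiff_sdiff (hZ'm.diff hZm)]
    rw [hYs, j3]
    calc _ ≤ _ := lintegral_mono_set hB
      _ ≤ _ := lintegral_union_le _ _ _
      _ ≤ _ := add_le_add j1 j2
      _ ≤ 2 * m (Z' \ Z) + 2 * m (Z \ Z') := by
        gcongr
        nth_rw 1 [← one_mul (m (Z \ Z'))]
        gcongr
        norm_num
      _ = _ := by ring
  calc _ ≤ _ := i2
    _ ≤ m Ys + m Ys := by gcongr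
    _ ≤ 2 * m (symmDiff Z Z') + 2 * m (symmDiff Z Z') := add_le_add i3 i3
    _ = _ := by ring

end CB

namespace CB
variable {X : Type*} [MeasurableSpace X] [StandardBorelSpace X] {m : Measure X} (S : CB m)

theorem lint_image {f : X → X} {A : Set X} (hf : Measurable f) (hA : MeasurableSet A)
    (hi : InjOn f A) (hE : ∀ x ∈ A, S.E x (f x)) {u : X → ℝ≥0∞} (hu : Measurable u) :
    ∫⁻ y in f '' A, u y ∂m = ∫⁻ x in A, u (f x) * S.w (f x) x ∂m := by
  classical
  have hPm : MeasurableSet {q : X × X | q.2 ∈ A ∧ f q.2 = q.1} :=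
    (measurable_snd hA).inter (measurableSet_eq_fun (hf.comp measurable_snd) measurable_fst)
  have h := S.mt (fun x y => bi (y ∈ A ∧ f y = x) * u x)
    ((bi_meas hPm).mul (hu.comp measurable_fst)) (fun x y hxy => by
      rw [bi_neg, zero_mul]; rintro ⟨h1, rfl⟩; exact hxy (S.sm (hE y h1)))
  have hm : MeasurableSet (f '' A) := hA.image_of_measurable_injOn hf hi
  rw [← lintegral_indicator hm, ← lintegral_indicator hA]
  refine Eq.trans (lintegral_congr fun x => ?_) (h.trans (lintegral_congr fun x => ?_))
  · by_cases hx : x ∈ f '' A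
    · obtain ⟨y, hy, rfl⟩ := hx
      rw [indicator_of_mem (mem_image_of_mem f hy), tsum_eq_single y, bi_pos ⟨hy, rfl⟩, one_mul]
      intro z hz
      rw [bi_neg, zero_mul]
      rintro ⟨h1, h2⟩; exact hz (hi h1 hy h2)
    · rw [indicator_of_notMem hx]
      symm
      refine ENNReal.tsum_eq_zero.2 fun y => ?_
      rw [bi_neg, zero_mul]
      rintro ⟨h1, h2⟩; exact hx ⟨y, h1, h2⟩
  · by_cases hx : x ∈ A
    · rw [indicator_of_mem hx, tsum_eq_single (f x), bi_pos ⟨hx, rfl⟩, one_mul]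
      intro z hz
      rw [bi_neg, zero_mul, zero_mul]
      rintro ⟨h1, h2⟩; exact hz h2.symm
    · rw [indicator_of_notMem hx]
      refine ENNReal.tsum_eq_zero.2 fun y => ?_
      rw [bi_neg, zero_mul, zero_mul]
      rintro ⟨h1, h2⟩; exact hx h1

theorem gain {G : X → X → Prop} (hG : ∀ x y, G x y → S.E x y) (hGs : ∀ x y, G x y → G y x)
    {r : X → X} (hr : Cell G r) {Z : Set X} (hZm : MeasurableSet Z) (hZr : ∀ x, x ∈ Z ↔ r x ∈ Z)
    {D : Set X} (hDm : MeasurableSet D) (i j : ℕ) (hD0 : ∀ x ∈ D, S.g j (S.g i x) = x)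
    (hD1 : ∀ x ∈ D, x ∈ Z) (hD2 : ∀ x ∈ D, S.g i x ∉ Z) (hD3 : ∀ x ∈ D, G x (S.g i x)) :
    ∃ r', Cell G r' ∧ (∀ x, r' (r x) = r' x) ∧ ∀ Z', MeasurableSet Z' → (∀ x, x ∈ Z' ↔ r' x ∈ Z') →
      ∫⁻ x in D, min 1 (S.w (S.g i x) x) ∂m ≤ 8 * m (symmDiff Z Z') := by
  have hrE := hr.hE S hG
  have hgm := S.gm i
  set M := S.mass r univ with hM
  have hMm : Measurable M := S.mass_meas hr.meas hrE .univ
  set D1 := {x | x ∈ D ∧ M (r x) * S.w (r x) (r (S.g i x)) ≤ M (r (S.g i x))} with hD1d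
  have hD1m : MeasurableSet D1 := hDm.inter (measurableSet_le ((hMm.comp hr.meas).mul
    (S.wm.comp (hr.meas.prodMk (hr.meas.comp hgm)))) (hMm.comp (hr.meas.comp hgm)))
  have hD2m : MeasurableSet (D \ D1) := hDm.diff hD1m
  have hle : ∫⁻ x in D, min 1 (S.w (S.g i x) x) ∂m ≤ ∫⁻ x in D1, min 1 (S.w (S.g i x) x) ∂m +
      ∫⁻ x in D \ D1, min 1 (S.w (S.g i x) x) ∂m := by
    refine (lintegral_mono_set ?_).trans (lintegral_union_le _ _ _)
    intro x hx
    by_cases h : x ∈ D1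
    · exact Or.inl h
    · exact Or.inr ⟨hx, h⟩
  have hinj : InjOn (S.g i) D := (S.injOn_pair i j).mono hD0
  rcases le_total (∫⁻ x in D \ D1, min 1 (S.w (S.g i x) x) ∂m) (∫⁻ x in D1, min 1 (S.w (S.g i x) x) ∂m) with h | h
  · obtain ⟨r', h1, h2, h3⟩ := S.gain1 hG hGs hr hZm hZr hD1m hgm (fun x hx => hD1 x hx.1) (fun x hx => hD2 x hx.1)
      (fun x hx => hD3 x hx.1) (hinj.mono (fun x hx => hx.1)) (fun x hx => hx.2)
    refine ⟨r', h1, h2, fun Z' hm hi => hle.trans ?_⟩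
    have := h3 Z' hm hi
    calc _ ≤ 4 * m (symmDiff Z Z') + 4 * m (symmDiff Z Z') := add_le_add this (h.trans this)
      _ = _ := by ring
  · have hD2m' : MeasurableSet (S.g i '' (D \ D1)) := hD2m.image_of_measurable_injOn hgm (hinj.mono diff_subset)
    obtain ⟨r', h1, h2, h3⟩ := S.gain1 hG hGs hr hZm.compl (fun x => not_congr (hZr x)) hD2m' (S.gm j)
      (by rintro _ ⟨x, hx, rfl⟩; exact hD2 x hx.1)
      (by rintro _ ⟨x, hx, rfl⟩; rw [hD0 x hx.1]; exact fun h => h (hD1 x hx.1))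
      (by rintro _ ⟨x, hx, rfl⟩; rw [hD0 x hx.1]; exact hGs _ _ (hD3 x hx.1))
      (by rintro _ ⟨x, hx, rfl⟩ _ ⟨y, hy, rfl⟩ h; rw [hD0 x hx.1, hD0 y hy.1] at h; rw [h])
      (by
        rintro _ ⟨x, hx, rfl⟩; rw [hD0 x hx.1]
        have h5 : ¬ (M (r x) * S.w (r x) (r (S.g i x)) ≤ M (r (S.g i x))) := fun h => hx.2 ⟨hx.1, h⟩
        have hab : S.E (r x) (r (S.g i x)) := S.tr (S.sm (hrE x)) (S.tr (S.Eg i x) (hrE _))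
        calc S.mass r univ (r (S.g i x)) * S.w (r (S.g i x)) (r x) ≤ (M (r x) * S.w (r x) (r (S.g i x))) * S.w (r (S.g i x)) (r x) :=
              mul_le_mul_left (not_le.1 h5).le _
          _ = M (r x) := by rw [mul_assoc, S.wc _ _ _ hab (S.sm hab), S.w1, mul_one])
    refine ⟨r', h1, h2, fun Z' hm hi => hle.trans ?_⟩
    have := h3 Z'ᶜ hm.compl (fun x => not_congr (hi x))
    rw [compl_symmDiff_compl, S.lint_image hgm hD2m (hinj.mono diff_subset) (fun x _ => S.Eg _ _)
      (u := fun y => min 1 (S.w (S.g j y) y)) (measurable_const.min (S.wm.comp ((S.gm j).prodMk measurable_id)))] at this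
    have e : ∫⁻ x in D \ D1, min 1 (S.w (S.g j (S.g i x)) (S.g i x)) * S.w (S.g i x) x ∂m =
        ∫⁻ x in D \ D1, min 1 (S.w (S.g i x) x) ∂m := by
      refine setLIntegral_congr_fun hD2m fun x hx => ?_
      rw [hD0 x hx.1]
      have e1 : S.w x (S.g i x) * S.w (S.g i x) x = 1 := by
        rw [S.wc _ _ _ (S.Eg _ _) (S.sm (S.Eg _ _)), S.w1]
      rcases le_total 1 (S.w x (S.g i x)) with h6 | h6
      · rw [min_eq_left h6, one_mul, min_eq_right]
        rw [← e1]; nth_rw 1 [← one_mul (S.w (S.g i x) x)]; exact mul_le_mul_left h6 _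
      · rw [min_eq_right h6, e1, min_eq_left]
        rw [← e1]; nth_rw 2 [← one_mul (S.w (S.g i x) x)]; exact mul_le_mul_left h6 _
    rw [e] at this
    calc _ ≤ 4 * m (symmDiff Z Z') + 4 * m (symmDiff Z Z') := add_le_add (h.trans this) this
      _ = _ := by ring

def dst (m : Measure X) (B : Set X) (r : X → X) : ℝ≥0∞ :=
  ⨅ (Z' : Set X) (_ : MeasurableSet Z' ∧ ∀ x, x ∈ Z' ↔ r x ∈ Z'), m (symmDiff B Z')

theorem dst_step [IsFiniteMeasure m] {G : X → X → Prop} (B : Set X) {ε : ℝ≥0∞} (hε : ε ≠ 0)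
    {r : X → X} (hr : Cell G r) : ∃ r', Cell G r' ∧ (∀ x, r' (r x) = r' x) ∧
      ∀ r'', Cell G r'' → (∀ x, r'' (r x) = r'' x) → dst m B r'' ≤ dst m B r' + ε := by
  set s := ⨆ (r'' : X → X) (_ : Cell G r'' ∧ (∀ x, r'' (r x) = r'' x)), dst m B r'' with hs
  have hle : ∀ r'', Cell G r'' → (∀ x, r'' (r x) = r'' x) → dst m B r'' ≤ s := fun r'' h1 h2 =>
    le_iSup₂_of_le r'' ⟨h1, h2⟩ le_rfl
  have hsf : s ≠ ∞ := by
    refine ne_top_of_le_ne_top (measure_ne_top m univ) (iSup₂_le fun r'' _ => ?_)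
    refine iInf₂_le_of_le univ ⟨.univ, fun x => by simp⟩ (measure_mono (subset_univ _))
  by_cases h0 : s = 0
  · exact ⟨r, hr, hr.idem, fun r'' h1 h2 => ((hle r'' h1 h2).trans h0.le).trans zero_le⟩
  · have : s - ε < s := ENNReal.sub_lt_self hsf h0 hε
    obtain ⟨r', h'⟩ := lt_iSup_iff.1 (this.trans_eq hs)
    obtain ⟨h1, h2⟩ := lt_iSup_iff.1 h'
    exact ⟨r', h1.1, h1.2, fun r'' h3 h4 => (hle r'' h3 h4).trans (tsub_le_iff_right.1 h2.le)⟩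

theorem chain [IsFiniteMeasure m] {G : X → X → Prop} (hG : ∀ x y, G x y → S.E x y) (hGs : ∀ x y, G x y → G y x)
    (hGm : MeasurableSet {p : X × X | G p.1 p.2}) (hconn : ∀ x y, S.E x y → Relation.ReflTransGen G x y)
    (herg : S.erg) : ∃ r : ℕ → X → X, (∀ n, Cell G (r n)) ∧ (∀ n x, r (n+1) (r n x) = r (n+1) x) ∧
      ∀ Z, MeasurableSet Z → (∀ n x, x ∈ Z ↔ r n x ∈ Z) → m Z = 0 ∨ m Zᶜ = 0 := by
  obtain ⟨𝒜, hAc, hAd⟩ := MeasureTheory.exists_countable_measureDense (μ := m)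
  obtain ⟨B, hB⟩ := hAc.exists_eq_range hAd.nonempty
  have hε : ∀ n : ℕ, ((n : ℝ≥0∞) + 1)⁻¹ ≠ 0 := fun n => by
    rw [Ne, ENNReal.inv_eq_zero]; exact_mod_cast ENNReal.natCast_ne_top (n+1)
  let step : ℕ → {r : X → X // Cell G r} → {r : X → X // Cell G r} := fun n r =>
    ⟨(dst_step (m := m) (B n.unpair.1) (hε n) r.2).choose, (dst_step (m := m) (B n.unpair.1) (hε n) r.2).choose_spec.1⟩
  have hstep : ∀ n (r : {r : X → X // Cell G r}), (∀ x, (step n r).1 (r.1 x) = (step n r).1 x) ∧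
      ∀ r'', Cell G r'' → (∀ x, r'' (r.1 x) = r'' x) → dst m (B n.unpair.1) r'' ≤ dst m (B n.unpair.1) (step n r).1 + ((n : ℝ≥0∞) + 1)⁻¹ :=
    fun n r => (dst_step (m := m) (B n.unpair.1) (hε n) r.2).choose_spec.2
  let rr : ℕ → {r : X → X // Cell G r} := fun n => Nat.rec ⟨id, measurable_id, fun _ => rfl, fun _ => .refl⟩ step n
  have hrr : ∀ n, rr (n+1) = step n (rr n) := fun n => rfl
  refine ⟨fun n => (rr n).1, fun n => (rr n).2, fun n => (hstep n (rr n)).1, ?_⟩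
  intro Z hZm hZ
  by_contra! hcon
  obtain ⟨hZ0, hZ1⟩ := hcon
  let P : X → X → Prop := fun x y => (x ∈ Z ∧ y ∉ Z) ∧ G x y
  have hPm : MeasurableSet {p : X × X | P p.1 p.2} :=
    ((measurable_fst hZm).inter (measurable_snd hZm.compl)).inter hGm
  have hnn : m {x | ∃ y, S.E x y ∧ P x y} ≠ 0 := by
    intro h0
    have h1 : ∀ᵐ x ∂m, ¬ ∃ y, S.E x y ∧ P x y := by rw [ae_iff]; simpa using h0
    have h2 := S.ae_all h1
    let Z1 : Set X := {x | ∀ y, S.E x y → y ∈ Z}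
    have hZ1m : MeasurableSet Z1 := S.all_meas (P := fun x y => y ∈ Z) (measurable_snd hZm)
    have hZZ : m (Z \ Z1) = 0 := by
      rw [ae_iff] at h2
      refine measure_mono_null ?_ h2
      rintro x ⟨hx, hx1⟩ hcon
      apply hx1
      intro y hy
      have : ∀ z, Relation.ReflTransGen G x z → z ∈ Z := by
        intro z hz
        induction hz with
        | refl => exact hx
        | tail h h' ih =>
          by_contra hc
          exact hcon _ (S.rtg_E hG h) ⟨_, hG _ _ h', ⟨ih, hc⟩, h'⟩
      exact this y (hconn x y hy)
    have hsub : Z1 ⊆ Z := fun x hx => hx x (S.rfl' x)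
    rcases herg Z1 hZ1m (fun x y hxy hx z hz => hx z (S.tr hxy hz)) with h | h
    · apply hZ0
      refine measure_mono_null (t := Z1 ∪ (Z \ Z1)) ?_ (measure_union_null h hZZ)
      intro x hx; by_cases hx1 : x ∈ Z1
      · exact Or.inl hx1
      · exact Or.inr ⟨hx, hx1⟩
    · exact hZ1 (measure_mono_null (compl_subset_compl.2 hsub) h)
  obtain ⟨i, j, hD⟩ := S.exists_pair hnn
  set D := {x | P x (S.g i x) ∧ S.g j (S.g i x) = x} with hDd
  have hDm : MeasurableSet D := by
    have : MeasurableSet {x | P x (S.g i x)} := (measurable_id.prodMk (S.gm i)) hPm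
    exact this.inter (measurableSet_eq_fun ((S.gm j).comp (S.gm i)) measurable_id)
  set c0 := ∫⁻ x in D, min 1 (S.w (S.g i x) x) ∂m with hc0
  have hc0' : c0 ≠ 0 := by
    intro h
    have hmm : Measurable (fun x => min 1 (S.w (S.g i x) x)) :=
      measurable_const.min (S.wm.comp ((S.gm i).prodMk measurable_id))
    rw [hc0, lintegral_eq_zero_iff hmm] at h
    apply hD
    have h' : ∀ᵐ x ∂(m.restrict D), False := by
      filter_upwards [h] with x hx
      have : min 1 (S.w (S.g i x) x) = 0 := hx
      rw [min_eq_iff] at this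
      rcases this with h | h
      · exact one_ne_zero h.1
      · exact S.w0 _ _ (S.sm (S.Eg i x)) h.1
    rw [Filter.eventually_false_iff_eq_bot, ae_eq_bot, Measure.restrict_eq_zero] at h'
    exact h'
  have hc0t : c0 ≠ ∞ := by
    refine ne_top_of_le_ne_top (measure_ne_top m univ) ?_
    calc c0 ≤ ∫⁻ x in D, 1 ∂m := lintegral_mono fun x => min_le_left _ _
      _ ≤ m univ := by simp; exact measure_mono (subset_univ _)
  set δ := c0 / 32 with hδ
  have hδc : c0 = 32 * δ := by rw [hδ, ENNReal.mul_div_cancel (by norm_num) (by norm_num)]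
  have hδ0 : δ ≠ 0 := by intro h; rw [h, mul_zero] at hδc; exact hc0' hδc
  have hδt : δ ≠ ∞ := by intro h; rw [h] at hδc; apply hc0t; rw [hδc]; exact ENNReal.mul_top (by norm_num)
  obtain ⟨_, htA, ht⟩ := hAd.approx Z hZm (measure_ne_top _ _) δ.toReal (ENNReal.toReal_pos hδ0 hδt)
  rw [hB] at htA
  obtain ⟨k, rfl⟩ := htA
  rw [ENNReal.ofReal_toReal hδt] at ht
  obtain ⟨N, hN⟩ := ENNReal.exists_inv_nat_lt hδ0
  set n := Nat.pair k N with hn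
  have hnk : n.unpair.1 = k := by rw [hn, Nat.unpair_pair]
  have hnN : ((n : ℝ≥0∞) + 1)⁻¹ ≤ δ := by
    refine le_trans (ENNReal.inv_le_inv.2 ?_) hN.le
    have : N ≤ n + 1 := (Nat.right_le_pair k N).trans (Nat.le_succ _)
    exact_mod_cast this
  obtain ⟨r', h1, h2, h3⟩ := S.gain hG hGs (rr (n+1)).2 hZm (hZ (n+1)) hDm i j (fun x hx => hx.2)
    (fun x hx => hx.1.1.1) (fun x hx => hx.1.1.2) (fun x hx => hx.1.2)
  have h4 := (hstep n (rr n)).2 r' h1 (fun x => by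
    have e := (hstep n (rr n)).1 x
    rw [← h2, hrr, e, ← hrr, h2])
  rw [hnk, ← hrr] at h4
  have h5 : dst m (B k) (rr (n+1)).1 ≤ δ := by
    refine iInf₂_le_of_le Z ⟨hZm, hZ (n+1)⟩ ?_
    rw [symmDiff_comm]; exact ht.le
  have h6 : c0 - 8 * δ ≤ 8 * dst m (B k) r' := by
    rw [← ENNReal.div_le_iff' (by simp) (by simp)]
    refine le_iInf₂ fun Z' hZ' => ENNReal.div_le_of_le_mul' ?_
    rw [tsub_le_iff_left, ← mul_add]
    refine (h3 Z' hZ'.1 hZ'.2).trans ?_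
    gcongr
    refine (measure_symmDiff_le Z (B k) Z').trans ?_
    gcongr
  have h7 : c0 ≤ 24 * δ := by
    rw [tsub_le_iff_left] at h6
    calc c0 ≤ _ := h6
      _ ≤ 8 * δ + 8 * (δ + δ) := by gcongr; exact h4.trans (add_le_add h5 hnN)
      _ = _ := by ring
  rw [hδc] at h7
  have : (32 : ℝ≥0∞) ≤ 24 := (ENNReal.mul_le_mul_iff_left hδ0 hδt).1 h7
  norm_num at this

end CB

namespace CB
variable {X : Type*} [MeasurableSpace X] [StandardBorelSpace X] {m : Measure X} (S : CB m)

theorem rtg_meas {G : X → X → Prop} (hG : ∀ x y, G x y → S.E x y)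
    (hGm : MeasurableSet {p : X × X | G p.1 p.2}) :
    MeasurableSet {p : X × X | Relation.ReflTransGen G p.1 p.2} := by
  let R : ℕ → Set (X × X) := fun n => Nat.rec {p | p.1 = p.2}
    (fun _ A => ⋃ i, {p | (p.1, S.g i p.1) ∈ A ∧ G (S.g i p.1) p.2}) n
  have hs : ∀ n, R (n+1) = ⋃ i, {p | (p.1, S.g i p.1) ∈ R n ∧ G (S.g i p.1) p.2} := fun n => rfl
  have hR : ∀ n, MeasurableSet (R n) := by
    intro n
    induction n with
    | zero => exact measurableSet_eq_fun measurable_fst measurable_snd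
    | succ n ih =>
      rw [hs]
      refine .iUnion fun i => ?_
      have h1 : Measurable (fun p : X × X => (p.1, S.g i p.1)) := measurable_fst.prodMk ((S.gm i).comp measurable_fst)
      have h2 : Measurable (fun p : X × X => (S.g i p.1, p.2)) := ((S.gm i).comp measurable_fst).prodMk measurable_snd
      exact (h1 ih).inter (h2 hGm)
  have hsub : ∀ n x y, (x, y) ∈ R n → Relation.ReflTransGen G x y := by
    intro n
    induction n with
    | zero => intro x y h; have : x = y := h; rw [this]
    | succ n ih =>
      intro x y h
      rw [hs] at h
      obtain ⟨i, h1, h2⟩ := mem_iUnion.1 h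
      exact (ih _ _ h1).tail h2
  have : {p : X × X | Relation.ReflTransGen G p.1 p.2} = ⋃ n, R n := by
    ext ⟨x, y⟩
    simp only [mem_setOf_eq, mem_iUnion]
    constructor
    · intro h
      induction h with
      | refl => exact ⟨0, rfl⟩
      | tail h h' ih =>
        obtain ⟨n, hn⟩ := ih
        refine ⟨n+1, ?_⟩
        rw [hs]
        obtain ⟨i, hi⟩ := (S.hE _ _).1 (S.rtg_E hG h)
        refine mem_iUnion.2 ⟨i, ?_⟩
        simp only [mem_setOf_eq, hi]
        exact ⟨hn, h'⟩
    · rintro ⟨n, hn⟩; exact hsub n _ _ hn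
  rw [this]
  exact .iUnion hR

theorem rtg_eqv {α : Type*} {G : α → α → Prop} (h : ∀ x y, G x y → G y x) : Equivalence (Relation.ReflTransGen G) :=
  ⟨fun _ => .refl, fun h' => rtg_symm h h', fun h1 h2 => h1.trans h2⟩

theorem erg_const {S : CB m} (he : S.erg) {f : X → ℝ≥0∞} (hf : Measurable f)
    (h : ∀ᵐ x ∂m, ∀ y, S.E x y → f y = f x) : ∃ c, ∀ᵐ x ∂m, f x = c := by
  refine Filter.exists_eventuallyEq_const_of_forall_separating (l := ae m) (f := f) MeasurableSet ?_
  intro U hU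
  let Z : Set X := {x | ∀ y, S.E x y → f y ∈ U}
  have hZ : MeasurableSet Z := S.all_meas (P := fun x y => f y ∈ U) (measurable_snd (hf hU))
  rcases he Z hZ (fun x y hxy hx z hz => hx z (S.tr hxy hz)) with h0 | h0
  · right
    have h0' : ∀ᵐ x ∂m, x ∉ Z := by rw [ae_iff]; simpa using h0
    filter_upwards [h, h0'] with x h1 h2 h3
    exact h2 fun y hy => by rw [h1 y hy]; exact h3
  · left
    have h0' : ∀ᵐ x ∂m, x ∈ Z := h0
    filter_upwards [h0'] with x h1
    exact h1 x (S.rfl' x)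

theorem noatom {S : CB m} (he : S.erg) (hn : ¬ S.hasS) (x0 : X) : m {x0} = 0 := by
  by_contra h
  apply hn
  refine ⟨fun x => S.w x0 x, S.wm.comp (measurable_const.prodMk measurable_id), ?_⟩
  have hZ : MeasurableSet {x | S.E x0 x} := (measurable_const.prodMk measurable_id) S.Emeas
  have : ∀ᵐ x ∂m, S.E x0 x := by
    rcases he _ hZ (fun x y hxy hx => S.tr hx hxy) with h0 | h0
    · exact absurd (measure_mono_null (singleton_subset_iff.2 (S.rfl' x0)) h0) h
    · exact h0
  filter_upwards [this] with x hx
  exact ⟨S.w0 _ _ hx, S.wt _ _ hx, fun y hy => S.wc _ _ _ hy (S.sm (S.tr hx hy))⟩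

theorem sup_top {S : CB m} (he : S.erg) (hn : ¬ S.hasS) {k : X → ℝ≥0∞} (hk : Measurable k) (hk0 : ∀ x, k x ≠ 0) :
    ∀ᵐ x ∂m, ⨆ i, S.w (S.g i x) x * k (S.g i x) = ∞ := by
  set V : X → ℝ≥0∞ := fun x => ⨆ i, S.w (S.g i x) x * k (S.g i x) with hV
  have hVm : Measurable V := Measurable.iSup fun i => (S.wm.comp ((S.gm i).prodMk measurable_id)).mul (hk.comp (S.gm i))
  have hle : ∀ x y, S.E x y → S.w y x * k y ≤ V x := by
    intro x y h
    obtain ⟨i, rfl⟩ := (S.hE _ _).1 h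
    exact le_iSup (fun i => S.w (S.g i x) x * k (S.g i x)) i
  have hle2 : ∀ x y, S.E x y → V y * S.w y x ≤ V x := by
    intro x y h
    simp only [hV, ENNReal.iSup_mul]
    refine iSup_le fun i => ?_
    have h2 := S.Eg i y
    rw [mul_right_comm, S.wc _ _ _ h h2]
    exact hle x _ (S.tr h h2)
  have heq : ∀ x y, S.E x y → V y * S.w y x = V x := by
    intro x y h
    refine le_antisymm (hle2 x y h) ?_
    have := mul_le_mul_left (hle2 y x (S.sm h)) (S.w y x)
    rwa [mul_assoc, S.wc _ _ _ h (S.sm h), S.w1, mul_one] at this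
  rcases he {x | V x = ∞} (hVm (measurableSet_singleton _)) (fun x y hxy hx => by
    have := heq y x (S.sm hxy)
    have hx' : V x = ∞ := hx
    rw [hx', ENNReal.top_mul (S.w0 _ _ hxy)] at this
    exact this.symm) with h0 | h0
  · exfalso
    apply hn
    refine ⟨V, hVm, ?_⟩
    have : ∀ᵐ x ∂m, V x ≠ ∞ := by rw [ae_iff]; simpa using h0
    filter_upwards [this] with x hx
    refine ⟨?_, hx, heq x⟩
    intro h
    have := hle x x (S.rfl' x)
    rw [h, S.w1, one_mul] at this
    exact hk0 x (le_antisymm this zero_le)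
  · exact h0

theorem split (hna : ∀ x, m {x} = 0) {D : Set X} (hDm : MeasurableSet D) (hD : m D ≠ 0) :
    ∃ A, MeasurableSet A ∧ A ⊆ D ∧ m A ≠ 0 ∧ m (D \ A) ≠ 0 := by
  by_contra! hcon
  obtain ⟨f, hf⟩ := MeasureTheory.exists_measurableEmbedding_real X
  let L : ℚ → Set X := fun q => {x | f x < q}
  have hL : ∀ q, MeasurableSet (L q) := fun q => measurableSet_lt hf.measurable measurable_const
  open Classical in
  let N : ℚ → Set X := fun q => if m (D ∩ L q) = 0 then D ∩ L q else D \ (D ∩ L q)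
  have hN : ∀ q, m (N q) = 0 := by
    intro q
    by_cases h : m (D ∩ L q) = 0
    · simp only [N, if_pos h, h]
    · simp only [N, if_neg h]; exact hcon _ (hDm.inter (hL q)) inter_subset_left h
  have hU : m (⋃ q, N q) = 0 := measure_iUnion_null hN
  have hsub : (D \ ⋃ q, N q).Subsingleton := by
    have key : ∀ x ∈ D \ ⋃ q, N q, ∀ y ∈ D \ ⋃ q, N q, ¬ f x < f y := by
      intro x hx y hy hlt
      obtain ⟨q, h1, h2⟩ := exists_rat_btwn hlt
      by_cases h : m (D ∩ L q) = 0
      · apply hx.2; refine mem_iUnion.2 ⟨q, ?_⟩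
        simp only [N, if_pos h]; exact ⟨hx.1, h1⟩
      · apply hy.2; refine mem_iUnion.2 ⟨q, ?_⟩
        simp only [N, if_neg h]; exact ⟨hy.1, fun h3 => absurd h3.2 (not_lt.2 h2.le)⟩
    intro x hx y hy
    exact hf.injective (le_antisymm (not_lt.1 (key y hy x hx)) (not_lt.1 (key x hx y hy)))
  have h0 : m (D \ ⋃ q, N q) = 0 := by
    rcases hsub.eq_empty_or_singleton with h | ⟨x, h⟩ <;> rw [h]
    · simp
    · exact hna x
  apply hD
  refine measure_mono_null (t := (D \ ⋃ q, N q) ∪ ⋃ q, N q) ?_ (measure_union_null h0 hU)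
  intro x hx
  by_cases h : x ∈ ⋃ q, N q
  · exact Or.inr h
  · exact Or.inl ⟨hx, h⟩

theorem choice [IsFiniteMeasure m] {G : X → X → Prop} (hG : ∀ x y, G x y → S.E x y) (hGs : ∀ x y, G x y → G y x)
    (hGi : ∀ x, ¬ G x x)
    (hGm : MeasurableSet {p : X × X | G p.1 p.2}) (hconn : ∀ x y, S.E x y → Relation.ReflTransGen G x y)
    (herg : S.erg) (hS : ¬ S.hasS)
    (hna : ∀ r : ℕ → X → X, (∀ n, Measurable (r n)) → (∀ n x, S.E x (r n x)) → (∀ n x, r (n+1) (r n x) = r (n+1) x) →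
      ¬ ∀ᵐ x ∂m, ∀ y, G x y → ∃ n, r n x = r n y) :
    ∃ (G1 : X → X → Prop) (D : Set X) (η : X → X) (S1 : CB m), (∀ x y, G1 x y → G1 y x) ∧ (∀ x y, G1 x y → G x y) ∧
      MeasurableSet {p : X × X | G1 p.1 p.2} ∧ MeasurableSet D ∧ m D ≠ 0 ∧ Measurable η ∧ InjOn η D ∧
      (∀ x ∈ D, η x ∉ D) ∧ (∀ x ∈ D, G x (η x)) ∧ (∀ x ∈ D, ¬ G1 x (η x)) ∧
      S1.w = S.w ∧ (∀ x y, S1.E x y ↔ Relation.ReflTransGen G1 x y) ∧ S1.erg ∧ ¬ S1.hasS := by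
  obtain ⟨r, hr, hrr, hrerg⟩ := S.chain hG hGs hGm hconn herg
  have hrm : ∀ n k x y, n ≤ k → r n x = r n y → r k x = r k y := by
    intro n k x y hnk h
    induction hnk with
    | refl => exact h
    | step _ ih => rw [← hrr, ih, hrr]
  let EF : X → X → Prop := fun x y => ∃ n, r n x = r n y
  have EFs : ∀ x y, EF x y → EF y x := fun x y ⟨n, h⟩ => ⟨n, h.symm⟩
  have EFm : MeasurableSet {p : X × X | EF p.1 p.2} := by
    have : {p : X × X | EF p.1 p.2} = ⋃ n, {p | r n p.1 = r n p.2} := by ext; simp [EF]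
    rw [this]
    exact .iUnion fun n => measurableSet_eq_fun ((hr n).meas.comp measurable_fst) ((hr n).meas.comp measurable_snd)
  have EFE : ∀ x y, EF x y → S.E x y := fun x y ⟨n, h⟩ => S.tr ((hr n).hE S hG x) (by rw [h]; exact S.sm ((hr n).hE S hG y))
  let SF := S.sub EF ⟨fun x => ⟨0, rfl⟩, fun h => EFs _ _ h, fun ⟨n, h⟩ ⟨k, h'⟩ => ⟨max n k,
    (hrm n _ _ _ (le_max_left _ _) h).trans (hrm k _ _ _ (le_max_right _ _) h')⟩⟩ EFm EFE
  have SFerg : SF.erg := by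
    intro Z hZ hinv
    refine hrerg Z hZ fun n x => ⟨hinv x (r n x) ⟨n, ((hr n).idem x).symm⟩, hinv (r n x) x ⟨n, (hr n).idem x⟩⟩
  have hnat := noatom herg hS
  let P : X → X → Prop := fun x y => G x y ∧ ¬ EF x y
  have hPm : MeasurableSet {p : X × X | P p.1 p.2} := hGm.inter EFm.compl
  have hnn : m {x | ∃ y, S.E x y ∧ P x y} ≠ 0 := by
    intro h0
    refine hna r (fun n => (hr n).meas) (fun n => (hr n).hE S hG) hrr ?_
    have h1 : ∀ᵐ x ∂m, ¬ ∃ y, S.E x y ∧ P x y := by rw [ae_iff]; simpa using h0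
    filter_upwards [h1] with x hx y hy
    by_contra hc
    exact hx ⟨y, hG _ _ hy, hy, hc⟩
  obtain ⟨i, j, hD0⟩ := S.exists_pair hnn
  set η := S.g i with hη
  have hηm : Measurable η := S.gm i
  set D0 := {x | P x (η x) ∧ S.g j (η x) = x} with hD0d
  have hD0m : MeasurableSet D0 := by
    have : MeasurableSet {x | P x (η x)} := (measurable_id.prodMk hηm) hPm
    exact this.inter (measurableSet_eq_fun ((S.gm j).comp hηm) measurable_id)
  have hinj : InjOn η D0 := (S.injOn_pair i j).mono fun x hx => hx.2
  -- make it disjoint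
  obtain ⟨D', hD'm, hD'0, hD's, hD'd⟩ : ∃ D', MeasurableSet D' ∧ m D' ≠ 0 ∧ D' ⊆ D0 ∧ ∀ x ∈ D', η x ∉ D' := by
    obtain ⟨f, hf⟩ := MeasureTheory.exists_measurableEmbedding_real X
    let A : ℚ → Set X := fun q => D0 ∩ {x | f x < q ∧ q < f (η x)}
    let B : ℚ → Set X := fun q => D0 ∩ {x | f (η x) < q ∧ q < f x}
    have hfm := hf.measurable
    have hA : ∀ q, MeasurableSet (A q) := fun q => hD0m.inter ((measurableSet_lt hfm measurable_const).inter
      (measurableSet_lt measurable_const (hfm.comp hηm)))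
    have hB : ∀ q, MeasurableSet (B q) := fun q => hD0m.inter ((measurableSet_lt (hfm.comp hηm) measurable_const).inter
      (measurableSet_lt measurable_const hfm))
    by_contra! hcon
    have hA0 : ∀ q, m (A q) = 0 := by
      intro q; by_contra h
      obtain ⟨x, hx, hx'⟩ := hcon _ (hA q) h inter_subset_left
      exact absurd (hx'.2.1.trans hx.2.2) (lt_irrefl _)
    have hB0 : ∀ q, m (B q) = 0 := by
      intro q; by_contra h
      obtain ⟨x, hx, hx'⟩ := hcon _ (hB q) h inter_subset_left
      exact absurd (hx.2.1.trans hx'.2.2) (lt_irrefl _)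
    apply hD0
    refine measure_mono_null (t := (⋃ q, A q) ∪ ⋃ q, B q) ?_
      (measure_union_null (measure_iUnion_null hA0) (measure_iUnion_null hB0))
    intro x hx
    have hne : f x ≠ f (η x) := fun h => hGi x (by
      have := hx.1.1; rwa [← hf.injective h] at this)
    rcases lt_or_gt_of_ne hne with h | h
    · obtain ⟨q, h1, h2⟩ := exists_rat_btwn h
      exact Or.inl (mem_iUnion.2 ⟨q, hx, h1, h2⟩)
    · obtain ⟨q, h1, h2⟩ := exists_rat_btwn h
      exact Or.inr (mem_iUnion.2 ⟨q, hx, h1, h2⟩)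
  obtain ⟨D1, hD1m, hD1s, hD10, hD20⟩ := split hnat hD'm hD'0
  let H : X → X → Prop := fun x y => (x ∈ D1 ∧ η x = y) ∨ (y ∈ D1 ∧ η y = x)
  have Hs : ∀ x y, H x y → H y x := fun x y h => h.symm
  have Hm : MeasurableSet {p : X × X | H p.1 p.2} :=
    ((measurable_fst hD1m).inter (measurableSet_eq_fun (hηm.comp measurable_fst) measurable_snd)).union
    ((measurable_snd hD1m).inter (measurableSet_eq_fun (hηm.comp measurable_snd) measurable_fst))
  let K : (X → X → Prop) → X → X → Prop := fun H x y => G x y ∧ (EF x y ∨ H x y)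
  have KG : ∀ H x y, K H x y → G x y := fun H x y h => h.1
  have Ks : ∀ H : X → X → Prop, (∀ x y, H x y → H y x) → ∀ x y, K H x y → K H y x := fun H hH x y h =>
    ⟨hGs _ _ h.1, h.2.imp (EFs _ _) (hH _ _)⟩
  have Km : ∀ H : X → X → Prop, MeasurableSet {p : X × X | H p.1 p.2} → MeasurableSet {p : X × X | K H p.1 p.2} := fun H hH =>
    hGm.inter (EFm.union hH)
  have KEF : ∀ H : X → X → Prop, (∀ x y, H x y → H y x) → ∀ x y, EF x y → Relation.ReflTransGen (K H) x y := by
    rintro H hH x y ⟨n, h⟩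
    have h1 : ∀ z, Relation.ReflTransGen (K H) z (r n z) := fun z =>
      rtg_mono (fun a b hab => ⟨hab.1, Or.inl ⟨n, hab.2⟩⟩) ((hr n).conn z)
    have h2 := rtg_symm (Ks H hH) (h1 y)
    rw [← h] at h2
    exact (h1 x).trans h2
  let SK : ∀ H : X → X → Prop, (∀ x y, H x y → H y x) → MeasurableSet {p : X × X | H p.1 p.2} → CB m := fun H hs hm =>
    S.sub (Relation.ReflTransGen (K H)) (rtg_eqv (Ks H hs)) (S.rtg_meas (fun x y h => hG _ _ h.1) (Km H hm))
      (fun x y h => S.rtg_E (fun x y h => hG _ _ h.1) h)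
  have SKerg : ∀ H hs hm, (SK H hs hm).erg := fun H hs hm Z hZ hinv =>
    SFerg Z hZ fun x y hxy => hinv x y (KEF H hs x y hxy)
  by_cases c1 : (SK H Hs Hm).hasS
  swap
  · refine ⟨K H, D' \ D1, η, SK H Hs Hm, Ks H Hs, KG H, Km H Hm, hD'm.diff hD1m, hD20, hηm, hinj.mono (diff_subset.trans hD's),
      fun x hx h => hD'd x hx.1 h.1, fun x hx => (hD's hx.1).1.1, ?_, rfl, fun _ _ => Iff.rfl, SKerg H Hs Hm, c1⟩
    rintro x hx ⟨-, h | h | h⟩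
    · exact (hD's hx.1).1.2 h
    · exact hx.2 h.1
    · exact hD'd x hx.1 (hD1s h.1)
  let H' : X → X → Prop := fun x y => ¬ H x y
  have Hs' : ∀ x y, H' x y → H' y x := fun x y h h' => h (Hs _ _ h')
  have Hm' : MeasurableSet {p : X × X | H' p.1 p.2} := Hm.compl
  by_cases c2 : (SK H' Hs' Hm').hasS
  swap
  · refine ⟨K H', D1, η, SK H' Hs' Hm', Ks H' Hs', KG H', Km H' Hm', hD1m, hD10, hηm, hinj.mono (hD1s.trans hD's),
      fun x hx h => hD'd x (hD1s hx) (hD1s h), fun x hx => (hD's (hD1s hx)).1.1, ?_, rfl, fun _ _ => Iff.rfl, SKerg _ Hs' Hm', c2⟩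
    rintro x hx ⟨-, h | h⟩
    · exact (hD's (hD1s hx)).1.2 h
    · exact h (Or.inl ⟨hx, rfl⟩)
  exfalso
  obtain ⟨s1, hs1m, hs1⟩ := c1
  obtain ⟨s2, hs2m, hs2⟩ := c2
  have hs1' : ∀ᵐ x ∂m, s1 x ≠ 0 ∧ s1 x ≠ ∞ ∧ ∀ y, Relation.ReflTransGen (K H) x y → s1 y * S.w y x = s1 x := hs1
  have hs2' : ∀ᵐ x ∂m, s2 x ≠ 0 ∧ s2 x ≠ ∞ ∧ ∀ y, Relation.ReflTransGen (K H') x y → s2 y * S.w y x = s2 x := hs2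
  have a1 := S.ae_all hs1'
  have a2 := S.ae_all hs2'
  obtain ⟨c, hc⟩ := erg_const SFerg (hs1m.div hs2m) (by
    filter_upwards [a1, a2] with x h1 h2 y hy
    have e1 := (h1 x (S.rfl' x)).2.2 y (KEF H Hs x y hy)
    have e2 := (h2 x (S.rfl' x)).2.2 y (KEF H' Hs' x y hy)
    have hE := EFE x y hy
    simp only [Pi.div_apply]
    rw [← e1, ← e2, ENNReal.mul_div_mul_right _ _ (S.w0 _ _ (S.sm hE)) (S.wt _ _ (S.sm hE))])
  apply hS
  refine ⟨s1, hs1m, ?_⟩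
  filter_upwards [a1, a2, S.ae_all hc] with x h1 h2 h3
  refine ⟨(h1 x (S.rfl' x)).1, (h1 x (S.rfl' x)).2.1, ?_⟩
  have hsc : ∀ y, S.E x y → s1 y = c * s2 y := by
    intro y hy
    rw [← h3 y hy, Pi.div_apply, ENNReal.div_mul_cancel (h2 y hy).1 (h2 y hy).2.1]
  intro y hy
  have hp := hconn x y hy
  clear hy
  induction hp with
  | refl => rw [S.w1, mul_one]
  | @tail u v hu huv ih =>
    have hxu := S.rtg_E hG hu
    have huvE := hG _ _ huv
    rw [← S.wc x u v hxu huvE, ← mul_assoc, ← ih]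
    congr 1
    by_cases hH : H u v
    · exact (h1 u hxu).2.2 v (.single ⟨huv, Or.inr hH⟩)
    · rw [hsc v (S.tr hxu huvE), hsc u hxu, mul_assoc, (h2 u hxu).2.2 v (.single ⟨huv, Or.inr hH⟩)]

end CB

namespace Cmb

/-- cut of an edge in an acyclic graph -/
theorem gcut {X : Type*} {G : Set (X × X)} (hac : AcyclicGraph G) (hirr : ∀ x, (x, x) ∉ G)
    (hs : ∀ x y, (x, y) ∈ G → (y, x) ∈ G) {u v : X} (huv : (u, v) ∈ G) :
    ∃ χ : X → Prop, ¬ (χ u ↔ χ v) ∧ ∀ x y, (x, y) ∈ G → ¬ (x = u ∧ y = v) → ¬ (x = v ∧ y = u) → (χ x ↔ χ y) := by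
  classical
  let G' : X → X → Prop := fun x y => (x, y) ∈ G ∧ ¬ (x = u ∧ y = v) ∧ ¬ (x = v ∧ y = u)
  have hG's : ∀ x y, G' x y → G' y x := fun x y h => ⟨hs _ _ h.1, fun h' => h.2.2 ⟨h'.2, h'.1⟩, fun h' => h.2.1 ⟨h'.2, h'.1⟩⟩
  refine ⟨fun z => Relation.ReflTransGen G' v z, ?_, ?_⟩
  · intro h
    have hvu : Relation.ReflTransGen G' v u := h.2 .refl
    have hex : ∃ n, ∃ c : ℕ → X, c 0 = v ∧ c n = u ∧ ∀ i < n, G' (c i) (c (i+1)) := by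
      clear h
      have : ∀ z, Relation.ReflTransGen G' v z → ∃ n, ∃ c : ℕ → X, c 0 = v ∧ c n = z ∧ ∀ i < n, G' (c i) (c (i+1)) := by
        intro z hz
        induction hz with
        | refl => exact ⟨0, fun _ => v, rfl, rfl, by simp⟩
        | @tail a b _ hab ih =>
          obtain ⟨n, c, h0, h1, h2⟩ := ih
          refine ⟨n+1, fun i => if i ≤ n then c i else b, by simp [h0], by simp, ?_⟩
          intro i hi
          have hi' : i ≤ n := by omega
          simp only [if_pos hi']
          by_cases hi2 : i + 1 ≤ n
          · rw [if_pos hi2]; exact h2 i (by omega)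
          · rw [if_neg hi2]
            have : i = n := by omega
            rw [this, h1]; exact hab
      exact this u hvu
    obtain ⟨c, h0, h1, h2⟩ := Nat.find_spec hex
    set n := Nat.find hex with hn
    have hmin : ∀ k < n, ¬ ∃ c : ℕ → X, c 0 = v ∧ c k = u ∧ ∀ i < k, G' (c i) (c (i+1)) := fun k hk => Nat.find_min hex hk
    have hinj : ∀ i j, i < j → j ≤ n → c i ≠ c j := by
      intro i j hij hj he
      refine hmin (n - (j - i)) (by omega) ⟨fun k => if k ≤ i then c k else c (k + (j - i)), ?_, ?_, ?_⟩
      · simp [h0]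
      · by_cases h : n - (j - i) ≤ i
        · simp only [if_pos h]
          have e1 : n = j := by omega
          have e2 : n - (j - i) = i := by omega
          rw [e2, he, ← e1, h1]
        · simp only [if_neg h]
          rw [show n - (j - i) + (j - i) = n by omega, h1]
      · intro k hk
        by_cases hk1 : k ≤ i
        · by_cases hk2 : k + 1 ≤ i
          · simp only [if_pos hk1, if_pos hk2]; exact h2 k (by omega)
          · simp only [if_pos hk1, if_neg hk2]
            have e : k = i := by omega
            subst e
            rw [he, show k + 1 + (j - k) = j + 1 by omega]
            exact h2 j (by omega)
        · have hk2 : ¬ k + 1 ≤ i := by omega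
          simp only [if_neg hk1, if_neg hk2]
          rw [show k + 1 + (j - i) = k + (j - i) + 1 by omega]
          exact h2 _ (by omega)
    have hn2 : 2 < n + 1 := by
      by_contra hlt
      have : n = 0 ∨ n = 1 := by omega
      rcases this with h | h
      · rw [h, h0] at h1; rw [h1] at huv; exact hirr _ huv
      · have := h2 0 (by omega)
        rw [h] at h1
        rw [h0, h1] at this
        exact this.2.2 ⟨rfl, rfl⟩
    refine hac (n+1) c hn2 ?_ ?_
    · intro i hi
      by_cases hin : i = n
      · rw [hin, Nat.mod_self, h0, h1]; exact huv
      · rw [Nat.mod_eq_of_lt (by omega)]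
        exact (h2 i (by omega)).1
    · intro i j hij
      by_contra hne
      have hne' : (i : ℕ) ≠ j := fun h => hne (Fin.ext h)
      rcases lt_or_gt_of_ne hne' with h | h
      · exact hinj i j h (by omega) hij
      · exact hinj j i h (by omega) hij.symm
  · intro x y hxy h1 h2
    have hg : G' x y := ⟨hxy, h1, h2⟩
    exact ⟨fun h => h.tail hg, fun h => h.tail (hG's _ _ hg)⟩

section
variable {X L : Type*} (src tgt : L → X)

def IsCut (Q : L → Prop) (l : L) (χ : X → Prop) : Prop :=
  ¬ (χ (src l) ↔ χ (tgt l)) ∧ ∀ l', Q l' → l' ≠ l → (χ (src l') ↔ χ (tgt l'))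

theorem expH {P : X → X → Prop} {fine hh : L → Prop}
    (hfine : ∀ l, fine l → P (src l) (tgt l)) {l : L} {κ : X → Prop} (hκ : IsCut src tgt hh l κ)
    (hinv : ∀ z z', P z z' → (κ z ↔ κ z')) : IsCut src tgt (fun l => fine l ∨ hh l) l κ := by
  refine ⟨hκ.1, ?_⟩
  rintro l' (h | h) hne
  · exact hinv _ _ (hfine l' h)
  · exact hκ.2 l' h hne

theorem expF {P : X → X → Prop} (hP : Equivalence P) {fine hh : L → Prop}
    (hfine : ∀ l, fine l → P (src l) (tgt l)) (hdisj : ∀ l, fine l → ¬ hh l)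
    (hcut : ∀ l, hh l → ∃ κ, IsCut src tgt hh l κ ∧ ∀ z z', P z z' → (κ z ↔ κ z'))
    {f : L} (hf : fine f) {χ : X → Prop} (hχ : IsCut src tgt fine f χ) :
    ∃ χ', IsCut src tgt (fun l => fine l ∨ hh l) f χ' ∧ (∀ z, P (src f) z → (χ' z ↔ χ z)) ∧
      ∀ h, hh h → P (src f) (src h) → ∀ z, P (tgt h) z → (χ' z ↔ χ' (src h)) := by
  choose! κ hκ hκi using hcut
  set c := src f with hc
  let χ' : X → Prop := fun z => (P c z ∧ χ z) ∨ (¬ P c z ∧ ∃ h n, hh h ∧ (n = src h ∨ n = tgt h) ∧ P c n ∧ ¬ (κ h z ↔ κ h n) ∧ χ n)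
  have a1 : ∀ z, P c z → (χ' z ↔ χ z) := by
    intro z hz
    constructor
    · rintro (h | h)
      · exact h.2
      · exact absurd hz h.1
    · intro h; exact Or.inl ⟨hz, h⟩
  have a2 : ∀ z, ¬ P c z → (χ' z ↔ ∃ h n, hh h ∧ (n = src h ∨ n = tgt h) ∧ P c n ∧ ¬ (κ h z ↔ κ h n) ∧ χ n) := by
    intro z hz
    constructor
    · rintro (h | h)
      · exact absurd h.1 hz
      · exact h.2
    · intro h; exact Or.inr ⟨hz, h⟩
  have a3 : ∀ z z', P z z' → ¬ P c z → (χ' z ↔ χ' z') := by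
    intro z z' h hz
    rw [a2 z hz, a2 z' fun h' => hz (hP.trans h' (hP.symm h))]
    constructor
    · rintro ⟨h1, n, h2, h3, h4, h5, h6⟩
      exact ⟨h1, n, h2, h3, h4, by rwa [← hκi h1 h2 z z' h], h6⟩
    · rintro ⟨h1, n, h2, h3, h4, h5, h6⟩
      exact ⟨h1, n, h2, h3, h4, by rwa [hκi h1 h2 z z' h], h6⟩
  have sep : ∀ h, hh h → ¬ P (src h) (tgt h) := fun h hh' hp => (hκ h hh').1 (hκi h hh' _ _ hp)
  -- across an h edge with one end in c
  have a4 : ∀ h u v, hh h → ((u = src h ∧ v = tgt h) ∨ (u = tgt h ∧ v = src h)) → P c u → (χ' v ↔ χ' u) := by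
    intro h u v hh' huv hu
    have hv : ¬ P c v := by
      intro hv
      have : P u v := hP.trans (hP.symm hu) hv
      rcases huv with ⟨rfl, rfl⟩ | ⟨rfl, rfl⟩
      · exact sep h hh' this
      · exact sep h hh' (hP.symm this)
    have hk : ¬ (κ h v ↔ κ h u) := by
      have := (hκ h hh').1
      rcases huv with ⟨rfl, rfl⟩ | ⟨rfl, rfl⟩
      · exact fun h => this h.symm
      · exact this
    rw [a1 u hu, a2 v hv]
    constructor
    · rintro ⟨h1, n, h2, h3, h4, h5, h6⟩
      by_cases he : h1 = h
      · subst he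
        have : n = u := by
          rcases huv with ⟨rfl, rfl⟩ | ⟨rfl, rfl⟩
          · rcases h3 with h3 | h3
            · exact h3
            · rw [h3] at h4; exact absurd h4 hv
          · rcases h3 with h3 | h3
            · rw [h3] at h4; exact absurd h4 hv
            · exact h3
        rwa [← this]
      · exfalso
        apply h5
        have e1 : κ h1 v ↔ κ h1 u := by
          have := (hκ h1 h2).2 h hh' (Ne.symm he)
          rcases huv with ⟨rfl, rfl⟩ | ⟨rfl, rfl⟩
          · exact this.symm
          · exact this
        rw [e1]
        exact hκi h1 h2 u n (hP.trans (hP.symm hu) h4)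
    · intro h6
      exact ⟨h, u, hh', huv.imp And.left And.left, hu, hk, h6⟩
  refine ⟨χ', ⟨?_, ?_⟩, a1, ?_⟩
  · rw [a1 _ (hP.refl c), a1 _ (hfine f hf)]
    exact hχ.1
  · rintro l' (h | h) hne
    · by_cases hp : P c (src l')
      · rw [a1 _ hp, a1 _ (hP.trans hp (hfine _ h))]
        exact hχ.2 l' h hne
      · exact a3 _ _ (hfine _ h) hp
    · by_cases hp : P c (src l')
      · exact (a4 l' _ _ h (Or.inl ⟨rfl, rfl⟩) hp).symm
      · by_cases hp2 : P c (tgt l')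
        · exact a4 l' _ _ h (Or.inr ⟨rfl, rfl⟩) hp2
        · rw [a2 _ hp, a2 _ hp2]
          have : ∀ h1 n, hh h1 → (n = src h1 ∨ n = tgt h1) → P c n → (κ h1 (src l') ↔ κ h1 (tgt l')) := by
            intro h1 n h2 h3 h4
            refine (hκ h1 h2).2 l' h ?_
            rintro rfl
            rcases h3 with rfl | rfl
            · exact hp h4
            · exact hp2 h4
          constructor
          · rintro ⟨h1, n, h2, h3, h4, h5, h6⟩
            exact ⟨h1, n, h2, h3, h4, by rwa [← this h1 n h2 h3 h4], h6⟩
          · rintro ⟨h1, n, h2, h3, h4, h5, h6⟩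
            exact ⟨h1, n, h2, h3, h4, by rwa [this h1 n h2 h3 h4], h6⟩
  · intro h hh' hp z hz
    have e1 := a4 h _ _ hh' (Or.inl ⟨rfl, rfl⟩) hp
    rw [← e1]
    refine (a3 _ _ hz ?_).symm
    intro h'
    exact sep h hh' (hP.trans (hP.symm hp) h')
end

section free
variable {X ι : Type*} (T : ι → Equiv.Perm X)

abbrev src (l : ι × X) : X := l.2
abbrev tgt (l : ι × X) : X := T l.1 l.2

def stp (l : ι × Bool) (y : X) : X := if l.2 then T l.1 y else (T l.1).symm y
def edg (l : ι × Bool) (y : X) : ι × X := if l.2 then (l.1, y) else (l.1, (T l.1).symm y)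
def act (L : List (ι × Bool)) (x : X) : X := L.foldr (stp T) x

theorem stp_edg (l : ι × Bool) (y : X) : (y = src (edg T l y) ∧ stp T l y = tgt T (edg T l y)) ∨
    (y = tgt T (edg T l y) ∧ stp T l y = src (edg T l y)) := by
  rcases l with ⟨i, b⟩
  cases b <;> simp [stp, edg, src, tgt]

theorem act_append (L L' : List (ι × Bool)) (x : X) : act T (L ++ L') x = act T L (act T L' x) := by
  simp [act, List.foldr_append]

theorem decomp (e : ι × X) {χ : X → Prop} (hχ : IsCut src (tgt T) (fun _ => True) e χ) (L : List (ι × Bool)) (x : X) :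
    (χ (act T L x) ↔ χ x) ∨ ∃ P l Q, L = P ++ l :: Q ∧ edg T l (act T Q x) = e ∧
      (χ (act T L x) ↔ χ (act T (l :: Q) x)) := by
  induction L with
  | nil => left; rfl
  | cons l L ih =>
    by_cases h : edg T l (act T L x) = e
    · right; exact ⟨[], l, L, rfl, h, Iff.rfl⟩
    · have hc := hχ.2 _ trivial h
      have h1 : χ (act T (l :: L) x) ↔ χ (act T L x) := by
        change χ (stp T l (act T L x)) ↔ _
        rcases stp_edg T l (act T L x) with ⟨h2, h3⟩ | ⟨h2, h3⟩
        · rw [h3]; nth_rw 2 [h2]; exact hc.symm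
        · rw [h3]; nth_rw 2 [h2]; exact hc
      rcases ih with ih | ⟨P, l', Q, h2, h3, h4⟩
      · left; rw [h1, ih]
      · right; exact ⟨l :: P, l', Q, by rw [h2]; rfl, h3, by rw [h1, h4]⟩

theorem freeL (hcut : ∀ e : ι × X, ∃ χ, IsCut src (tgt T) (fun _ => True) e χ) :
    ∀ n (L : List (ι × Bool)), L.length = n → FreeGroup.IsReduced L → ∀ x, act T L x = x → L = [] := by
  intro n
  induction n using Nat.strong_induction_on with
  | _ n ih =>
    intro L hn hred x hx
    rcases L with _ | ⟨l, L'⟩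
    · rfl
    exfalso
    set y := act T L' x with hy
    have hx' : stp T l y = x := hx
    obtain ⟨χ, hχ⟩ := hcut (edg T l y)
    have hxy : ¬ (χ y ↔ χ x) := by
      rcases stp_edg T l y with ⟨h2, h3⟩ | ⟨h2, h3⟩
      · rw [← hx', h3]; nth_rw 1 [h2]; exact hχ.1
      · rw [← hx', h3]; nth_rw 1 [h2]; exact fun h => hχ.1 h.symm
    rcases decomp T (edg T l y) hχ L' x with h | ⟨P, l', Q, h1, h2, h3⟩
    · exact hxy h
    set z := act T (l' :: Q) x with hz
    have hz' : stp T l' (act T Q x) = z := rfl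
    have hyP : y = act T P z := by rw [hy, h1, act_append]
    have hzy : z = y := by
      have h4 := stp_edg T l' (act T Q x)
      rw [h2, hz'] at h4
      have h5 := stp_edg T l y
      have hc := hχ.1
      rcases h4 with ⟨-, h4⟩ | ⟨-, h4⟩ <;> rcases h5 with ⟨h5, -⟩ | ⟨h5, -⟩
      · exfalso; apply hc; rw [← h4, ← h3]; nth_rw 1 [← h5]
      · rw [h4]; exact h5.symm
      · rw [h4]; exact h5.symm
      · exfalso; apply hc; rw [← h4, ← h5]; exact h3.symm
    have hPr : FreeGroup.IsReduced P := by
      refine hred.infix ⟨[l], l' :: Q, ?_⟩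
      rw [h1]; simp
    have hPn : P = [] := by
      refine ih P.length ?_ P rfl hPr z (by rw [← hyP, hzy])
      rw [← hn, h1]; simp
    subst hPn
    simp only [List.nil_append] at h1
    rw [h1] at hred
    have hll : l.1 = l'.1 → l.2 = l'.2 := by
      unfold FreeGroup.IsReduced at hred
      rw [List.isChain_cons_cons] at hred
      exact hred.1
    rw [hzy] at hz'
    rcases l with ⟨i, b⟩
    rcases l' with ⟨i', b'⟩
    have he1 : i' = i := by
      have := congrArg Prod.fst h2
      cases b <;> cases b' <;> simpa [edg] using this
    subst he1
    have hb : b = b' := hll rfl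
    subst hb
    have h6 := congrArg Prod.snd h2
    set q := act T Q x
    apply hxy
    have : y = x := by
      rw [← hx', ← hz']
      cases b
      · have h7 : (T i').symm q = (T i').symm y := h6
        have h8 : (T i').symm q = y := hz'
        change (T i').symm q = (T i').symm ((T i').symm q)
        rw [h7, ← h7, h8]
        rw [← h7, h8]
      · have h7 : q = y := h6
        have h8 : T i' q = y := hz'
        change T i' q = T i' (T i' q)
        rw [h8, ← h7, h8, ← h7]
    rw [this]

theorem act_mk (L : List (ι × Bool)) (x : X) : FreeGroup.lift T (FreeGroup.mk L) x = act T L x := by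
  induction L with
  | nil => 
    change FreeGroup.lift T 1 x = x
    simp
  | cons l L ih =>
    have : FreeGroup.mk (l :: L) = FreeGroup.mk [l] * FreeGroup.mk L := by simp
    rw [this, map_mul, Equiv.Perm.mul_apply, ih]
    change _ = stp T l (act T L x)
    rcases l with ⟨i, b⟩
    cases b <;> simp [stp, FreeGroup.lift_mk] <;> rfl

theorem free_of_cut (hcut : ∀ e : ι × X, ∃ χ, IsCut src (tgt T) (fun _ => True) e χ) (g : FreeGroup ι) (hg : g ≠ 1) (x : X) :
    FreeGroup.lift T g x ≠ x := by
  classical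
  intro h
  apply hg
  rw [← FreeGroup.mk_toWord (x := g), act_mk] at h
  have := freeL T hcut _ g.toWord rfl FreeGroup.isReduced_toWord x h
  exact FreeGroup.toWord_eq_nil_iff.1 this

end free
end Cmb

namespace CB
variable {X : Type*} [MeasurableSpace X] [StandardBorelSpace X] {m : Measure X} (S : CB m)

theorem pieces (hna : ∀ x, m {x} = 0) {D : Set X} (hDm : MeasurableSet D) (hD : m D ≠ 0) :
    ∃ P : ℕ → Set X, (∀ n, MeasurableSet (P n)) ∧ (∀ n, P n ⊆ D) ∧ (∀ n, m (P n) ≠ 0) ∧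
      ∀ n k, n ≠ k → ∀ x, x ∈ P n → x ∉ P k := by
  have hsp : ∀ D : {D : Set X // MeasurableSet D ∧ m D ≠ 0}, ∃ A : Set X, MeasurableSet A ∧ A ⊆ D.1 ∧ m A ≠ 0 ∧ m (D.1 \ A) ≠ 0 :=
    fun D => split hna D.2.1 D.2.2
  choose a ha1 ha2 ha3 ha4 using hsp
  let Q : ℕ → {D : Set X // MeasurableSet D ∧ m D ≠ 0} := fun n => Nat.rec ⟨D, hDm, hD⟩
    (fun _ D => ⟨D.1 \ a D, D.2.1.diff (ha1 D), ha4 D⟩) n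
  have hQs : ∀ n, (Q (n+1)).1 = (Q n).1 \ a (Q n) := fun n => rfl
  have hanti : ∀ n k, n ≤ k → (Q k).1 ⊆ (Q n).1 := by
    intro n k h
    induction h with
    | refl => exact le_rfl
    | step _ ih => rw [hQs]; exact diff_subset.trans ih
  have hlt : ∀ n k, n < k → ∀ x, x ∈ a (Q k) → x ∉ a (Q n) := by
    intro n k h x hx
    have := hanti (n+1) k h (ha2 _ hx)
    rw [hQs] at this
    exact this.2
  refine ⟨fun n => a (Q n), fun n => ha1 _, fun n => (ha2 _).trans (hanti 0 n (Nat.zero_le _)), fun n => ha3 _, ?_⟩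
  intro n k hnk x hx hx'
  rcases lt_or_gt_of_ne hnk with h | h
  · exact hlt _ _ h x hx' hx
  · exact hlt _ _ h x hx hx'

theorem T3 [IsFiniteMeasure m] (he : S.erg) (hn : ¬ S.hasS) {A B : Set X} (hA : MeasurableSet A) (hB : MeasurableSet B)
    (hB0 : m B ≠ 0) : ∃ (τ : X → X) (A0 : Set X), Measurable τ ∧ MeasurableSet A0 ∧ A0 ⊆ A ∧ m (A \ A0) = 0 ∧
      (∀ x ∈ A0, S.E x (τ x) ∧ τ x ∈ B) ∧ InjOn τ A0 := by
  classical
  set c : ℝ≥0∞ := (m B / 2) / (m A + 1) with hc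
  have hc0 : c ≠ 0 := by
    rw [hc]; refine (ENNReal.div_pos ?_ ?_).ne'
    · exact (ENNReal.half_pos hB0).ne'
    · simp [measure_ne_top]
  have hct : c ≠ ∞ := by
    rw [hc]; refine ENNReal.div_ne_top ?_ (by simp)
    exact (ENNReal.div_lt_top (measure_ne_top _ _) (by simp)).ne
  have hcA : c * m A < m B := by
    have h1 : c * (m A + 1) = m B / 2 := ENNReal.div_mul_cancel (by simp) (by simp [measure_ne_top])
    calc c * m A ≤ c * (m A + 1) := by gcongr; exact le_self_add
      _ = m B / 2 := h1
      _ < m B := ENNReal.half_lt_self hB0 (measure_ne_top _ _)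
  let I : ℕ → ℕ := fun k => (Nat.unpair k).1
  let J : ℕ → ℕ := fun k => (Nat.unpair k).2
  let UU : ℕ → Set X × Set X → Set X := fun k P =>
    {x | x ∈ A ∧ x ∉ P.1 ∧ S.g (I k) x ∈ B ∧ S.g (I k) x ∉ P.2 ∧ S.w (S.g (I k) x) x ≤ c ∧ S.g (J k) (S.g (I k) x) = x}
  let P : ℕ → Set X × Set X := fun n => Nat.rec (∅, ∅) (fun k P => (P.1 ∪ UU k P, P.2 ∪ S.g (I k) '' UU k P)) n
  let U : ℕ → Set X := fun k => UU k (P k)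
  have hP1 : ∀ k, (P (k+1)).1 = (P k).1 ∪ U k := fun k => rfl
  have hP2 : ∀ k, (P (k+1)).2 = (P k).2 ∪ S.g (I k) '' U k := fun k => rfl
  have hUinj : ∀ k, InjOn (S.g (I k)) (U k) := fun k => (S.injOn_pair (I k) (J k)).mono fun x hx => hx.2.2.2.2.2
  have hUm' : ∀ k, MeasurableSet (P k).1 → MeasurableSet (P k).2 → MeasurableSet (U k) := by
    intro k h1 h2
    have e : U k = A ∩ ((P k).1ᶜ ∩ (S.g (I k) ⁻¹' B ∩ (S.g (I k) ⁻¹' (P k).2ᶜ ∩ ({x | S.w (S.g (I k) x) x ≤ c} ∩ {x | S.g (J k) (S.g (I k) x) = x})))) := rfl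
    rw [e]
    refine hA.inter (h1.compl.inter ((S.gm _ hB).inter ((S.gm _ h2.compl).inter (MeasurableSet.inter ?_ ?_))))
    · exact measurableSet_le (S.wm.comp ((S.gm _).prodMk measurable_id)) measurable_const
    · exact measurableSet_eq_fun ((S.gm _).comp (S.gm _)) measurable_id
  have hPm : ∀ k, MeasurableSet (P k).1 ∧ MeasurableSet (P k).2 := by
    intro k
    induction k with
    | zero => exact ⟨MeasurableSet.empty, MeasurableSet.empty⟩
    | succ k ih =>
      rw [hP1, hP2]
      exact ⟨ih.1.union (hUm' k ih.1 ih.2), ih.2.union (Einj (S.gm _) (hUm' k ih.1 ih.2) (hUinj k))⟩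
  have hUm : ∀ k, MeasurableSet (U k) := fun k => hUm' k (hPm k).1 (hPm k).2
  have hmon : ∀ k n, k ≤ n → (P k).1 ⊆ (P n).1 ∧ (P k).2 ⊆ (P n).2 := by
    intro k n h
    induction h with
    | refl => exact ⟨le_rfl, le_rfl⟩
    | step _ ih => rw [hP1, hP2]; exact ⟨ih.1.trans subset_union_left, ih.2.trans subset_union_left⟩
  have hUP : ∀ k n x, k < n → x ∈ U k → x ∈ (P n).1 ∧ S.g (I k) x ∈ (P n).2 := by
    intro k n x h hx
    have := hmon (k+1) n h
    rw [hP1, hP2] at this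
    exact ⟨this.1 (Or.inr hx), this.2 (Or.inr ⟨x, hx, rfl⟩)⟩
  have hUd : ∀ k n x, x ∈ U k → x ∈ U n → k = n := by
    intro k n x h1 h2
    rcases lt_trichotomy k n with h | h | h
    · exact absurd (hUP _ _ _ h h1).1 h2.2.1
    · exact h
    · exact absurd (hUP _ _ _ h h2).1 h1.2.1
  let τ : X → X := fun x => if h : ∃ k, x ∈ U k then S.g (I h.choose) x else x
  have hτ : ∀ k x, x ∈ U k → τ x = S.g (I k) x := by
    intro k x hx
    have h : ∃ k, x ∈ U k := ⟨k, hx⟩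
    have : h.choose = k := hUd _ _ x h.choose_spec hx
    simp only [τ]
    rw [dif_pos h, this]
  have hτm : Measurable τ := by
    intro V hV
    have : τ ⁻¹' V = (⋃ k, (U k ∩ S.g (I k) ⁻¹' V)) ∪ ((⋃ k, U k)ᶜ ∩ V) := by
      ext x
      by_cases h : ∃ k, x ∈ U k
      · obtain ⟨k, hk⟩ := h
        simp only [mem_preimage, hτ k x hk, mem_union, mem_iUnion, mem_inter_iff, mem_compl_iff]
        constructor
        · intro h; exact Or.inl ⟨k, hk, h⟩
        · rintro (⟨n, hn, h⟩ | ⟨h, -⟩)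
          · rwa [hUd k n x hk hn]
          · exact absurd ⟨k, hk⟩ h
      · have e : τ x = x := dif_neg h
        simp only [mem_preimage, e, mem_union, mem_iUnion, mem_inter_iff, mem_compl_iff]
        constructor
        · intro h'; exact Or.inr ⟨h, h'⟩
        · rintro (⟨n, hn, -⟩ | ⟨-, h'⟩)
          · exact absurd ⟨n, hn⟩ h
          · exact h'
    rw [this]
    exact (MeasurableSet.iUnion fun k => (hUm k).inter (S.gm _ hV)).union ((MeasurableSet.iUnion hUm).compl.inter hV)
  set A0 := ⋃ k, U k with hA0
  have hA0m : MeasurableSet A0 := MeasurableSet.iUnion hUm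
  have hA0A : A0 ⊆ A := iUnion_subset fun k x hx => hx.1
  have hprop : ∀ x ∈ A0, (S.E x (τ x) ∧ τ x ∈ B) ∧ S.w (τ x) x ≤ c := by
    intro x hx
    obtain ⟨k, hk⟩ := mem_iUnion.1 hx
    rw [hτ k x hk]
    exact ⟨⟨S.Eg _ _, hk.2.2.1⟩, hk.2.2.2.2.1⟩
  have hinj : InjOn τ A0 := by
    intro x hx y hy hxy
    obtain ⟨k, hk⟩ := mem_iUnion.1 hx
    obtain ⟨n, hn⟩ := mem_iUnion.1 hy
    rw [hτ k x hk, hτ n y hn] at hxy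
    rcases lt_trichotomy k n with h | h | h
    · have := (hUP _ _ _ h hk).2
      rw [hxy] at this; exact absurd this hn.2.2.2.1
    · subst h; exact hUinj k hk hn hxy
    · have := (hUP _ _ _ h hn).2
      rw [← hxy] at this; exact absurd this hk.2.2.2.1
  refine ⟨τ, A0, hτm, hA0m, hA0A, ?_, fun x hx => (hprop x hx).1, hinj⟩
  by_contra hUl
  set Ul := A \ A0 with hUldef
  have hUlm : MeasurableSet Ul := hA.diff hA0m
  have him : MeasurableSet (τ '' A0) := Einj hτm hA0m hinj
  have hτA : m (τ '' A0) < m B := by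
    rw [S.measure_image hτm hA0m hinj fun x hx => (hprop x hx).1.1]
    calc ∫⁻ x in A0, S.w (τ x) x ∂m ≤ ∫⁻ x in A0, c ∂m := setLIntegral_mono measurable_const fun x hx => (hprop x hx).2
      _ = c * m A0 := by simp
      _ ≤ c * m A := by gcongr
      _ < m B := hcA
  set W := B \ τ '' A0 with hW
  have hW0 : m W ≠ 0 := by
    intro h
    have h1 : m B ≤ m W + m (τ '' A0) := (measure_mono (by rw [hW]; simp)).trans (measure_union_le _ _)
    rw [h, zero_add] at h1
    exact absurd hτA (not_lt.2 h1)
  apply hn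
  set k : X → ℝ≥0∞ := fun x => bi (x ∈ Ul) with hkdef
  have hk : Measurable k := bi_meas hUlm
  set V : X → ℝ≥0∞ := fun x => ⨆ i, S.w (S.g i x) x * k (S.g i x) with hV
  have hVm : Measurable V := Measurable.iSup fun i => (S.wm.comp ((S.gm i).prodMk measurable_id)).mul (hk.comp (S.gm i))
  have hle : ∀ x y, S.E x y → S.w y x * k y ≤ V x := by
    intro x y h
    obtain ⟨i, rfl⟩ := (S.hE _ _).1 h
    exact le_iSup (fun i => S.w (S.g i x) x * k (S.g i x)) i
  have hle2 : ∀ x y, S.E x y → V y * S.w y x ≤ V x := by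
    intro x y h
    simp only [hV, ENNReal.iSup_mul]
    refine iSup_le fun i => ?_
    have h2 := S.Eg i y
    rw [mul_right_comm, S.wc _ _ _ h h2]
    exact hle x _ (S.tr h h2)
  have heq : ∀ x y, S.E x y → V y * S.w y x = V x := by
    intro x y h
    refine le_antisymm (hle2 x y h) ?_
    have := mul_le_mul_left (hle2 y x (S.sm h)) (S.w y x)
    rwa [mul_assoc, S.wc _ _ _ h (S.sm h), S.w1, mul_one] at this
  refine ⟨V, hVm, ?_⟩
  have v1 : ∀ᵐ x ∂m, V x ≠ 0 := by
    have hm : MeasurableSet {x | V x ≠ 0} := (hVm (measurableSet_singleton _)).compl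
    rcases he _ hm (fun x y hxy hx h0 => by
      have := heq x y hxy
      rw [h0, zero_mul] at this
      exact hx this.symm) with h0 | h0
    · exfalso
      refine hUl (measure_mono_null ?_ h0)
      intro x hx h
      have := hle x x (S.rfl' x)
      rw [h, S.w1, one_mul] at this
      simp [hkdef, bi_pos hx] at this
    · exact h0
  have v2 : ∀ᵐ x ∂m, V x ≠ ∞ := by
    have hm : MeasurableSet {x | V x ≠ ∞} := (hVm (measurableSet_singleton _)).compl
    rcases he _ hm (fun x y hxy hx h0 => by
      have := heq x y hxy
      rw [h0, ENNReal.top_mul (S.w0 _ _ (S.sm hxy))] at this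
      exact hx this.symm) with h0 | h0
    · exfalso
      refine hW0 (measure_mono_null ?_ h0)
      intro y hy h
      have : V y ≤ c⁻¹ := by
        refine iSup_le fun l => ?_
        set x := S.g l y with hx
        by_cases hxU : x ∈ Ul
        · rw [hkdef]; simp only [bi_pos hxU, mul_one]
          have hyx : S.E y x := S.Eg _ _
          obtain ⟨i, hi⟩ := (S.hE _ _).1 (S.sm hyx)
          have hnot : x ∉ U (Nat.pair i l) := fun h => hxU.2 (mem_iUnion.2 ⟨_, h⟩)
          have hcw : c < S.w y x := by
            by_contra hcw
            apply hnot
            have e1 : I (Nat.pair i l) = i := by simp [I]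
            have e2 : J (Nat.pair i l) = l := by simp [J]
            refine ⟨hxU.1, ?_, ?_, ?_, ?_, ?_⟩
            · intro hx1
              apply hxU.2
              have : ∀ n, (P n).1 ⊆ A0 := by
                intro n
                induction n with
                | zero => exact empty_subset _
                | succ n ih => rw [hP1]; exact union_subset ih (subset_iUnion U n)
              exact this _ hx1
            · rw [e1, hi]; exact hy.1
            · rw [e1, hi]; intro hx1
              apply hy.2
              have : ∀ n, (P n).2 ⊆ τ '' A0 := by
                intro n
                induction n with
                | zero => exact empty_subset _
                | succ n ih =>
                  rw [hP2]; refine union_subset ih ?_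
                  rintro _ ⟨x, hx, rfl⟩
                  exact ⟨x, mem_iUnion.2 ⟨n, hx⟩, hτ _ _ hx⟩
              exact this _ hx1
            · rw [e1, hi]; exact not_lt.1 hcw
            · rw [e1, e2, hi]
          have h3 := S.wc x y x (S.sm hyx) hyx
          rw [S.w1] at h3
          rw [ENNReal.eq_inv_of_mul_eq_one_left h3]
          exact ENNReal.inv_le_inv.2 hcw.le
        · rw [hkdef]; simp only [bi_neg hxU, mul_zero]; exact zero_le
      rw [h] at this
      simp [hc0] at this
    · exact h0
  filter_upwards [v1, v2] with x h1 h2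
  exact ⟨h1, h2, heq x⟩

end CB

namespace CB
variable {X : Type*} [MeasurableSpace X] [StandardBorelSpace X] {m : Measure X} (S : CB m)

open Classical in
theorem rank {p : X × X → X} (hp : Measurable p) {Q : Set (X × X)} (hQ : MeasurableSet Q)
    (hE : ∀ e ∈ Q, S.E (p e) e.1 ∧ S.E (p e) e.2) {A : Set X} (hinf : ∀ a ∈ A, {e | e ∈ Q ∧ p e = a}.Infinite) :
    ∃ rk : X × X → ℕ, Measurable rk ∧ ∀ a ∈ A, ∀ n, ∃! e, e ∈ Q ∧ p e = a ∧ rk e = n := by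
  have hex : ∀ q : X × X, ∃ i, S.g i q.1 = q.2 ∨ ¬ S.E q.1 q.2 := by
    intro q
    by_cases h : S.E q.1 q.2
    · obtain ⟨i, hi⟩ := (S.hE _ _).1 h
      exact ⟨i, Or.inl hi⟩
    · exact ⟨0, Or.inr h⟩
  let idx : X × X → ℕ := fun q => Nat.find (hex q)
  have hidx : Measurable idx := by
    refine measurable_find hex fun k => MeasurableSet.union ?_ S.Emeas.compl
    exact measurableSet_eq_fun ((S.gm k).comp measurable_fst) measurable_snd
  have hidx' : ∀ q : X × X, S.E q.1 q.2 → S.g (idx q) q.1 = q.2 := by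
    intro q h
    rcases Nat.find_spec (hex q) with h' | h'
    · exact h'
    · exact absurd h h'
  let code : X × X → ℕ := fun e => Nat.pair (idx (p e, e.1)) (idx (p e, e.2))
  have hcode : Measurable code := by
    have : Measurable (fun q : ℕ × ℕ => Nat.pair q.1 q.2) := measurable_of_countable _
    exact this.comp ((hidx.comp (hp.prodMk measurable_fst)).prodMk (hidx.comp (hp.prodMk measurable_snd)))
  let dec : X → ℕ → X × X := fun a k => (S.g (Nat.unpair k).1 a, S.g (Nat.unpair k).2 a)
  have hdec : ∀ e ∈ Q, dec (p e) (code e) = e := by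
    intro e he
    simp only [dec, code, Nat.unpair_pair]
    rw [hidx' (p e, e.1) (hE e he).1, hidx' (p e, e.2) (hE e he).2]
  have hdm : ∀ k, Measurable (fun a => dec a k) := fun k => (S.gm _).prodMk (S.gm _)
  let Hit : X → ℕ → Prop := fun a k => dec a k ∈ Q ∧ p (dec a k) = a ∧ code (dec a k) = k
  have hHm : ∀ k, MeasurableSet {a | Hit a k} := fun k =>
    (hdm k hQ).inter ((measurableSet_eq_fun (hp.comp (hdm k)) measurable_id).inter
      (measurableSet_eq_fun (hcode.comp (hdm k)) measurable_const))
  have hHit : ∀ e ∈ Q, Hit (p e) (code e) := by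
    intro e he
    have := hdec e he
    refine ⟨?_, ?_, ?_⟩ <;> rw [this]
    exact he
  have hcm : ∀ n, Measurable (fun a => Nat.count (Hit a) n) := by
    intro n
    induction n with
    | zero => simp only [Nat.count_zero]; exact measurable_const
    | succ n ih =>
      simp only [Nat.count_succ]
      exact ih.add (Measurable.ite (hHm n) measurable_const measurable_const)
  refine ⟨fun e => Nat.count (Hit (p e)) (code e), ?_, ?_⟩
  · intro V hV
    have : (fun e => Nat.count (Hit (p e)) (code e)) ⁻¹' V = ⋃ k, ({e | code e = k} ∩ {e | Nat.count (Hit (p e)) k ∈ V}) := by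
      ext e; simp
    rw [this]
    exact .iUnion fun k => (measurableSet_eq_fun hcode measurable_const).inter (((hcm k).comp hp) hV)
  · intro a ha n
    have hi : {k | Hit a k}.Infinite := by
      have h1 : InjOn code {e | e ∈ Q ∧ p e = a} := by
        rintro e ⟨he, he'⟩ f ⟨hf, hf'⟩ hef
        rw [← hdec e he, ← hdec f hf, he', hf', hef]
      refine ((hinf a ha).image h1).mono ?_
      rintro _ ⟨e, ⟨he, rfl⟩, rfl⟩
      exact hHit e he
    have hk := Nat.nth_mem_of_infinite hi n
    have hk2 := Nat.count_nth_of_infinite hi n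
    set k := Nat.nth (Hit a) n with hkd
    refine ⟨dec a k, ⟨hk.1, hk.2.1, ?_⟩, ?_⟩
    · simp only
      rw [hk.2.1, hk.2.2]
      exact hk2
    · rintro e ⟨he, hea, hen⟩
      simp only at hen
      subst hea
      have : code e = k := Nat.count_injective (hHit e he) hk (hen.trans hk2.symm)
      rw [← this, hdec e he]

theorem perm {R : X → X → Prop} (hR : MeasurableSet {q : X × X | R q.1 q.2}) (hE : ∀ x y, R x y → S.E x y)
    (h1 : ∀ x, ∃! y, R x y) (h2 : ∀ y, ∃! x, R x y) :
    ∃ T : Equiv.Perm X, Measurable T ∧ Measurable T.symm ∧ ∀ x y, T x = y ↔ R x y := by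
  choose f hf hfu using h1
  choose k hk hku using h2
  let T : Equiv.Perm X := ⟨f, k, fun x => (hku _ _ (hf x)).symm, fun y => (hfu _ _ (hk y)).symm⟩
  refine ⟨T, ?_, ?_, ?_⟩
  · intro V hV
    have := S.ex_meas (P := fun x y => R x y ∧ y ∈ V) (hR.inter (measurable_snd hV))
    convert this using 1
    ext x
    simp only [mem_preimage, mem_setOf_eq]
    constructor
    · intro h; exact ⟨f x, hE _ _ (hf x), hf x, h⟩
    · rintro ⟨y, -, h, hy⟩
      rwa [← show y = T x from hfu _ _ h]
  · intro V hV
    have := S.ex_meas (P := fun y x => R x y ∧ x ∈ V) ((measurable_swap hR).inter (measurable_snd hV))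
    convert this using 1
    ext x
    simp only [mem_preimage, mem_setOf_eq]
    constructor
    · intro h; exact ⟨k x, S.sm (hE _ _ (hk x)), hk x, h⟩
    · rintro ⟨y, -, h, hy⟩
      rwa [← show y = T.symm x from hku _ _ h]
  · intro x y
    constructor
    · rintro rfl; exact hf x
    · intro h; exact (hfu _ _ h).symm

/-- breadth first retraction onto a complete section -/
theorem retract {G1 : X → X → Prop} (hG : ∀ x y, S.E x y ↔ Relation.ReflTransGen G1 x y)
    (hG1s : ∀ x y, G1 x y → G1 y x)
    (hGm : MeasurableSet {q : X × X | G1 q.1 q.2}) {A : Set X} (hA : MeasurableSet A)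
    (hAc : ∀ x, ∃ y, S.E x y ∧ y ∈ A) :
    ∃ ρ : X → X, Cell G1 ρ ∧ (∀ x, ρ x ∈ A) ∧ ∀ x ∈ A, ρ x = x := by
  classical
  have hGE : ∀ x y, G1 x y → S.E x y := fun x y h => (hG x y).2 (.single h)
  let B : ℕ → Set X := fun n => Nat.rec (motive := fun _ => Set X) A (fun _ B => B ∪ {x | ∃ y, S.E x y ∧ (G1 x y ∧ y ∈ B)}) n
  have hBs : ∀ n, B (n+1) = B n ∪ {x | ∃ y, S.E x y ∧ (G1 x y ∧ y ∈ B n)} := fun n => rfl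
  have hBm : ∀ n, MeasurableSet (B n) := by
    intro n
    induction n with
    | zero => exact hA
    | succ n ih =>
      rw [hBs]
      exact ih.union (S.ex_meas (P := fun x y => G1 x y ∧ y ∈ B n) (hGm.inter (measurable_snd ih)))
  have hBex : ∀ x, ∃ n, x ∈ B n := by
    intro x
    obtain ⟨y, hxy, hy⟩ := hAc x
    have h := (hG _ _).1 hxy
    induction h using Relation.ReflTransGen.head_induction_on with
    | refl => exact ⟨0, hy⟩
    | @head u v huv _ ih =>
      obtain ⟨n, hn⟩ := ih ((hG _ _).2 (by assumption))
      exact ⟨n+1, by rw [hBs]; exact Or.inr ⟨v, hGE _ _ huv, huv, hn⟩⟩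
  -- parent map at stage n
  let lv : X → ℕ := fun x => Nat.find (hBex x)
  have hlv : Measurable lv := measurable_find (p := fun x n => x ∈ B n) hBex hBm
  have hpar : ∀ x, ∃ i, x ∈ A ∨ (G1 x (S.g i x) ∧ lv (S.g i x) < lv x) := by
    intro x
    by_cases hx : x ∈ A
    · exact ⟨0, Or.inl hx⟩
    · have h1 : x ∈ B (lv x) := Nat.find_spec (hBex x)
      have h2 : lv x ≠ 0 := fun h => by rw [h] at h1; exact hx h1
      obtain ⟨n, hn⟩ := Nat.exists_eq_succ_of_ne_zero h2
      rw [hn, hBs] at h1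
      rcases h1 with h1 | ⟨y, hxy, hg, hy⟩
      · exact absurd h1 (Nat.find_min (hBex x) (by change n < lv x; omega))
      · obtain ⟨i, rfl⟩ := (S.hE _ _).1 hxy
        refine ⟨i, Or.inr ⟨hg, ?_⟩⟩
        have : lv (S.g i x) ≤ n := Nat.find_min' (hBex _) hy
        omega
  have hpm : ∀ i, MeasurableSet {x | x ∈ A ∨ (G1 x (S.g i x) ∧ lv (S.g i x) < lv x)} := fun i =>
    hA.union (((measurable_id.prodMk (S.gm i)) hGm).inter (measurableSet_lt (hlv.comp (S.gm i)) hlv))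
  let pn : X → ℕ := fun x => Nat.find (hpar x)
  have hpn : Measurable pn := measurable_find hpar hpm
  let par : X → X := fun x => if x ∈ A then x else S.g (pn x) x
  have hparm : Measurable par := by
    refine Measurable.ite hA measurable_id ?_
    intro V hV
    have : (fun x => S.g (pn x) x) ⁻¹' V = ⋃ k, ({x | pn x = k} ∩ S.g k ⁻¹' V) := by ext; simp
    rw [this]
    exact .iUnion fun k => (measurableSet_eq_fun hpn measurable_const).inter (S.gm k hV)
  have hpA : ∀ x ∈ A, par x = x := fun x hx => if_pos hx
  have hpG : ∀ x, x ∉ A → G1 x (par x) ∧ lv (par x) < lv x := by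
    intro x hx
    have e : par x = S.g (pn x) x := if_neg hx
    rw [e]
    rcases Nat.find_spec (hpar x) with h | h
    · exact absurd h hx
    · exact h
  let ρ : X → X := fun x => par^[lv x] x
  have hit : ∀ n x, lv x ≤ n → par^[n] x ∈ A := by
    intro n
    induction n with
    | zero => 
      intro x hx
      have h1 : x ∈ B (lv x) := Nat.find_spec (hBex x)
      rw [Nat.le_zero.1 hx] at h1
      exact h1
    | succ n ih =>
      intro x hx
      rw [Function.iterate_succ_apply]
      apply ih
      by_cases h : x ∈ A
      · rw [hpA x h]
        have : lv x ≤ 0 := Nat.find_min' (hBex _) h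
        omega
      · have := (hpG x h).2
        omega
  have hA0 : ∀ x ∈ A, ∀ n, par^[n] x = x := fun x hx n => Function.iterate_fixed (hpA x hx) n
  have hstab : ∀ n x, lv x ≤ n → par^[n] x = ρ x := by
    intro n x hn
    obtain ⟨k, rfl⟩ := Nat.exists_eq_add_of_le' hn
    rw [Function.iterate_add_apply]
    exact hA0 _ (hit _ _ le_rfl) _
  have hρA : ∀ x, ρ x ∈ A := fun x => hit _ x le_rfl
  have hρ1 : ∀ x ∈ A, ρ x = x := fun x hx => hA0 x hx _
  have hρp : ∀ x, ρ (par x) = ρ x := by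
    intro x
    by_cases h : x ∈ A
    · rw [hpA x h]
    · have h1 := (hpG x h).2
      rw [← hstab (lv x - 1) (par x) (by omega), ← Function.iterate_succ_apply, Nat.succ_eq_add_one, Nat.sub_add_cancel (by omega)]
  refine ⟨ρ, ⟨?_, fun x => hρ1 _ (hρA x), ?_⟩, hρA, hρ1⟩
  · intro V hV
    have : ρ ⁻¹' V = ⋃ k, ({x | lv x = k} ∩ par^[k] ⁻¹' V) := by ext; simp [ρ]
    rw [this]
    exact .iUnion fun k => (measurableSet_eq_fun hlv measurable_const).inter (hparm.iterate k hV)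
  · have : ∀ n x, lv x ≤ n → Relation.ReflTransGen (fun u v => G1 u v ∧ ρ u = ρ v) x (ρ x) := by
      intro n
      induction n with
      | zero =>
        intro x hx
        have hxA := hit 0 x hx
        rw [Function.iterate_zero_apply] at hxA
        rw [hρ1 x hxA]
      | succ n ih =>
        intro x hx
        by_cases h : x ∈ A
        · rw [hρ1 x h]
        · have h1 := hpG x h
          have h2 := ih (par x) (by omega)
          rw [hρp] at h2
          exact .head ⟨h1.1, (hρp x).symm⟩ h2
    exact fun x => this _ x le_rfl

end CB

namespace Cmb

structure Dat {X ι : Type*} (G : Set (X × X)) (G1 : X → X → Prop) (T : ι → Equiv.Perm X) (a b : ι) where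
  hac : AcyclicGraph G
  hirr : ∀ x, (x, x) ∉ G
  hsy : ∀ x y, (x, y) ∈ G → (y, x) ∈ G
  g1 : ∀ x y, G1 x y → (x, y) ∈ G
  g1s : ∀ x y, G1 x y → G1 y x
  ρ : X → X
  π : X → X
  rk : X → ℤ
  ed : ι → X → X × X
  cell : ∀ x, Relation.ReflTransGen (fun u v => G1 u v ∧ ρ u = ρ v) x (ρ x)
  ρπ : ∀ x, ρ (π x) = π x
  πρ : ∀ x, π (ρ x) = ρ x
  πE : ∀ x, Relation.ReflTransGen G1 x (π x)
  hba : b ≠ a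
  edG : ∀ j x, j ≠ a → ed j x ∈ G
  edn : ∀ j x, j ≠ a → G1 (ed j x).1 (ed j x).2 → ρ (ed j x).1 ≠ ρ (ed j x).2
  edσ : ∀ j x, j ≠ a → G1 (ed j x).1 (ed j x).2 → π x = ρ (ed j x).1
  edσ' : ∀ j x, j ≠ a → ¬ G1 (ed j x).1 (ed j x).2 → π x = π (ed j x).1
  edτ : ∀ j x, j ≠ a → G1 (ed j x).1 (ed j x).2 → π (T j x) = ρ (ed j x).2
  edτ' : ∀ j x, j ≠ a → ¬ G1 (ed j x).1 (ed j x).2 → π (T j x) = π (ed j x).2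
  edinj : ∀ j x j' x', j ≠ a → j' ≠ a → ed j x = ed j' x' → j = j' ∧ x = x'
  edO : ∀ j x j' x', j ≠ a → j' ≠ a → ed j x ≠ (ed j' x').swap
  edsurj : ∀ u v, (u, v) ∈ G → (G1 u v → ρ u ≠ ρ v) → ∃ j x, j ≠ a ∧ (ed j x = (u, v) ∨ ed j x = (v, u))
  sπ : ∀ x, π (T a x) = π x
  srk : ∀ x, rk (T a x) = rk x + 1
  rkinj : ∀ x y, π x = π y → rk x = rk y → x = y
  hbH : ∀ x, ∃ y, π y = π x ∧ ¬ G1 (ed b y).1 (ed b y).2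

namespace Dat
variable {X ι : Type*} {G : Set (X × X)} {G1 : X → X → Prop} {T : ι → Equiv.Perm X} {a b : ι}

theorem ππ (d : Dat G G1 T a b) (x : X) : d.π (d.π x) = d.π x := by
  have h := d.πρ (d.π x)
  rwa [d.ρπ] at h

theorem inv_of {R : X → X → Prop} {χ : X → Prop} (h : ∀ x y, R x y → (χ x ↔ χ y)) {x y : X}
    (hxy : Relation.ReflTransGen R x y) : χ x ↔ χ y := by
  induction hxy with
  | refl => exact Iff.rfl
  | tail _ h' ih => exact ih.trans (h _ _ h')

theorem mono_rtg {α : Type*} {R R' : α → α → Prop} (h : ∀ a b, R a b → R' a b) {x y : α}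
    (hx : Relation.ReflTransGen R x y) : Relation.ReflTransGen R' x y := by
  induction hx with
  | refl => exact .refl
  | tail _ h' ih => exact ih.tail (h _ _ h')

theorem e1eq (d : Dat G G1 T a b) : Equivalence (Relation.ReflTransGen G1) := CB.rtg_eqv d.g1s

theorem ρE (d : Dat G G1 T a b) (x : X) : Relation.ReflTransGen G1 x (d.ρ x) := mono_rtg (fun _ _ h => h.1) (d.cell x)

/-- the basic cut attached to a labelled edge -/
theorem base (d : Dat G G1 T a b) (l : ι × X) (hl : l.1 ≠ a) : ∃ χ : X → Prop, ¬ (χ (d.ed l.1 l.2).1 ↔ χ (d.ed l.1 l.2).2) ∧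
    (∀ l' : ι × X, l'.1 ≠ a → l' ≠ l → (χ (d.ed l'.1 l'.2).1 ↔ χ (d.ed l'.1 l'.2).2)) ∧
    (∀ x, G1 (d.ed l.1 l.2).1 (d.ed l.1 l.2).2 → (χ x ↔ χ (d.ρ x))) ∧
    (¬ G1 (d.ed l.1 l.2).1 (d.ed l.1 l.2).2 → ∀ x y, Relation.ReflTransGen G1 x y → (χ x ↔ χ y)) := by
  obtain ⟨χ, h1, h2⟩ := gcut d.hac d.hirr d.hsy (u := (d.ed l.1 l.2).1) (v := (d.ed l.1 l.2).2) (d.edG _ _ hl)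
  refine ⟨χ, h1, ?_, ?_, ?_⟩
  · intro l' hl' hne
    refine h2 _ _ (d.edG _ _ hl') ?_ ?_
    · rintro ⟨e1, e2⟩
      apply hne
      obtain ⟨e3, e4⟩ := d.edinj l'.1 l'.2 l.1 l.2 hl' hl (Prod.ext e1 e2)
      exact Prod.ext e3 e4
    · rintro ⟨e1, e2⟩
      exact d.edO l'.1 l'.2 l.1 l.2 hl' hl (Prod.ext e1 e2)
  · intro x hg
    refine inv_of ?_ (d.cell x)
    rintro u v ⟨huv, hr⟩
    have := d.edn _ _ hl hg
    refine h2 _ _ (d.g1 _ _ huv) ?_ ?_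
    · rintro ⟨rfl, rfl⟩; exact this hr
    · rintro ⟨rfl, rfl⟩; exact this hr.symm
  · intro hg x y hxy
    refine inv_of ?_ hxy
    intro u v huv
    refine h2 _ _ (d.g1 _ _ huv) ?_ ?_
    · rintro ⟨rfl, rfl⟩; exact hg huv
    · rintro ⟨rfl, rfl⟩; exact hg (d.g1s _ _ huv)

def Fs (_ : Dat G G1 T a b) (l : ι × X) : Prop := l.1 = a
def Lb (d : Dat G G1 T a b) (l : ι × X) : Prop := l.1 ≠ a ∧ G1 (d.ed l.1 l.2).1 (d.ed l.1 l.2).2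
def Hb (d : Dat G G1 T a b) (l : ι × X) : Prop := l.1 ≠ a ∧ ¬ G1 (d.ed l.1 l.2).1 (d.ed l.1 l.2).2

theorem cutL (d : Dat G G1 T a b) (l : ι × X) (hl : d.Lb l) : ∃ κ, IsCut src (tgt T) d.Lb l κ ∧ ∀ z z', d.π z = d.π z' → (κ z ↔ κ z') := by
  obtain ⟨χ, h1, h2, h3, -⟩ := d.base l hl.1
  refine ⟨fun z => χ (d.π z), ⟨?_, ?_⟩, fun z z' h => by simp only [h]⟩
  · simp only [src, tgt]
    rw [d.edσ _ _ hl.1 hl.2, d.edτ _ _ hl.1 hl.2, ← h3 _ hl.2, ← h3 _ hl.2]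
    exact h1
  · intro l' hl' hne
    simp only [src, tgt]
    rw [d.edσ _ _ hl'.1 hl'.2, d.edτ _ _ hl'.1 hl'.2, ← h3 _ hl.2, ← h3 _ hl.2]
    exact h2 l' hl'.1 hne

theorem cutH (d : Dat G G1 T a b) (l : ι × X) (hl : d.Hb l) : ∃ κ, IsCut src (tgt T) d.Hb l κ ∧
    ∀ z z', Relation.ReflTransGen G1 z z' → (κ z ↔ κ z') := by
  obtain ⟨χ, h1, h2, -, h3⟩ := d.base l hl.1
  have h3 := h3 hl.2
  have e : ∀ l', d.Hb l' → (χ (src l') ↔ χ (d.ed l'.1 l'.2).1) ∧ (χ (tgt T l') ↔ χ (d.ed l'.1 l'.2).2) := by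
    intro l' hl'
    simp only [src, tgt]
    constructor
    · rw [h3 _ _ (d.πE l'.2), d.edσ' _ _ hl'.1 hl'.2, ← h3 _ _ (d.πE _)]
    · rw [h3 _ _ (d.πE (T l'.1 l'.2)), d.edτ' _ _ hl'.1 hl'.2, ← h3 _ _ (d.πE _)]
  refine ⟨χ, ⟨?_, ?_⟩, h3⟩
  · rw [(e l hl).1, (e l hl).2]; exact h1
  · intro l' hl' hne
    rw [(e l' hl').1, (e l' hl').2]; exact h2 l' hl'.1 hne

theorem sE (d : Dat G G1 T a b) (x : X) : Relation.ReflTransGen G1 x (T a x) := by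
  refine (d.πE x).trans ?_
  rw [← d.sπ]; exact d.e1eq.symm (d.πE _)

theorem lE (d : Dat G G1 T a b) (l : ι × X) (hl : d.Lb l) : Relation.ReflTransGen G1 (src l) (tgt T l) := by
  simp only [src, tgt]
  refine (d.πE _).trans (Relation.ReflTransGen.trans ?_ (d.e1eq.symm (d.πE _)))
  rw [d.edσ _ _ hl.1 hl.2, d.edτ _ _ hl.1 hl.2]
  exact (d.e1eq.symm (d.ρE _)).trans (.head hl.2 (d.ρE _))

theorem e1E (d : Dat G G1 T a b) {x y : X} (h : Relation.ReflTransGen G1 x y) : (x, y) ∈ connRel G :=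
  mono_rtg (fun _ _ h => d.g1 _ _ h) h

theorem Eeq (d : Dat G G1 T a b) : Equivalence (fun x y => (x, y) ∈ connRel G) := by
  have := CB.rtg_eqv (G := fun x y => (x, y) ∈ G) d.hsy
  exact this

theorem trich (d : Dat G G1 T a b) (l : ι × X) : d.Fs l ∨ d.Lb l ∨ d.Hb l := by
  by_cases h : l.1 = a
  · exact Or.inl h
  · by_cases h' : G1 (d.ed l.1 l.2).1 (d.ed l.1 l.2).2
    · exact Or.inr (Or.inl ⟨h, h'⟩)
    · exact Or.inr (Or.inr ⟨h, h'⟩)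

theorem tE (d : Dat G G1 T a b) (l : ι × X) : (src l, tgt T l) ∈ connRel G := by
  rcases d.trich l with h | h | h
  · have h' : l.1 = a := h
    simp only [src, tgt, h']
    exact d.e1E (d.sE _)
  · exact d.e1E (d.lE l h)
  · simp only [src, tgt]
    have h1 := d.e1E (d.πE l.2)
    have h2 := d.e1E (d.πE (T l.1 l.2))
    rw [d.edσ' _ _ h.1 h.2] at h1
    rw [d.edτ' _ _ h.1 h.2] at h2
    have h3 : ((d.ed l.1 l.2).1, (d.ed l.1 l.2).2) ∈ connRel G := .single (d.edG _ _ h.1)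
    exact d.Eeq.trans (d.Eeq.trans h1 (d.Eeq.symm (d.e1E (d.πE _)))) (d.Eeq.trans h3 (d.Eeq.trans (d.e1E (d.πE _)) (d.Eeq.symm h2)))

theorem full (d : Dat G G1 T a b) {l : ι × X} {χ : X → Prop} (h : IsCut src (tgt T) (fun l => (d.Fs l ∨ d.Lb l) ∨ d.Hb l) l χ) :
    IsCut src (tgt T) (fun _ => True) l χ :=
  ⟨h.1, fun l' _ hne => h.2 l' (or_assoc.2 (d.trich l')) hne⟩

theorem cuts (d : Dat G G1 T a b) (l : ι × X) : ∃ χ, IsCut src (tgt T) (fun _ => True) l χ ∧ ∀ x0, (x0 = src l ∨ x0 = tgt T l) →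
    ∃ z0, (z0, x0) ∈ connRel G ∧ ∀ z, Relation.ReflTransGen G1 z0 z → (χ z ↔ χ x0) := by
  have hfine2 : ∀ l, d.Fs l ∨ d.Lb l → Relation.ReflTransGen G1 (src l) (tgt T l) := by
    rintro l (h | h)
    · have h' : l.1 = a := h
      simp only [src, tgt, h']
      exact d.sE _
    · exact d.lE l h
  have hdisj2 : ∀ l, d.Fs l ∨ d.Lb l → ¬ d.Hb l := by
    rintro l (h | h) h'
    · exact h'.1 h
    · exact h'.2 h.2
  -- level two for fine edges
  have lev2 : ∀ l χ1, d.Fs l ∨ d.Lb l → IsCut src (tgt T) (fun l => d.Fs l ∨ d.Lb l) l χ1 →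
      (∀ x0, (x0 = src l ∨ x0 = tgt T l) → ∃ h, d.Hb h ∧ Relation.ReflTransGen G1 (src l) (src h) ∧ (χ1 (src h) ↔ χ1 x0)) →
      ∃ χ, IsCut src (tgt T) (fun _ => True) l χ ∧ ∀ x0, (x0 = src l ∨ x0 = tgt T l) →
    ∃ z0, (z0, x0) ∈ connRel G ∧ ∀ z, Relation.ReflTransGen G1 z0 z → (χ z ↔ χ x0) := by
    intro l χ1 hl hχ1 hex
    obtain ⟨χ, c1, c2, c3⟩ := expF src (tgt T) d.e1eq hfine2 hdisj2 d.cutH hl hχ1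
    refine ⟨χ, d.full c1, ?_⟩
    intro x0 hx0
    obtain ⟨h, hh, h1, h2⟩ := hex x0 hx0
    have hsx : Relation.ReflTransGen G1 (src l) x0 := by
      rcases hx0 with rfl | rfl
      · exact .refl
      · exact hfine2 l hl
    refine ⟨tgt T h, ?_, ?_⟩
    · exact d.Eeq.trans (d.Eeq.symm (d.tE h)) (d.Eeq.trans (d.Eeq.symm (d.e1E h1)) (d.e1E hsx))
    · intro z hz
      rw [c3 h hh h1 z hz, c2 _ h1, c2 _ hsx, h2]
  have findH : ∀ x, ∃ h, d.Hb h ∧ d.π (src h) = d.π x := by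
    intro x
    obtain ⟨y, h1, h2⟩ := d.hbH x
    exact ⟨(b, y), ⟨d.hba, h2⟩, h1⟩
  have πe : ∀ x y, d.π x = d.π y → Relation.ReflTransGen G1 x y := by
    intro x y h
    refine (d.πE x).trans ?_
    rw [h]; exact d.e1eq.symm (d.πE y)
  have peq : Equivalence (fun x y => d.π x = d.π y) := ⟨fun _ => rfl, fun h => h.symm, fun h h' => h.trans h'⟩
  have hfine1 : ∀ l, d.Fs l → d.π (src l) = d.π (tgt T l) := by
    intro l hl
    have h' : l.1 = a := hl
    simp only [src, tgt, h', d.sπ]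
  rcases d.trich l with hl | hl | hl
  · -- line edges
    obtain ⟨i, x⟩ := l
    have hl' : i = a := hl
    subst hl'
    have hc0 : IsCut src (tgt T) d.Fs (i, x) (fun z => d.π z = d.π x ∧ d.rk x < d.rk z) := by
      refine ⟨?_, ?_⟩
      · simp [src, tgt, d.sπ, d.srk]
      · rintro ⟨j, y⟩ hj hne
        have hj' : j = i := hj
        subst hj'
        simp only [src, tgt, d.sπ, d.srk]
        have hyx : y ≠ x := fun h => hne (by rw [h])
        constructor
        · rintro ⟨h1, h2⟩; exact ⟨h1, by omega⟩
        · rintro ⟨h1, h2⟩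
          refine ⟨h1, ?_⟩
          have : d.rk y ≠ d.rk x := fun h => hyx (d.rkinj _ _ h1 h)
          omega
    obtain ⟨χ1, c1, c2, c3⟩ := expF src (tgt T) peq hfine1 (fun l hl hl' => hl'.1 hl) d.cutL hl hc0
    refine lev2 _ χ1 (Or.inl hl) c1 ?_
    intro x0 hx0
    have hπ0 : d.π x = d.π x0 := by
      rcases hx0 with rfl | rfl
      · rfl
      · exact hfine1 _ hl
    by_cases hb : d.Hb (b, x0)
    · exact ⟨(b, x0), hb, πe _ _ hπ0, Iff.rfl⟩
    · have hb' : d.Lb (b, x0) := by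
        rcases d.trich (b, x0) with h | h | h
        · exact absurd h d.hba
        · exact h
        · exact absurd h hb
      obtain ⟨h, hh, hπ⟩ := findH (tgt T (b, x0))
      refine ⟨h, hh, ?_, ?_⟩
      · exact ((πe _ _ hπ0).trans (d.lE _ hb')).trans (πe _ _ hπ.symm)
      · exact c3 (b, x0) hb' hπ0 _ hπ.symm
  · obtain ⟨κ, hκ, hκi⟩ := d.cutL l hl
    refine lev2 l κ (Or.inr hl) (expH src (tgt T) (P := fun x y => d.π x = d.π y) hfine1 hκ hκi) ?_
    intro x0 hx0
    obtain ⟨h, hh, hπ⟩ := findH x0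
    refine ⟨h, hh, ?_, hκi _ _ hπ⟩
    refine Relation.ReflTransGen.trans ?_ (πe _ _ hπ.symm)
    rcases hx0 with rfl | rfl
    · exact .refl
    · exact d.lE _ hl
  · obtain ⟨κ, hκ, hκi⟩ := d.cutH l hl
    refine ⟨κ, d.full (expH src (tgt T) hfine2 hκ hκi), ?_⟩
    intro x0 _
    exact ⟨x0, d.Eeq.refl _, fun z hz => (hκi _ _ hz).symm⟩

theorem orb_sub (d : Dat G G1 T a b) (g : FreeGroup ι) (x : X) : (x, FreeGroup.lift T g x) ∈ connRel G := by
  induction g using FreeGroup.induction_on generalizing x with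
  | C1 => simpa using d.Eeq.refl x
  | of i => simpa using d.tE (i, x)
  | inv_of i h =>
    have := h ((FreeGroup.lift T (FreeGroup.of i)).symm x)
    rw [Equiv.apply_symm_apply] at this
    rw [map_inv]
    exact d.Eeq.symm this
  | mul g h ih1 ih2 =>
    rw [map_mul, Equiv.Perm.mul_apply]
    exact d.Eeq.trans (ih2 x) (ih1 _)

theorem orb (d : Dat G G1 T a b) (x y : X) : (x, y) ∈ connRel G ↔ ∃ g, FreeGroup.lift T g x = y := by
  constructor
  swap
  · rintro ⟨g, rfl⟩; exact d.orb_sub g x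
  let O : X → X → Prop := fun x y => ∃ g, FreeGroup.lift T g x = y
  have hO : Equivalence O := by
    refine ⟨fun x => ⟨1, by simp⟩, ?_, ?_⟩
    · rintro x y ⟨g, rfl⟩
      exact ⟨g⁻¹, by rw [map_inv]; simp⟩
    · rintro x y z ⟨g, rfl⟩ ⟨h, rfl⟩
      exact ⟨h * g, by rw [map_mul, Equiv.Perm.mul_apply]⟩
  have hT : ∀ j x, O x (T j x) := fun j x => ⟨FreeGroup.of j, by simp⟩
  have hup : ∀ n : ℕ, ∀ x y, d.π x = d.π y → d.rk y = d.rk x + n → O x y := by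
    intro n
    induction n with
    | zero =>
      intro x y h1 h2
      rw [d.rkinj x y h1 (by omega)]
      exact hO.refl _
    | succ n ih =>
      intro x y h1 h2
      refine hO.trans (hT a x) (ih _ _ (by rw [d.sπ, h1]) ?_)
      rw [d.srk]; push_cast at h2; omega
  have hfib : ∀ x y, d.π x = d.π y → O x y := by
    intro x y h
    rcases le_total (d.rk x) (d.rk y) with h' | h'
    · exact hup (d.rk y - d.rk x).toNat x y h (by omega)
    · exact hO.symm (hup (d.rk x - d.rk y).toNat y x h.symm (by omega))
  have hπ : ∀ x, O x (d.π x) := fun x => hfib _ _ (d.ππ x).symm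
  have hE : ∀ u v, (u, v) ∈ G → (G1 u v → O (d.ρ u) (d.ρ v)) ∧ (¬ G1 u v → O u v) := by
    intro u v huv
    by_cases hg : G1 u v ∧ d.ρ u = d.ρ v
    · refine ⟨fun _ => by rw [hg.2]; exact hO.refl _, fun h => absurd hg.1 h⟩
    · obtain ⟨j, x, hj, hx⟩ := d.edsurj u v huv (fun h h' => hg ⟨h, h'⟩)
      have key : ∀ u v, d.ed j x = (u, v) → (G1 u v → O (d.ρ u) (d.ρ v)) ∧ (¬ G1 u v → O u v) := by
        intro u v hx
        have e := hO.trans (hO.symm (hπ x)) (hO.trans (hT j x) (hπ (T j x)))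
        constructor
        · intro hg
          have e1 := d.edσ j x hj (by rw [hx]; exact hg)
          have e2 := d.edτ j x hj (by rw [hx]; exact hg)
          rw [e1, e2, hx] at e
          exact e
        · intro hg
          have e1 := d.edσ' j x hj (by rw [hx]; exact hg)
          have e2 := d.edτ' j x hj (by rw [hx]; exact hg)
          rw [e1, e2, hx] at e
          exact hO.trans (hπ u) (hO.trans e (hO.symm (hπ v)))
      rcases hx with hx | hx
      · exact key u v hx
      · have := key v u hx
        exact ⟨fun h => hO.symm (this.1 (d.g1s _ _ h)), fun h => hO.symm (this.2 fun h' => h (d.g1s _ _ h'))⟩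
  have hE1 : ∀ u v, Relation.ReflTransGen G1 u v → O (d.ρ u) (d.ρ v) := by
    intro u v h
    induction h with
    | refl => exact hO.refl _
    | tail _ h' ih => exact hO.trans ih ((hE _ _ (d.g1 _ _ h')).1 h')
  intro h
  change O x y
  have h' : Relation.ReflTransGen (fun a b => (a, b) ∈ G) x y := h
  clear h
  induction h' with
  | refl => exact hO.refl _
  | @tail u v _ h' ih =>
    refine hO.trans ih ?_
    by_cases hg : G1 u v
    · have h1 : Relation.ReflTransGen G1 (d.π u) (d.π v) := (d.e1eq.symm (d.πE u)).trans (.head hg (d.πE v))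
      have := hE1 _ _ h1
      rw [d.ρπ, d.ρπ] at this
      exact hO.trans (hπ u) (hO.trans this (hO.symm (hπ v)))
    · exact (hE u v h').2 hg

end Dat
end Cmb

namespace CB
variable {X : Type*} [MeasurableSpace X] [StandardBorelSpace X] {m : Measure X} (S : CB m)

theorem matchP {Q : Set (X × X)} (hQ : MeasurableSet Q) {p q : X × X → X} (hp : Measurable p) (hq : Measurable q)
    (hEp : ∀ e ∈ Q, S.E (p e) e.1 ∧ S.E (p e) e.2) (hEq : ∀ e ∈ Q, S.E (q e) e.1 ∧ S.E (q e) e.2) {A : Set X}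
    (hpA : ∀ e ∈ Q, p e ∈ A) (hqA : ∀ e ∈ Q, q e ∈ A)
    (hip : ∀ a ∈ A, {e | e ∈ Q ∧ p e = a}.Infinite) (hiq : ∀ a ∈ A, {e | e ∈ Q ∧ q e = a}.Infinite)
    {π : X → X} {r : X → ℕ} (hπ : Measurable π) (hr : Measurable r) (hπA : ∀ x, π x ∈ A) (hπE : ∀ x, S.E x (π x))
    (hπr : ∀ a ∈ A, ∀ n, ∃! x, π x = a ∧ r x = n) :
    ∃ (T : Equiv.Perm X) (ed : X → X × X), Measurable T ∧ Measurable T.symm ∧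
      (∀ x, ed x ∈ Q ∧ p (ed x) = π x ∧ q (ed x) = π (T x)) ∧ Function.Injective ed ∧ ∀ e ∈ Q, ∃ x, ed x = e := by
  obtain ⟨rO, hrO, hO⟩ := S.rank hp hQ hEp hip
  obtain ⟨rI, hrI, hI⟩ := S.rank hq hQ hEq hiq
  let R : X → X → Prop := fun x y => ∃ e : X × X, e ∈ Q ∧ p e = π x ∧ rO e = r x ∧ q e = π y ∧ rI e = r y
  have hRE : ∀ x y, R x y → S.E x y := by
    rintro x y ⟨e, he, h1, -, h2, -⟩
    have a1 := (hEp e he).1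
    have a2 := (hEq e he).1
    rw [h1] at a1; rw [h2] at a2
    exact S.tr (S.tr (hπE x) a1) (S.sm (S.tr (hπE y) a2))
  have hRm : MeasurableSet {z : X × X | R z.1 z.2} := by
    have : {z : X × X | R z.1 z.2} = ⋃ i, ⋃ k, {z : X × X | (S.g i z.1, S.g k z.1) ∈ Q ∧ p (S.g i z.1, S.g k z.1) = π z.1 ∧
        rO (S.g i z.1, S.g k z.1) = r z.1 ∧ q (S.g i z.1, S.g k z.1) = π z.2 ∧ rI (S.g i z.1, S.g k z.1) = r z.2} := by
      ext ⟨x, y⟩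
      simp only [mem_setOf_eq, mem_iUnion]
      constructor
      · rintro ⟨⟨u, v⟩, he, h1, h2⟩
        have a1 := hEp _ he
        rw [h1] at a1
        obtain ⟨i, hi⟩ := (S.hE _ _).1 (S.tr (hπE x) a1.1)
        obtain ⟨k, hk⟩ := (S.hE _ _).1 (S.tr (hπE x) a1.2)
        simp only at hi hk
        refine ⟨i, k, ?_⟩
        rw [hi, hk]
        exact ⟨he, h1, h2⟩
      · rintro ⟨i, k, h⟩
        exact ⟨_, h⟩
    rw [this]
    refine .iUnion fun i => .iUnion fun k => ?_
    have hm : Measurable (fun z : X × X => (S.g i z.1, S.g k z.1)) :=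
      ((S.gm i).comp measurable_fst).prodMk ((S.gm k).comp measurable_fst)
    refine (hm hQ).inter (.inter ?_ (.inter ?_ (.inter ?_ ?_)))
    · exact measurableSet_eq_fun (hp.comp hm) (hπ.comp measurable_fst)
    · exact measurableSet_eq_fun (hrO.comp hm) (hr.comp measurable_fst)
    · exact measurableSet_eq_fun (hq.comp hm) (hπ.comp measurable_snd)
    · exact measurableSet_eq_fun (hrI.comp hm) (hr.comp measurable_snd)
  have h1 : ∀ x, ∃! y, R x y := by
    intro x
    obtain ⟨e, ⟨he, h1, h2⟩, heu⟩ := hO (π x) (hπA x) (r x)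
    obtain ⟨y, ⟨hy1, hy2⟩, hyu⟩ := hπr (q e) (hqA e he) (rI e)
    refine ⟨y, ⟨e, he, h1, h2, hy1.symm, hy2.symm⟩, ?_⟩
    rintro y' ⟨e', he', h1', h2', h3', h4'⟩
    have : e' = e := heu e' ⟨he', h1', h2'⟩
    subst this
    exact hyu _ ⟨h3'.symm, h4'.symm⟩
  have h2 : ∀ y, ∃! x, R x y := by
    intro x
    obtain ⟨e, ⟨he, h1, h2⟩, heu⟩ := hI (π x) (hπA x) (r x)
    obtain ⟨y, ⟨hy1, hy2⟩, hyu⟩ := hπr (p e) (hpA e he) (rO e)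
    refine ⟨y, ⟨e, he, hy1.symm, hy2.symm, h1, h2⟩, ?_⟩
    rintro y' ⟨e', he', h3', h4', h1', h2'⟩
    have : e' = e := heu e' ⟨he', h1', h2'⟩
    subst this
    exact hyu _ ⟨h3'.symm, h4'.symm⟩
  obtain ⟨T, hT1, hT2, hT⟩ := S.perm hRm hRE h1 h2
  choose ed hed hedu using fun x => hO (π x) (hπA x) (r x)
  refine ⟨T, ed, hT1, hT2, ?_, ?_, ?_⟩
  · intro x
    refine ⟨(hed x).1, (hed x).2.1, ?_⟩
    obtain ⟨e, he, h1, h2, h3, -⟩ := (hT x (T x)).1 rfl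
    rw [← h3, hedu x e ⟨he, h1, h2⟩]
  · intro x y hxy
    have a1 := hed x
    have a2 := hed y
    rw [← hxy] at a2
    exact (hπr (π x) (hπA x) (r x)).unique ⟨rfl, rfl⟩ ⟨a2.2.1.symm.trans a1.2.1, a2.2.2.symm.trans a1.2.2⟩
  · intro e he
    obtain ⟨x, ⟨hx1, hx2⟩, -⟩ := hπr (p e) (hpA e he) (rO e)
    exact ⟨x, (hedu x e ⟨he, hx1.symm, hx2.symm⟩).symm⟩

theorem lineP {π : X → X} {r : X → ℕ} {A : Set X} (hπ : Measurable π) (hr : Measurable r) (hπA : ∀ x, π x ∈ A) (hπE : ∀ x, S.E x (π x))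
    (hπr : ∀ a ∈ A, ∀ n, ∃! x, π x = a ∧ r x = n) :
    ∃ (T : Equiv.Perm X) (ζ : ℕ ≃ ℤ), Measurable T ∧ Measurable T.symm ∧ ∀ x, π (T x) = π x ∧ ζ (r (T x)) = ζ (r x) + 1 := by
  let ζ : ℕ ≃ ℤ := Equiv.intEquivNat.symm
  let R : X → X → Prop := fun x y => π y = π x ∧ ζ (r y) = ζ (r x) + 1
  have hRE : ∀ x y, R x y → S.E x y := by
    rintro x y ⟨h, -⟩
    have := hπE y
    rw [h] at this
    exact S.tr (hπE x) (S.sm this)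
  have hζ : Measurable ζ := measurable_of_countable _
  have hRm : MeasurableSet {z : X × X | R z.1 z.2} := by
    refine (measurableSet_eq_fun (hπ.comp measurable_snd) (hπ.comp measurable_fst)).inter ?_
    exact measurableSet_eq_fun (hζ.comp (hr.comp measurable_snd)) ((hζ.comp (hr.comp measurable_fst)).add_const _)
  have h1 : ∀ x, ∃! y, R x y := by
    intro x
    obtain ⟨y, ⟨hy1, hy2⟩, hyu⟩ := hπr (π x) (hπA x) (ζ.symm (ζ (r x) + 1))
    refine ⟨y, ⟨hy1, by rw [hy2]; simp⟩, ?_⟩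
    rintro y' ⟨h1, h2⟩
    exact hyu y' ⟨h1, by rw [← h2]; simp⟩
  have h2 : ∀ y, ∃! x, R x y := by
    intro x
    obtain ⟨y, ⟨hy1, hy2⟩, hyu⟩ := hπr (π x) (hπA x) (ζ.symm (ζ (r x) - 1))
    refine ⟨y, ⟨hy1.symm, by rw [hy2]; simp⟩, ?_⟩
    rintro y' ⟨h1, h2⟩
    exact hyu y' ⟨h1.symm, by rw [h2]; simp⟩
  obtain ⟨T, hT1, hT2, hT⟩ := S.perm hRm hRE h1 h2
  exact ⟨T, ζ, hT1, hT2, fun x => (hT x (T x)).1 rfl⟩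

open Classical in
theorem build {ι : Type*} [Countable ι] {a b : ι} (hba : b ≠ a) {G : Set (X × X)} (hGm : MeasurableSet G) (hac : AcyclicGraph G)
    (hirr : ∀ x, (x, x) ∉ G) (hsy : ∀ x y, (x, y) ∈ G → (y, x) ∈ G) (hE : ∀ x y, S.E x y ↔ (x, y) ∈ connRel G)
    {G1 : X → X → Prop} (g1 : ∀ x y, G1 x y → (x, y) ∈ G) (g1s : ∀ x y, G1 x y → G1 y x)
    (g1m : MeasurableSet {z : X × X | G1 z.1 z.2})
    {A : Set X} (hA : MeasurableSet A) (hAc : ∀ x, ∃ y, Relation.ReflTransGen G1 x y ∧ y ∈ A)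
    {Dj : ι → Set X} (hDm : ∀ j, MeasurableSet (Dj j)) (hDd : ∀ j j' x, x ∈ Dj j → x ∈ Dj j' → j = j')
    {η : X → X} (hη : Measurable η) (hηi : ∀ j j' x y, x ∈ Dj j → y ∈ Dj j' → η x = η y → x = y)
    (hηD : ∀ j j' x, x ∈ Dj j → η x ∉ Dj j') (hηG : ∀ j x, x ∈ Dj j → (x, η x) ∈ G) (hηG1 : ∀ j x, x ∈ Dj j → ¬ G1 x (η x))
    {α : ι × ℕ × Bool → X → X} (hαm : ∀ k, Measurable (α k))
    (hαi : ∀ k k' x x', x ∈ A → x' ∈ A → α k x = α k' x' → k = k' ∧ x = x')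
    (hαA : ∀ k x, x ∈ A → α k x ∉ A) (hαE : ∀ k x, x ∈ A → Relation.ReflTransGen G1 x (α k x))
    (hα0 : ∀ j n x, x ∈ A → α (j, n, false) x ∈ Dj j) (hα1 : ∀ j n x, x ∈ A → ∃ y ∈ Dj j, η y = α (j, n, true) x) :
    ∃ T : ι → Equiv.Perm X, (∀ j, Measurable (T j) ∧ Measurable (T j).symm) ∧ Nonempty (Cmb.Dat G G1 T a b) := by
  have hG1E : ∀ x y, G1 x y → S.E x y := fun x y h => (hE _ _).2 (.single (g1 _ _ h))
  have e1eq := rtg_eqv g1s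
  have e1E : ∀ x y, Relation.ReflTransGen G1 x y → S.E x y := by
    intro x y h
    rw [hE]
    exact Cmb.Dat.mono_rtg (fun _ _ h => g1 _ _ h) h
  let S1 : CB m := S.sub (Relation.ReflTransGen G1) e1eq (S.rtg_meas hG1E g1m) e1E
  obtain ⟨ρ, hρc, hρA, hρ1⟩ := S1.retract (G1 := G1) (fun x y => Iff.rfl) g1s g1m hA hAc
  have hρE : ∀ x, Relation.ReflTransGen G1 x (ρ x) := fun x => Cmb.Dat.mono_rtg (fun _ _ h => h.1) (hρc.conn x)
  -- the second retraction
  let W : X → X → Prop := fun x y => y ∈ A ∧ ∃ k, α k y = x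
  have hWm : MeasurableSet {z : X × X | W z.1 z.2} := by
    refine (measurable_snd hA).inter ?_
    have : {z : X × X | ∃ k, α k z.2 = z.1} = ⋃ k, {z : X × X | α k z.2 = z.1} := by ext; simp
    change MeasurableSet {z : X × X | ∃ k, α k z.2 = z.1}
    rw [this]
    exact .iUnion fun k => measurableSet_eq_fun ((hαm k).comp measurable_snd) measurable_fst
  have hWu : ∀ x y y', W x y → W x y' → y = y' := by
    rintro x y y' ⟨hy, k, hk⟩ ⟨hy', k', hk'⟩
    exact (hαi k k' y y' hy hy' (hk.trans hk'.symm)).2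
  have hWE : ∀ x y, W x y → Relation.ReflTransGen G1 x y := by
    rintro x y ⟨hy, k, rfl⟩
    exact e1eq.symm (hαE k y hy)
  let π : X → X := fun x => if h : ∃ y, W x y then h.choose else ρ x
  have hπ1 : ∀ x y, W x y → π x = y := by
    intro x y h
    have h' : ∃ y, W x y := ⟨y, h⟩
    have : π x = h'.choose := dif_pos h'
    rw [this]
    exact hWu x _ _ h'.choose_spec h
  have hπ2 : ∀ x, (¬ ∃ y, W x y) → π x = ρ x := fun x h => dif_neg h
  have hπm : Measurable π := by
    intro V hV
    have : π ⁻¹' V = {x | ∃ y, S1.E x y ∧ (W x y ∧ y ∈ V)} ∪ ({x | ∃ y, S1.E x y ∧ W x y}ᶜ ∩ ρ ⁻¹' V) := by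
      ext x
      by_cases h : ∃ y, W x y
      · obtain ⟨y, hy⟩ := h
        simp only [mem_preimage, hπ1 x y hy, mem_union, mem_inter_iff, mem_setOf_eq, mem_compl_iff]
        constructor
        · intro h; exact Or.inl ⟨y, hWE _ _ hy, hy, h⟩
        · rintro (⟨y', -, hy', h⟩ | ⟨h, -⟩)
          · rwa [hWu x y y' hy hy']
          · exact absurd ⟨y, hWE _ _ hy, hy⟩ h
      · simp only [mem_preimage, hπ2 x h, mem_union, mem_inter_iff, mem_setOf_eq, mem_compl_iff]
        constructor
        · intro h'; exact Or.inr ⟨fun ⟨y, _, hy⟩ => h ⟨y, hy⟩, h'⟩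
        · rintro (⟨y, -, hy, -⟩ | ⟨-, h'⟩)
          · exact absurd ⟨y, hy⟩ h
          · exact h'
    rw [this]
    exact (S1.ex_meas (P := fun x y => W x y ∧ y ∈ V) (hWm.inter (measurable_snd hV))).union
      ((S1.ex_meas hWm).compl.inter (hρc.meas hV))
  have hπA : ∀ x, π x ∈ A := by
    intro x
    by_cases h : ∃ y, W x y
    · obtain ⟨y, hy⟩ := h
      rw [hπ1 x y hy]; exact hy.1
    · rw [hπ2 x h]; exact hρA x
  have hπid : ∀ x ∈ A, π x = x := by
    intro x hx
    rw [hπ2, hρ1 x hx]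
    rintro ⟨y, hy, k, hk⟩
    exact hαA k y hy (by rw [hk]; exact hx)
  have hπα : ∀ k x, x ∈ A → π (α k x) = x := fun k x hx => hπ1 _ _ ⟨hx, k, rfl⟩
  have hπE1 : ∀ x, Relation.ReflTransGen G1 x (π x) := by
    intro x
    by_cases h : ∃ y, W x y
    · obtain ⟨y, hy⟩ := h
      rw [hπ1 x y hy]; exact hWE _ _ hy
    · rw [hπ2 x h]; exact hρE x
  have hπE : ∀ x, S.E x (π x) := fun x => e1E _ _ (hπE1 x)
  -- ranks in fibres
  have hαinf : ∀ x ∈ A, ∀ j ε, Function.Injective (fun n : ℕ => α (j, n, ε) x) := by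
    intro x hx j ε n n' h
    have := (hαi _ _ _ _ hx hx h).1
    simpa using this
  obtain ⟨rF, hrF, hF⟩ := S.rank (p := fun e => π e.1) (hπm.comp measurable_fst) (Q := {e | e.1 = e.2})
    (measurableSet_eq_fun measurable_fst measurable_snd)
    (fun e he => by
      have he' : e.1 = e.2 := he
      rw [← he']; exact ⟨S.sm (hπE _), S.sm (hπE _)⟩) (A := A) (fun x hx => by
      refine (Set.infinite_range_of_injective (f := fun n : ℕ => (α (b, n, false) x, α (b, n, false) x)) ?_).mono ?_
      · intro n n' h
        exact hαinf x hx b false (congrArg Prod.fst h)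
      · rintro _ ⟨n, rfl⟩
        exact ⟨rfl, hπα _ _ hx⟩)
  let r : X → ℕ := fun x => rF (x, x)
  have hr : Measurable r := hrF.comp (measurable_id.prodMk measurable_id)
  have hπr : ∀ c ∈ A, ∀ n, ∃! x, π x = c ∧ r x = n := by
    intro c hc n
    obtain ⟨⟨u, v⟩, ⟨h0, h1, h2⟩, hu⟩ := hF c hc n
    have h0' : u = v := h0
    subst h0'
    refine ⟨u, ⟨h1, h2⟩, ?_⟩
    rintro y ⟨hy1, hy2⟩
    exact congrArg Prod.fst (hu (y, y) ⟨rfl, hy1, hy2⟩)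
  -- coloured oriented edges
  obtain ⟨f, hf⟩ := MeasureTheory.exists_measurableEmbedding_real X
  let Pos : X → X → Prop := fun u v => (∃ j, u ∈ Dj j) ∧ v = η u
  let Or' : X → X → Prop := fun u v => Pos u v ∨ (¬ Pos v u ∧ f u < f v)
  have hPosm : MeasurableSet {z : X × X | Pos z.1 z.2} := by
    have : {z : X × X | Pos z.1 z.2} = (⋃ j, Prod.fst ⁻¹' (Dj j)) ∩ {z : X × X | z.2 = η z.1} := by
      ext; simp [Pos]
    rw [this]
    exact (MeasurableSet.iUnion fun j => measurable_fst (hDm j)).inter (measurableSet_eq_fun measurable_snd (hη.comp measurable_fst))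
  have hOrm : MeasurableSet {z : X × X | Or' z.1 z.2} :=
    hPosm.union ((measurable_swap hPosm).compl.inter (measurableSet_lt (hf.measurable.comp measurable_fst) (hf.measurable.comp measurable_snd)))
  have hOra : ∀ u v, Or' u v → ¬ Or' v u := by
    rintro u v (⟨⟨j, h1⟩, rfl⟩ | ⟨h1, h2⟩) (h3 | ⟨h3, h4⟩)
    · obtain ⟨⟨j', h3⟩, -⟩ := h3
      exact hηD _ _ _ h1 h3
    · exact h3 ⟨⟨j, h1⟩, rfl⟩
    · exact h1 h3
    · exact lt_asymm h2 h4
  have hOrt : ∀ u v, u ≠ v → Or' u v ∨ Or' v u := by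
    intro u v huv
    by_cases h1 : Pos u v
    · exact Or.inl (Or.inl h1)
    by_cases h2 : Pos v u
    · exact Or.inr (Or.inl h2)
    rcases lt_or_gt_of_ne (fun h => huv (hf.injective h)) with h | h
    · exact Or.inl (Or.inr ⟨h2, h⟩)
    · exact Or.inr (Or.inr ⟨h1, h⟩)
  let Col : ι → X → X → Prop := fun j u v => (u ∈ Dj j ∧ v = η u) ∨ (j = b ∧ ¬ ∃ j', j' ≠ a ∧ u ∈ Dj j' ∧ v = η u)
  have hColm : ∀ j, MeasurableSet {z : X × X | Col j z.1 z.2} := by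
    intro j
    have h0 : ∀ j, MeasurableSet {z : X × X | z.1 ∈ Dj j ∧ z.2 = η z.1} := fun j =>
      (measurable_fst (hDm j)).inter (measurableSet_eq_fun measurable_snd (hη.comp measurable_fst))
    refine (h0 j).union (.inter (.const _) (MeasurableSet.compl ?_))
    have : {z : X × X | ∃ j', j' ≠ a ∧ z.1 ∈ Dj j' ∧ z.2 = η z.1} = ⋃ j', ⋃ (_ : j' ≠ a), {z : X × X | z.1 ∈ Dj j' ∧ z.2 = η z.1} := by
      ext z; simp only [mem_setOf_eq, mem_iUnion, exists_prop]
    change MeasurableSet {z : X × X | ∃ j', j' ≠ a ∧ z.1 ∈ Dj j' ∧ z.2 = η z.1}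
    rw [this]
    exact .iUnion fun j' => .iUnion fun _ => h0 j'
  have hColu : ∀ j j' u v, j ≠ a → j' ≠ a → Col j u v → Col j' u v → j = j' := by
    rintro j j' u v hj hj' (⟨h1, h2⟩ | ⟨h1, h2⟩) (⟨h3, h4⟩ | ⟨h3, h4⟩)
    · exact hDd _ _ _ h1 h3
    · exact absurd ⟨j, hj, h1, h2⟩ h4
    · exact absurd ⟨j', hj', h3, h4⟩ h2
    · rw [h1, h3]
  have hCole : ∀ u v, ∃ j, j ≠ a ∧ Col j u v := by
    intro u v
    by_cases h : ∃ j', j' ≠ a ∧ u ∈ Dj j' ∧ v = η u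
    · obtain ⟨j, hj, h1, h2⟩ := h
      exact ⟨j, hj, Or.inl ⟨h1, h2⟩⟩
    · exact ⟨b, hba, Or.inr ⟨rfl, h⟩⟩
  let Q : ι → Set (X × X) := fun j => {e | e ∈ G ∧ (¬ (G1 e.1 e.2 ∧ ρ e.1 = ρ e.2)) ∧ Or' e.1 e.2 ∧ Col j e.1 e.2}
  have hQm : ∀ j, MeasurableSet (Q j) := fun j => hGm.inter ((g1m.inter (measurableSet_eq_fun (hρc.meas.comp measurable_fst)
    (hρc.meas.comp measurable_snd))).compl.inter (hOrm.inter (hColm j)))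
  let p : X × X → X := fun e => if G1 e.1 e.2 then ρ e.1 else π e.1
  let q : X × X → X := fun e => if G1 e.1 e.2 then ρ e.2 else π e.2
  have hp : Measurable p := Measurable.ite g1m (hρc.meas.comp measurable_fst) (hπm.comp measurable_fst)
  have hq : Measurable q := Measurable.ite g1m (hρc.meas.comp measurable_snd) (hπm.comp measurable_snd)
  have hpA : ∀ e, p e ∈ A := by intro e; simp only [p]; split_ifs; exacts [hρA _, hπA _]
  have hqA : ∀ e, q e ∈ A := by intro e; simp only [q]; split_ifs; exacts [hρA _, hπA _]
  have hpE : ∀ e, S.E (p e) e.1 := by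
    intro e; simp only [p]; split_ifs; exacts [S.sm (e1E _ _ (hρE _)), S.sm (hπE _)]
  have hqE : ∀ e, S.E (q e) e.2 := by
    intro e; simp only [q]; split_ifs; exacts [S.sm (e1E _ _ (hρE _)), S.sm (hπE _)]
  have hQE : ∀ j e, e ∈ Q j → S.E e.1 e.2 := fun j e he => (hE _ _).2 (.single he.1)
  have hQη : ∀ j x, x ∈ Dj j → (x, η x) ∈ Q j := fun j x hx =>
    ⟨hηG j x hx, fun h => hηG1 j x hx h.1, Or.inl ⟨⟨j, hx⟩, rfl⟩, Or.inl ⟨hx, rfl⟩⟩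
  have hip : ∀ j, ∀ c ∈ A, {e | e ∈ Q j ∧ p e = c}.Infinite := by
    intro j c hc
    refine (Set.infinite_range_of_injective (f := fun n : ℕ => (α (j, n, false) c, η (α (j, n, false) c))) ?_).mono ?_
    · intro n n' h
      exact hαinf c hc j false (congrArg Prod.fst h)
    · rintro _ ⟨n, rfl⟩
      refine ⟨hQη j _ (hα0 j n c hc), ?_⟩
      simp only [p]
      rw [if_neg (hηG1 j _ (hα0 j n c hc)), hπα _ _ hc]
  have hiq : ∀ j, ∀ c ∈ A, {e | e ∈ Q j ∧ q e = c}.Infinite := by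
    intro j c hc
    choose y hy1 hy2 using fun n => hα1 j n c hc
    refine (Set.infinite_range_of_injective (f := fun n : ℕ => (y n, η (y n))) ?_).mono ?_
    · intro n n' h
      have h' := congrArg Prod.snd h
      simp only [hy2] at h'
      exact hαinf c hc j true h'
    · rintro _ ⟨n, rfl⟩
      refine ⟨hQη j _ (hy1 n), ?_⟩
      simp only [q]
      rw [if_neg (hηG1 j _ (hy1 n)), hy2, hπα _ _ hc]
  choose Tj edj hT1 hT2 hed hedi heds using fun j => S.matchP (hQm j) hp hq
    (fun e he => ⟨hpE e, S.tr (hpE e) (hQE j e he)⟩) (fun e he => ⟨S.tr (hqE e) (S.sm (hQE j e he)), hqE e⟩)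
    (fun e _ => hpA e) (fun e _ => hqA e) (hip j) (hiq j) hπm hr hπA hπE hπr
  obtain ⟨Ts, ζ, hs1, hs2, hs3⟩ := S.lineP hπm hr hπA hπE hπr
  let T : ι → Equiv.Perm X := fun j => if j = a then Ts else Tj j
  have hTa : T a = Ts := if_pos rfl
  have hTn : ∀ j, j ≠ a → T j = Tj j := fun j hj => if_neg hj
  refine ⟨T, ?_, ⟨?_⟩⟩
  · intro j
    by_cases hj : j = a
    · rw [hj, hTa]; exact ⟨hs1, hs2⟩
    · rw [hTn j hj]; exact ⟨hT1 j, hT2 j⟩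
  · exact {
      hac := hac, hirr := hirr, hsy := hsy, g1 := g1, g1s := g1s, ρ := ρ, π := π, rk := fun x => ζ (r x), ed := edj
      cell := hρc.conn
      ρπ := fun x => hρ1 _ (hπA x)
      πρ := fun x => hπid _ (hρA x)
      πE := hπE1
      hba := hba
      edG := fun j x _ => (hed j x).1.1
      edn := fun j x _ h h' => (hed j x).1.2.1 ⟨h, h'⟩
      edσ := fun j x _ h => by rw [← (hed j x).2.1]; exact if_pos h
      edσ' := fun j x _ h => by rw [← (hed j x).2.1]; exact if_neg h
      edτ := fun j x hj h => by rw [hTn j hj, ← (hed j x).2.2]; exact if_pos h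
      edτ' := fun j x hj h => by rw [hTn j hj, ← (hed j x).2.2]; exact if_neg h
      edinj := fun j x j' x' hj hj' h => by
        have h1 := (hed j x).1.2.2.2
        have h2 := (hed j' x').1.2.2.2
        rw [← h] at h2
        have := hColu _ _ _ _ hj hj' h1 h2
        subst this
        exact ⟨rfl, hedi j h⟩
      edO := fun j x j' x' _ _ h => by
        have h1 := (hed j x).1.2.2.1
        have h2 := (hed j' x').1.2.2.1
        rw [h] at h1
        exact hOra _ _ h1 h2
      edsurj := fun u v huv hne => by
        have hne' : u ≠ v := by rintro rfl; exact hirr _ huv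
        rcases hOrt u v hne' with h | h
        · obtain ⟨j, hj, hc⟩ := hCole u v
          obtain ⟨x, hx⟩ := heds j (u, v) ⟨huv, fun h => hne h.1 h.2, h, hc⟩
          exact ⟨j, x, hj, Or.inl hx⟩
        · obtain ⟨j, hj, hc⟩ := hCole v u
          obtain ⟨x, hx⟩ := heds j (v, u) ⟨hsy _ _ huv, fun h => hne (g1s _ _ h.1) h.2.symm, h, hc⟩
          exact ⟨j, x, hj, Or.inr hx⟩
      sπ := fun x => by rw [hTa]; exact (hs3 x).1
      srk := fun x => by rw [hTa]; exact (hs3 x).2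
      rkinj := fun x y h1 h2 => (hπr (π x) (hπA x) (r x)).unique ⟨rfl, rfl⟩ ⟨h1.symm, (ζ.injective h2).symm⟩
      hbH := fun x => by
        have hx := hα0 b 0 (π x) (hπA x)
        obtain ⟨y, hy⟩ := heds b _ (hQη b _ hx)
        refine ⟨y, ?_, ?_⟩
        · rw [← (hed b y).2.1, hy]
          simp only [p]
          rw [if_neg (hηG1 b _ hx), hπα _ _ (hπA x)]
        · rw [hy]; exact hηG1 b _ hx }

end CB

namespace CB
variable {X : Type*} [MeasurableSpace X] [StandardBorelSpace X] {m : Measure X} (S : CB m)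

theorem prep [IsFiniteMeasure m] {ι : Type*} [Countable ι] {G : Set (X × X)} (hGm : MeasurableSet G)
    (hirr : ∀ x, (x, x) ∉ G) (hsy : ∀ x y, (x, y) ∈ G → (y, x) ∈ G) (hE : ∀ x y, S.E x y ↔ (x, y) ∈ connRel G)
    (herg : S.erg) (hS : ¬ S.hasS)
    (hna : ∀ r : ℕ → X → X, (∀ n, Measurable (r n)) → (∀ n x, S.E x (r n x)) → (∀ n x, r (n+1) (r n x) = r (n+1) x) →
      ¬ ∀ᵐ x ∂m, ∀ y, (x, y) ∈ G → ∃ n, r n x = r n y)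
    {k : X → ℝ≥0∞} (hk : Measurable k) (hk0 : ∀ x, k x ≠ 0) :
    ∃ (G1 : X → X → Prop) (A X₁ : Set X) (Dj : ι → Set X) (η : X → X) (α : ι × ℕ × Bool → X → X),
    (∀ x y, G1 x y → (x, y) ∈ G) ∧ (∀ x y, G1 x y → G1 y x) ∧
    MeasurableSet {z : X × X | G1 z.1 z.2} ∧ MeasurableSet A ∧ MeasurableSet X₁ ∧ m X₁ᶜ = 0 ∧
    (∀ x y, S.E x y → x ∈ X₁ → y ∈ X₁) ∧
    (∀ x ∈ X₁, ∃ y, Relation.ReflTransGen G1 x y ∧ y ∈ A) ∧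
    (∀ x ∈ X₁, ∀ M : ℝ≥0∞, M < ∞ → ∃ y, Relation.ReflTransGen G1 x y ∧ M < S.w y x * k y) ∧
    (∀ j, MeasurableSet (Dj j)) ∧ (∀ j j' x, x ∈ Dj j → x ∈ Dj j' → j = j') ∧
    Measurable η ∧ (∀ j j' x y, x ∈ Dj j → y ∈ Dj j' → η x = η y → x = y) ∧
    (∀ j j' x, x ∈ Dj j → η x ∉ Dj j') ∧ (∀ j x, x ∈ Dj j → (x, η x) ∈ G) ∧ (∀ j x, x ∈ Dj j → ¬ G1 x (η x)) ∧
    (∀ x, S.E x (η x)) ∧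
    (∀ k, Measurable (α k)) ∧
    (∀ k k' x x', x ∈ A → x' ∈ A → α k x = α k' x' → k = k' ∧ x = x') ∧
    (∀ k x, x ∈ A → α k x ∉ A) ∧ (∀ k x, Relation.ReflTransGen G1 x (α k x)) ∧
    (∀ j n x, x ∈ A → α (j, n, false) x ∈ Dj j) ∧ (∀ j n x, x ∈ A → ∃ y ∈ Dj j, η y = α (j, n, true) x) := by
  classical
  obtain ⟨G1, D, η, S1, g1s, g1, g1m, hD, hD0, hη, hηi, hηD, hηG, hηG1, hw1, hE1, he1, hS1⟩ :=
    S.choice (G := fun x y => (x, y) ∈ G) (fun x y h => (hE _ _).2 (.single h)) hsy hirr hGm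
      (fun x y h => (hE _ _).1 h) herg hS hna
  have e1E : ∀ x y, S1.E x y → S.E x y := by
    intro x y h
    rw [hE]; exact Cmb.Dat.mono_rtg g1 ((hE1 _ _).1 h)
  obtain ⟨P, hPm, hPD, hP0, hPd⟩ := pieces (noatom he1 hS1) hD hD0
  obtain ⟨en, hen⟩ := Countable.exists_injective_nat (ι × ℕ × Bool)
  let C : ι × ℕ × Bool → Set X := fun k => if k.2.2 then η '' P (en k + 1) else P (en k + 1)
  have hCm : ∀ k, MeasurableSet (C k) := by
    intro k
    simp only [C]
    split_ifs
    · exact Einj hη (hPm _) (hηi.mono (hPD _))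
    · exact hPm _
  have hC0 : ∀ k, m (C k) ≠ 0 := by
    intro k
    simp only [C]
    split_ifs
    · intro h
      apply hP0 (en k + 1)
      refine measure_mono_null ?_ (S.sat_null h)
      intro x hx
      exact ⟨η x, (hE _ _).2 (.single (hηG x (hPD _ hx))), mem_image_of_mem _ hx⟩
    · exact hP0 _
  have hCP : ∀ k x, x ∈ C k → x ∉ P 0 := by
    intro k x hx h0
    simp only [C] at hx
    split_ifs at hx
    · obtain ⟨y, hy, rfl⟩ := hx
      exact hηD y (hPD _ hy) (hPD _ h0)
    · exact hPd _ _ (Nat.succ_ne_zero _) x hx h0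
  have hCd : ∀ k k' x, x ∈ C k → x ∈ C k' → k = k' := by
    intro k k' x hx hx'
    have key : ∀ x, x ∈ P (en k + 1) → x ∈ P (en k' + 1) → k = k' := by
      intro x hx hx'
      by_contra h
      exact hPd _ _ (fun h' => h (hen (Nat.succ_injective h'))) x hx hx'
    simp only [C] at hx hx'
    split_ifs at hx hx'
    · obtain ⟨y, hy, rfl⟩ := hx
      obtain ⟨y', hy', h⟩ := hx'
      have := hηi (hPD _ hy') (hPD _ hy) h
      subst this
      exact key _ hy hy'
    · obtain ⟨y, hy, rfl⟩ := hx
      exact absurd (hPD _ hx') (hηD y (hPD _ hy))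
    · obtain ⟨y, hy, rfl⟩ := hx'
      exact absurd (hPD _ hx) (hηD y (hPD _ hy))
    · exact key _ hx hx'
  choose τ A0 hτ hA0m hA0 hA00 hτE hτi using fun k => S1.T3 he1 hS1 (hPm 0) (hCm k) (hC0 k)
  let A : Set X := P 0 ∩ ⋂ k, A0 k
  have hAm : MeasurableSet A := (hPm 0).inter (.iInter hA0m)
  have hAk : ∀ k x, x ∈ A → x ∈ A0 k := fun k x hx => mem_iInter.1 hx.2 k
  have hA : m A ≠ 0 := by
    intro h
    apply hP0 0
    refine measure_mono_null (t := A ∪ ⋃ k, P 0 \ A0 k) ?_ (measure_union_null h (measure_iUnion_null hA00))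
    intro x hx
    by_cases h : ∀ k, x ∈ A0 k
    · exact Or.inl ⟨hx, mem_iInter.2 h⟩
    · push Not at h
      obtain ⟨k, hk⟩ := h
      exact Or.inr (mem_iUnion.2 ⟨k, hx, hk⟩)
  have hsatA : ∀ᵐ x ∂m, ∃ y, S1.E x y ∧ y ∈ A := by
    have hZ : MeasurableSet {x | ∃ y, S1.E x y ∧ y ∈ A} := S1.ex_meas (P := fun _ y => y ∈ A) (measurable_snd hAm)
    rcases he1 _ hZ (fun x y hxy ⟨z, hz, hzA⟩ => ⟨z, S1.tr (S1.sm hxy) hz, hzA⟩) with h | h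
    · have hsub : A ⊆ {x | ∃ y, S1.E x y ∧ y ∈ A} := fun x hx => ⟨x, S1.rfl' x, hx⟩
      exact absurd (measure_mono_null hsub h) hA
    · exact h
  have hsup := sup_top he1 hS1 hk hk0
  let V : X → ℝ≥0∞ := fun x => ⨆ i, S1.w (S1.g i x) x * k (S1.g i x)
  have hVm : Measurable V := Measurable.iSup fun i => (S1.wm.comp ((S1.gm i).prodMk measurable_id)).mul (hk.comp (S1.gm i))
  let X₁ : Set X := {x | ∀ y, S.E x y → (∃ z, S1.E y z ∧ z ∈ A) ∧ V y = ∞}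
  have hX1m : MeasurableSet X₁ := S.all_meas (P := fun _ y => (∃ z, S1.E y z ∧ z ∈ A) ∧ V y = ∞)
    (measurable_snd (((S1.ex_meas (P := fun _ y => y ∈ A) (measurable_snd hAm))).inter (hVm (measurableSet_singleton ∞))))
  have hX10 : m X₁ᶜ = 0 := S.ae_all (hsatA.and hsup)
  let Dj : ι → Set X := fun j => ⋃ n : ℕ, ⋃ ε : Bool, P (en (j, n, ε) + 1)
  have hDj : ∀ j x, x ∈ Dj j → x ∈ D := by
    intro j x hx
    obtain ⟨n, hx⟩ := mem_iUnion.1 hx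
    obtain ⟨ε, hx⟩ := mem_iUnion.1 hx
    exact hPD _ hx
  refine ⟨G1, A, X₁, Dj, fun x => if x ∈ D then η x else x, fun k x => if x ∈ A then τ k x else x,
    g1, g1s, g1m, hAm, hX1m, hX10, ?_, ?_, ?_, ?_, ?_, ?_, ?_, ?_, ?_, ?_, ?_, ?_, ?_, ?_, ?_, ?_, ?_⟩
  · exact fun x y hxy hx z hz => hx z (S.tr hxy hz)
  · intro x hx
    obtain ⟨⟨y, h1, h2⟩, -⟩ := hx x (S.rfl' x)
    exact ⟨y, (hE1 _ _).1 h1, h2⟩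
  · intro x hx M hM
    have h := (hx x (S.rfl' x)).2
    rw [← h] at hM
    obtain ⟨i, hi⟩ := lt_iSup_iff.1 hM
    refine ⟨S1.g i x, (hE1 _ _).1 (S1.Eg i x), ?_⟩
    rwa [hw1] at hi
  · exact fun j => .iUnion fun n => .iUnion fun ε => hPm _
  · intro j j' x hx hx'
    obtain ⟨n, hx⟩ := mem_iUnion.1 hx
    obtain ⟨ε, hx⟩ := mem_iUnion.1 hx
    obtain ⟨n', hx'⟩ := mem_iUnion.1 hx'
    obtain ⟨ε', hx'⟩ := mem_iUnion.1 hx'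
    by_contra h
    refine hPd _ _ (fun h' => h ?_) x hx hx'
    have := hen (Nat.succ_injective h')
    exact congrArg Prod.fst this
  · exact Measurable.ite hD hη measurable_id
  · intro j j' x y hx hy h
    simp only [if_pos (hDj _ _ hx), if_pos (hDj _ _ hy)] at h
    exact hηi (hDj _ _ hx) (hDj _ _ hy) h
  · intro j j' x hx h
    simp only [if_pos (hDj _ _ hx)] at h
    exact hηD x (hDj _ _ hx) (hDj _ _ h)
  · intro j x hx
    simp only [if_pos (hDj _ _ hx)]
    exact hηG x (hDj _ _ hx)
  · intro j x hx
    simp only [if_pos (hDj _ _ hx)]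
    exact hηG1 x (hDj _ _ hx)
  · intro x
    by_cases hx : x ∈ D
    · simp only [if_pos hx]
      exact (hE _ _).2 (.single (hηG x hx))
    · simp only [if_neg hx]; exact S.rfl' x
  · exact fun k => Measurable.ite hAm (hτ k) measurable_id
  · intro k k' x x' hx hx' h
    simp only [if_pos hx, if_pos hx'] at h
    have h1 := (hτE k x (hAk _ _ hx)).2
    have h2 := (hτE k' x' (hAk _ _ hx')).2
    rw [← h] at h2
    have := hCd _ _ _ h1 h2
    subst this
    exact ⟨rfl, hτi k (hAk _ _ hx) (hAk _ _ hx') h⟩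
  · intro k x hx h
    simp only [if_pos hx] at h
    exact hCP k _ (hτE k x (hAk _ _ hx)).2 h.1
  · intro k x
    by_cases hx : x ∈ A
    · simp only [if_pos hx]
      exact (hE1 _ _).1 (hτE k x (hAk _ _ hx)).1
    · simp only [if_neg hx]; exact .refl
  · intro j n x hx
    simp only [if_pos hx]
    have h1 := (hτE (j, n, false) x (hAk _ _ hx)).2
    exact mem_iUnion.2 ⟨n, mem_iUnion.2 ⟨false, by simpa [C] using h1⟩⟩
  · intro j n x hx
    simp only [if_pos hx]
    have h1 := (hτE (j, n, true) x (hAk _ _ hx)).2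
    simp only [C, if_true] at h1
    obtain ⟨y, hy, h⟩ := h1
    exact ⟨y, mem_iUnion.2 ⟨n, mem_iUnion.2 ⟨true, hy⟩⟩, by rw [if_pos (hPD _ hy), h]⟩

end CB

theorem rtg_sub {X : Type*} {R : X → X → Prop} {Z : Set X} (h : ∀ x y, R x y → x ∈ Z → y ∈ Z) (x y : Z) :
    Relation.ReflTransGen (fun u v : Z => R u v) x y ↔ Relation.ReflTransGen R (x : X) y := by
  constructor
  · intro h
    induction h with
    | refl => exact .refl
    | tail _ h1 ih => exact ih.tail h1
  · intro h1
    have key : ∀ z : X, Relation.ReflTransGen R (x : X) z → ∃ hz : z ∈ Z, Relation.ReflTransGen (fun u v : Z => R u v) x ⟨z, hz⟩ := by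
      intro z hz
      induction hz with
      | refl => exact ⟨x.2, .refl⟩
      | tail _ h2 ih =>
        obtain ⟨hb, ih⟩ := ih
        exact ⟨h _ _ h2 hb, ih.tail h2⟩
    exact (key y h1).2

theorem gd_path {X : Type*} {G : Set (X × X)} {x y : X} (h : (x, y) ∈ connRel G) :
    ∃ m : ℕ, ∃ c : ℕ → X, c 0 = x ∧ c m = y ∧ ∀ i < m, (c i, c (i + 1)) ∈ G := by
  have h' : Relation.ReflTransGen (fun a b => (a, b) ∈ G) x y := h
  induction h' using Relation.ReflTransGen.head_induction_on with
  | refl => exact ⟨0, fun _ => y, rfl, rfl, by simp⟩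
  | head h1 h2 ih =>
    rename_i u v
    obtain ⟨m, c, h0, hm, hc⟩ := ih h2
    refine ⟨m + 1, fun n => Nat.casesOn n u c, rfl, hm, ?_⟩
    intro i hi
    cases i with
    | zero => simpa [h0] using h1
    | succ i => exact hc i (by omega)

theorem half_mem {X : Type*} {G : Set (X × X)} {χ : X → Prop} {u v z : X} (hcut : ¬ (χ u ↔ χ v))
    (ho : ∀ x y, (x, y) ∈ G → ¬ (χ x ↔ χ y) → (x = u ∧ y = v) ∨ (x = v ∧ y = u)) (hz : χ z ↔ χ v)
    (hc : (u, z) ∈ connRel G) : z ∈ halfSpace G u v := by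
  obtain ⟨m0, c0, h0⟩ := gd_path hc
  have hne : ((fun m : ℕ => (m : ℕ∞)) ''
    {m : ℕ | ∃ c : ℕ → X, c 0 = u ∧ c m = z ∧ ∀ i < m, (c i, c (i + 1)) ∈ G}).Nonempty := ⟨m0, m0, ⟨c0, h0⟩, rfl⟩
  obtain ⟨m, ⟨c, hc0, hcm, hce⟩, hm⟩ := csInf_mem hne
  have key : ∀ n ≤ m, (∃ i < n, c i = u ∧ c (i+1) = v) ∨ (χ (c n) ↔ χ u) := by
    intro n
    induction n with
    | zero => intro _; right; rw [hc0]
    | succ n ih =>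
      intro hn
      rcases ih (by omega) with ⟨i, hi, h⟩ | h
      · exact Or.inl ⟨i, by omega, h⟩
      · by_cases h2 : χ (c n) ↔ χ (c (n+1))
        · exact Or.inr (h2.symm.trans h)
        · rcases ho _ _ (hce n (by omega)) h2 with h3 | h3
          · exact Or.inl ⟨n, by omega, h3⟩
          · exact absurd (by rw [← h, h3.1]) hcut
  rcases key m le_rfl with ⟨i, hi, h1, h2⟩ | h
  · change gdist G v z < gdist G u z
    have e : gdist G u z = (m : ℕ∞) := hm.symm
    rw [e]
    refine lt_of_le_of_lt (b := ((m - (i+1) : ℕ) : ℕ∞)) ?_ (by exact_mod_cast (by omega))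
    refine sInf_le ⟨m - (i+1), ⟨fun n => c (i+1+n), by simpa using h2, ?_, ?_⟩, rfl⟩
    · change c (i + 1 + (m - (i+1))) = z
      rw [← hcm]; congr 1; omega
    · intro j hj
      exact hce (i+1+j) (by omega)
  · rw [hcm] at h
    exact absurd (h.symm.trans hz) hcut

theorem lift_meas {Y ι : Type*} [MeasurableSpace Y] {T : ι → Equiv.Perm Y} (hT : ∀ j, Measurable (T j) ∧ Measurable (T j).symm)
    (g : FreeGroup ι) : Measurable (FreeGroup.lift T g) := by
  induction g using FreeGroup.induction_on with
  | C1 => simpa using measurable_id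
  | of i => simpa using (hT i).1
  | inv_of i _ => simpa using (hT i).2
  | mul x y hx hy =>
    rw [map_mul]
    exact hx.comp hy

theorem orb_sch {X ι : Type*} [MeasurableSpace X] (φ : FreeGroup ι →* Equiv.Perm X) (g : FreeGroup ι) (x : X) :
    (x, φ g x) ∈ connRel (schreier φ) := by
  induction g using FreeGroup.induction_on generalizing x with
  | C1 => rw [map_one]; exact Relation.ReflTransGen.refl
  | of i =>
    by_cases h : x = φ (FreeGroup.of i) x
    · rw [← h]; exact Relation.ReflTransGen.refl
    · exact .single ⟨h, i, Or.inl rfl⟩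
  | inv_of i _ =>
    by_cases h : x = φ (FreeGroup.of i)⁻¹ x
    · change Relation.ReflTransGen _ x (φ (FreeGroup.of i)⁻¹ x)
      rw [← h]
    · refine .single ⟨h, i, Or.inr ?_⟩
      change φ (FreeGroup.of i) (φ (FreeGroup.of i)⁻¹ x) = x
      rw [map_inv]
      exact Equiv.apply_symm_apply _ _
  | mul x' y hx hy =>
    rw [map_mul]
    exact Relation.ReflTransGen.trans (hy x) (hx _)

namespace CB
variable {X : Type*} [MeasurableSpace X] [StandardBorelSpace X] {m : Measure X} (S : CB m)

theorem finish [IsFiniteMeasure m] {ι : Type*} [Countable ι] {a b : ι} (hba : b ≠ a) {G : Set (X × X)} (hGm : MeasurableSet G)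
    (hac : AcyclicGraph G)
    (hirr : ∀ x, (x, x) ∉ G) (hsy : ∀ x y, (x, y) ∈ G → (y, x) ∈ G) (hE : ∀ x y, S.E x y ↔ (x, y) ∈ connRel G)
    (herg : S.erg) (hS : ¬ S.hasS)
    (hna : ∀ r : ℕ → X → X, (∀ n, Measurable (r n)) → (∀ n x, S.E x (r n x)) → (∀ n x, r (n+1) (r n x) = r (n+1) x) →
      ¬ ∀ᵐ x ∂m, ∀ y, (x, y) ∈ G → ∃ n, r n x = r n y)
    {k : X → ℝ≥0∞} (hk : Measurable k) (hk0 : ∀ x, k x ≠ 0) :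
    ∃ φ : FreeGroup ι →* Equiv.Perm X, (∀ g, Measurable (φ g)) ∧ ∃ X₁ : Set X, m X₁ᶜ = 0 ∧
      (∀ x ∈ X₁, ∀ g, g ≠ 1 → φ g x ≠ x) ∧ (∀ x ∈ X₁, ∀ y, S.E x y ↔ ∃ g, φ g x = y) ∧
      ∀ x ∈ X₁, ∀ r, IsGeodesicRay (schreier φ) r → (x, r 0) ∈ connRel (schreier φ) → S.E x (r 0) ∧
        ∀ i, ∀ M : ℝ≥0∞, M < ∞ → ∃ y ∈ halfSpace (schreier φ) (r i) (r (i+1)), S.E (r 0) y ∧ M < S.w y (r 0) * k y := by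
  classical
  obtain ⟨G1, A, X₁, Dj, η, α, g1, g1s, g1m, hA, hX1m, hX10, hX1E, hX1A, hX1V, hDm, hDd, hη, hηi, hηD, hηG, hηG1, hηE,
    hαm, hαi, hαA, hαE, hα0, hα1⟩ := S.prep (ι := ι) hGm hirr hsy hE herg hS hna hk hk0
  have : StandardBorelSpace X₁ := hX1m.standardBorel
  have hG1E : ∀ x y, Relation.ReflTransGen G1 x y → S.E x y := by
    intro x y h
    rw [hE]; exact Cmb.Dat.mono_rtg g1 h
  have cm : Measurable (fun p : X₁ × X₁ => ((p.1 : X), (p.2 : X))) :=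
    (measurable_subtype_coe.comp measurable_fst).prodMk (measurable_subtype_coe.comp measurable_snd)
  let Sy : CB (0 : Measure X₁) := {
    E := fun x y => S.E x y
    g := fun i x => ⟨S.g i x, hX1E _ _ (S.Eg i x) x.2⟩
    w := fun _ _ => 1
    eqv := ⟨fun x => S.rfl' _, fun h => S.sm h, fun h h' => S.tr h h'⟩
    hE := fun x y => by
      rw [S.hE]; simp [Subtype.ext_iff]
    gm := fun i => ((S.gm i).comp measurable_subtype_coe).subtype_mk
    wm := measurable_const
    w0 := by simp
    wt := by simp
    wc := by simp
    mt := by simp }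
  let Gy : Set (X₁ × X₁) := {p | ((p.1 : X), (p.2 : X)) ∈ G}
  have hRG : ∀ x y : X₁, (x, y) ∈ connRel Gy ↔ ((x : X), (y : X)) ∈ connRel G := fun x y =>
    rtg_sub (R := fun u v => (u, v) ∈ G) (fun u v h hu => hX1E u v ((hE _ _).2 (.single h)) hu) x y
  have hRG1 : ∀ x y : X₁, Relation.ReflTransGen (fun u v : X₁ => G1 u v) x y ↔ Relation.ReflTransGen G1 (x : X) (y : X) := fun x y =>
    rtg_sub (R := G1) (fun u v h hu => hX1E u v ((hE _ _).2 (.single (g1 _ _ h))) hu) x y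
  have hDX : ∀ x, x ∈ X₁ → η x ∈ X₁ := fun x hx => hX1E _ _ (hηE x) hx
  have hαX : ∀ k x, x ∈ X₁ → α k x ∈ X₁ := fun k x hx => hX1E _ _ (hG1E _ _ (hαE k x)) hx
  obtain ⟨T, hT, ⟨d⟩⟩ := Sy.build (a := a) (b := b) hba (G := Gy) (cm hGm)
    (by
      intro n c hn hc hinj
      refine hac n (fun i => (c i : X)) hn hc ?_
      intro i j hij
      exact hinj (Subtype.ext hij))
    (fun x => hirr x) (fun x y h => hsy _ _ h) (fun x y => (hE _ _).trans (hRG x y).symm)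
    (G1 := fun u v => G1 u v) (fun x y h => g1 _ _ h) (fun x y h => g1s _ _ h) (cm g1m)
    (A := {x | (x : X) ∈ A}) (measurable_subtype_coe hA)
    (by
      intro x
      obtain ⟨y, h1, h2⟩ := hX1A x x.2
      exact ⟨⟨y, hX1E _ _ (hG1E _ _ h1) x.2⟩, (hRG1 _ _).2 h1, h2⟩)
    (Dj := fun j => {x | (x : X) ∈ Dj j}) (fun j => measurable_subtype_coe (hDm j)) (fun j j' x h h' => hDd j j' x h h')
    (η := fun x => ⟨η x, hDX x x.2⟩) ((hη.comp measurable_subtype_coe).subtype_mk)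
    (fun j j' x y hx hy h => Subtype.ext (hηi j j' x y hx hy (congrArg Subtype.val h)))
    (fun j j' x hx => hηD j j' x hx) (fun j x hx => hηG j x hx) (fun j x hx => hηG1 j x hx)
    (α := fun k x => ⟨α k x, hαX k x x.2⟩) (fun k => ((hαm k).comp measurable_subtype_coe).subtype_mk)
    (fun k k' x x' hx hx' h => by
      obtain ⟨h1, h2⟩ := hαi k k' x x' hx hx' (congrArg Subtype.val h)
      exact ⟨h1, Subtype.ext h2⟩)
    (fun k x hx => hαA k x hx) (fun k x _ => (hRG1 _ _).2 (hαE k x)) (fun j n x hx => hα0 j n x hx)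
    (fun j n x hx => by
      obtain ⟨y, h1, h2⟩ := hα1 j n x hx
      have hyX : y ∈ X₁ := by
        refine hX1E _ _ (S.sm (hηE y)) ?_
        rw [h2]; exact hαX _ _ x.2
      exact ⟨⟨y, hyX⟩, h1, Subtype.ext h2⟩)
  let φ : FreeGroup ι →* Equiv.Perm X := (Equiv.Perm.ofSubtype (p := fun x => x ∈ X₁)).comp (FreeGroup.lift T)
  have φin : ∀ g (x : X₁), φ g x = FreeGroup.lift T g x := fun g x => Equiv.Perm.ofSubtype_apply_of_mem _ x.2
  have φout : ∀ g x, x ∉ X₁ → φ g x = x := fun g x hx => Equiv.Perm.ofSubtype_apply_of_not_mem _ hx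
  have φX : ∀ g x, x ∈ X₁ → φ g x ∈ X₁ := fun g x hx => by
    rw [φin g ⟨x, hx⟩]; exact Subtype.property _
  have hTof : ∀ s x, FreeGroup.lift T (FreeGroup.of s) x = T s x := by intro s x; simp
  have lab : ∀ x y, (x, y) ∈ schreier φ → ∃ l : ι × X₁, (x = (Cmb.src l : X₁) ∧ y = (Cmb.tgt T l : X₁)) ∨
      (y = (Cmb.src l : X₁) ∧ x = (Cmb.tgt T l : X₁)) := by
    have aux : ∀ x y s, x ≠ y → φ (FreeGroup.of s) x = y → ∃ l : ι × X₁, (x = (Cmb.src l : X₁) ∧ y = (Cmb.tgt T l : X₁)) := by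
      intro x y s hne h
      have hx : x ∈ X₁ := by
        by_contra hx
        rw [φout _ _ hx] at h
        exact hne h
      refine ⟨(s, ⟨x, hx⟩), rfl, ?_⟩
      rw [← h, φin _ ⟨x, hx⟩, hTof]
    rintro x y ⟨hne, s, h | h⟩
    · obtain ⟨l, hl⟩ := aux x y s hne h
      exact ⟨l, Or.inl hl⟩
    · obtain ⟨l, hl⟩ := aux y x s (Ne.symm hne) h
      exact ⟨l, Or.inr hl⟩
  have labX : ∀ x y, (x, y) ∈ schreier φ → x ∈ X₁ ∧ y ∈ X₁ := by
    intro x y h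
    obtain ⟨l, ⟨h1, h2⟩ | ⟨h1, h2⟩⟩ := lab x y h
    · rw [h1, h2]; exact ⟨Subtype.property _, Subtype.property _⟩
    · rw [h1, h2]; exact ⟨Subtype.property _, Subtype.property _⟩
  have horb : ∀ x ∈ X₁, ∀ y, S.E x y ↔ ∃ g, φ g x = y := by
    intro x hx y
    constructor
    · intro h
      have hy := hX1E _ _ h hx
      obtain ⟨g, hg⟩ := (d.orb ⟨x, hx⟩ ⟨y, hy⟩).1 ((hRG _ _).2 ((hE _ _).1 h))
      exact ⟨g, by rw [φin g ⟨x, hx⟩, hg]⟩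
    · rintro ⟨g, rfl⟩
      rw [hE, φin g ⟨x, hx⟩]
      exact (hRG ⟨x, hx⟩ _).1 ((d.orb _ _).2 ⟨g, rfl⟩)
  have hschE : ∀ x y, (x, y) ∈ connRel (schreier φ) → S.E x y := by
    intro x y h
    have h' : Relation.ReflTransGen (fun a b => (a, b) ∈ schreier φ) x y := h
    induction h' with
    | refl => exact S.rfl' x
    | tail h1 h2 ih =>
      refine S.tr (ih h1) ?_
      obtain ⟨k1, k2⟩ := labX _ _ h2
      obtain ⟨-, s, h | h⟩ := h2
      · exact (horb _ k1 _).2 ⟨_, h⟩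
      · exact S.sm ((horb _ k2 _).2 ⟨_, h⟩)
  refine ⟨φ, ?_, X₁, hX10, ?_, horb, ?_⟩
  · intro g
    have : ⇑(φ g) = fun x => if h : x ∈ X₁ then ((FreeGroup.lift T g ⟨x, h⟩ : X₁) : X) else x := by
      funext x
      split_ifs with h
      · exact φin g ⟨x, h⟩
      · exact φout g x h
    rw [this]
    exact Measurable.dite (s := X₁) (f := fun x => ((FreeGroup.lift T g x : X₁) : X)) (g := fun x => (x : X))
      (measurable_subtype_coe.comp (lift_meas hT g)) measurable_subtype_coe hX1m
  · intro x hx g hg h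
    refine Cmb.free_of_cut T (fun e => ?_) g hg ⟨x, hx⟩ ?_
    · obtain ⟨χ, h1, -⟩ := d.cuts e
      exact ⟨χ, h1⟩
    · rw [φin g ⟨x, hx⟩] at h
      exact Subtype.ext h
  · intro x hx r hr hxr
    have h0 := hschE _ _ hxr
    have hr0 := hX1E _ _ h0 hx
    refine ⟨h0, ?_⟩
    intro i M hM
    obtain ⟨hu, hv⟩ := labX _ _ (hr.1 i)
    obtain ⟨l, hl⟩ := lab _ _ (hr.1 i)
    obtain ⟨χ, hχ, hχ2⟩ := d.cuts l
    have hri : ∀ n, S.E (r 0) (r n) := by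
      intro n
      induction n with
      | zero => exact S.rfl' _
      | succ n ih => exact S.tr ih (hschE _ _ (.single (hr.1 n)))
    obtain ⟨z0, hz1, hz2⟩ := hχ2 ⟨r (i+1), hv⟩ (by
      rcases hl with ⟨h1, h2⟩ | ⟨h1, h2⟩
      · exact Or.inr (Subtype.ext h2)
      · exact Or.inl (Subtype.ext h1))
    have hz0 : S.E (r 0) z0 := S.tr (hri (i+1)) (S.sm ((hE _ _).2 ((hRG _ _).1 hz1)))
    have hc0 := S.w0 _ _ (S.sm hz0)
    have hct := S.wt _ _ (S.sm hz0)
    obtain ⟨y, hy1, hy2⟩ := hX1V z0 z0.2 (M / S.w z0 (r 0)) (ENNReal.div_lt_top hM.ne hc0)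
    have hyE := S.tr hz0 (hG1E _ _ hy1)
    have hyX : y ∈ X₁ := hX1E _ _ hyE hr0
    refine ⟨y, ?_, hyE, ?_⟩
    · refine half_mem (χ := fun z => ∃ h : z ∈ X₁, χ ⟨z, h⟩) ?_ ?_ ?_ ?_
      · have := hχ.1
        have e1 : ∀ z : X₁, (∃ h : (z : X) ∈ X₁, χ ⟨z, h⟩) ↔ χ z := fun z => ⟨fun ⟨_, h⟩ => h, fun h => ⟨z.2, h⟩⟩
        rcases hl with ⟨h1, h2⟩ | ⟨h1, h2⟩
        · rw [h1, h2, e1, e1]; exact this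
        · rw [h1, h2, e1, e1]; exact fun h => this h.symm
      · intro x' y' hxy hne
        obtain ⟨l', hl'⟩ := lab _ _ hxy
        have e1 : ∀ z : X₁, (∃ h : (z : X) ∈ X₁, χ ⟨z, h⟩) ↔ χ z := fun z => ⟨fun ⟨_, h⟩ => h, fun h => ⟨z.2, h⟩⟩
        have hll : l' = l := by
          by_contra hcon
          have := hχ.2 l' trivial hcon
          apply hne
          rcases hl' with ⟨h1, h2⟩ | ⟨h1, h2⟩
          · rw [h1, h2, e1, e1]; exact this
          · rw [h1, h2, e1, e1]; exact this.symm
        subst hll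
        rcases hl with ⟨h1, h2⟩ | ⟨h1, h2⟩ <;> rcases hl' with ⟨h3, h4⟩ | ⟨h3, h4⟩ <;> simp [h1, h2, h3, h4]
      · have := hz2 ⟨y, hyX⟩ ((hRG1 _ _).2 hy1)
        constructor
        · rintro ⟨_, h⟩; exact ⟨hv, this.1 h⟩
        · rintro ⟨_, h⟩; exact ⟨hyX, this.2 h⟩
      · obtain ⟨g, rfl⟩ := (horb _ hu y).1 (S.tr (S.sm (hri i)) hyE)
        exact orb_sch φ g _
    · rw [ENNReal.div_lt_iff (Or.inl hc0) (Or.inl hct)] at hy2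
      rw [← S.wc _ _ _ hz0 (hG1E _ _ hy1)]
      calc M < S.w y z0 * k y * S.w z0 (r 0) := hy2
        _ = _ := by ring

end CB

theorem tsum_sub_bi {X : Type*} (A : Set X) (f : X → ℝ≥0∞) : ∑' y : {y : X // y ∈ A}, f y = ∑' y, bi (y ∈ A) * f y := by
  rw [show (∑' y : {y : X // y ∈ A}, f y) = ∑' y, A.indicator f y from tsum_subtype A f]
  refine tsum_congr fun y => ?_
  by_cases h : y ∈ A
  · rw [indicator_of_mem h, bi_pos h, one_mul]
  · rw [indicator_of_notMem h, bi_neg h, zero_mul]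

section
variable {X : Type*} [MeasurableSpace X] [StandardBorelSpace X]

/-- saturations of null sets -/
theorem nullsat {μ : Measure X} {E : Set (X × X)} (hE : MeasurableSet E) (hmcp : MCP μ E)
    {g : ℕ → X → X} (hg : ∀ i, Measurable (g i)) (hgE : ∀ᵐ x ∂μ, ∀ y, (x, y) ∈ E → ∃ i, g i x = y)
    {N : Set X} (hN : μ N = 0) : μ (ESat E N) = 0 := by
  obtain ⟨N', hNN', hN'm, hN'0⟩ := exists_measurable_superset_of_null hN
  have hA : MeasurableSet (E ∩ {p | p.2 ∈ N'}) := hE.inter (measurable_snd hN'm)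
  have h1 := (hmcp (E ∩ {p | p.2 ∈ N'}) inter_subset_left hA).2 (by
    unfold nuR lintR
    rw [← lintegral_zero (μ := μ)]
    apply lintegral_congr_ae
    have : ∀ᵐ x ∂μ, x ∉ N' := by rw [ae_iff]; simpa using hN'0
    filter_upwards [this] with x hx
    have : IsEmpty {y : X // (y, x) ∈ E ∩ {p | p.2 ∈ N'}} := ⟨fun ⟨y, h⟩ => hx h.2⟩
    simp)
  have h2 : ∀ i, μ {x | (x, g i x) ∈ E ∩ {p | p.2 ∈ N'}} = 0 := by
    intro i
    have hm : MeasurableSet {x | (x, g i x) ∈ E ∩ {p | p.2 ∈ N'}} := (measurable_id.prodMk (hg i)) hA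
    rw [← lintegral_bi μ hm, ← nonpos_iff_eq_zero, ← h1]
    unfold nuL lintL
    refine lintegral_mono fun x => ?_
    by_cases h : (x, g i x) ∈ E ∩ {p | p.2 ∈ N'}
    · rw [bi_pos h]
      exact ENNReal.le_tsum (f := fun _ : {y : X // (x, y) ∈ E ∩ {p | p.2 ∈ N'}} => (1 : ℝ≥0∞)) ⟨g i x, h⟩
    · rw [bi_neg h]; exact zero_le
  refine measure_mono_null (t := {x | ¬ ∀ y, (x, y) ∈ E → ∃ i, g i x = y} ∪ ⋃ i, {x | (x, g i x) ∈ E ∩ {p | p.2 ∈ N'}}) ?_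
    (measure_union_null (ae_iff.1 hgE) (measure_iUnion_null h2))
  rintro x ⟨y, hy, hxy⟩
  by_cases h : ∀ y, (x, y) ∈ E → ∃ i, g i x = y
  · obtain ⟨i, rfl⟩ := h y hxy
    exact Or.inr (mem_iUnion.2 ⟨i, hxy, hNN' hy⟩)
  · exact Or.inl h

/-- a null set is contained in a Borel invariant null set -/
theorem nullinv {μ : Measure X} {E : Set (X × X)} (hs : ∀ N : Set X, μ N = 0 → μ (ESat E N) = 0)
    (hsy : ∀ x y, (x, y) ∈ E → (y, x) ∈ E)
    {B : Set X} (hB : μ B = 0) : ∃ N, MeasurableSet N ∧ B ⊆ N ∧ μ N = 0 ∧ ∀ x y, (x, y) ∈ E → x ∈ N → y ∈ N := by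
  let Q : ℕ → Set X := fun n => Nat.rec (motive := fun _ => Set X) (toMeasurable μ B) (fun _ N => toMeasurable μ (ESat E N)) n
  have hQs : ∀ n, Q (n+1) = toMeasurable μ (ESat E (Q n)) := fun n => rfl
  have h0 : ∀ n, μ (Q n) = 0 := by
    intro n
    induction n with
    | zero => exact (measure_toMeasurable B).trans hB
    | succ n ih => rw [hQs, measure_toMeasurable]; exact hs _ ih
  refine ⟨⋃ n, Q n, .iUnion fun n => ?_, (subset_toMeasurable μ B).trans (subset_iUnion Q 0), measure_iUnion_null h0, ?_⟩
  · cases n <;> exact measurableSet_toMeasurable _ _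
  · intro x y h hx
    obtain ⟨n, hn⟩ := mem_iUnion.1 hx
    refine mem_iUnion.2 ⟨n+1, ?_⟩
    rw [hQs]
    exact subset_toMeasurable _ _ ⟨x, hn, hsy _ _ h⟩

namespace CB
variable {m : Measure X} (S : CB m)

/-- the left measure on pairs -/
def NL (μ : Measure X) : Measure (X × X) :=
  Measure.sum fun i => (μ.restrict {x | ∀ j < i, S.g j x ≠ S.g i x}).map (fun x => (x, S.g i x))

theorem NL_int (μ : Measure X) {F : X × X → ℝ≥0∞} (hF : Measurable F) :
    ∫⁻ e, F e ∂(S.NL μ) = ∫⁻ x, ∑' y, bi (S.E x y) * F (x, y) ∂μ := by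
  classical
  have hI : ∀ i, MeasurableSet {x | ∀ j < i, S.g j x ≠ S.g i x} := by
    intro i
    have : {x | ∀ j < i, S.g j x ≠ S.g i x} = ⋂ j, ⋂ (_ : j < i), {x | S.g j x = S.g i x}ᶜ := by
      ext; simp
    rw [this]
    exact .iInter fun j => .iInter fun _ => (measurableSet_eq_fun (S.gm j) (S.gm i)).compl
  have hFi : ∀ i, Measurable (fun x => F (x, S.g i x)) := fun i => hF.comp (measurable_id.prodMk (S.gm i))
  have e : ∀ x, ∑' y, bi (S.E x y) * F (x, y) = ∑' i, ({x | ∀ j < i, S.g j x ≠ S.g i x}).indicator (fun x => F (x, S.g i x)) x := by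
    intro x
    rw [S.tsum_eq (fun x y => bi (S.E x y) * F (x, y)) (fun x y h => by rw [bi_neg h, zero_mul])]
    refine tsum_congr fun i => ?_
    simp only [indicator_apply, mem_setOf_eq]
    rw [bi_pos (S.Eg i x), one_mul]
  simp_rw [e]
  rw [lintegral_tsum (fun i => ((hFi i).indicator (hI i)).aemeasurable), NL, lintegral_sum_measure]
  refine tsum_congr fun i => ?_
  have hgi : Measurable (fun x => (x, S.g i x)) := measurable_id.prodMk (S.gm i)
  rw [lintegral_map hF hgi, lintegral_indicator (hI i)]

/-- extending the Radon-Nikodym identity from sets to functions -/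
theorem mt_of_sets {μ : Measure X} {w : X × X → ℝ≥0∞} (hw : Measurable w)
    (h : ∀ A : Set (X × X), A ⊆ {p | S.E p.1 p.2} → MeasurableSet A → nuL μ A = lintR μ w A)
    {F : X → X → ℝ≥0∞} (hF : Measurable (fun p : X × X => F p.1 p.2)) (hF0 : ∀ x y, ¬ S.E x y → F x y = 0) :
    ∫⁻ x, ∑' y, F x y ∂μ = ∫⁻ x, ∑' y, F y x * w (y, x) ∂μ := by
  have hR : ∀ {F : X × X → ℝ≥0∞}, Measurable F → ∫⁻ e, F e ∂(((S.NL μ).map Prod.swap).withDensity w) =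
      ∫⁻ x, ∑' y, bi (S.E x y) * (w (y, x) * F (y, x)) ∂μ := by
    intro F hF
    rw [lintegral_withDensity_eq_lintegral_mul _ hw hF, lintegral_map (hw.mul hF) measurable_swap]
    exact S.NL_int μ ((hw.mul hF).comp measurable_swap)
  have heq : S.NL μ = ((S.NL μ).map Prod.swap).withDensity w := by
    ext A hA
    have hAE : MeasurableSet ({p | S.E p.1 p.2} ∩ A) := S.Emeas.inter hA
    have hb : Measurable (fun e : X × X => bi (e ∈ A)) := bi_meas hA
    have h1 := S.NL_int μ hb
    have h2 := hR hb
    rw [lintegral_bi (p := fun e => e ∈ A) _ hA] at h1 h2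
    have h3 := h _ inter_subset_left hAE
    unfold nuL lintL lintR at h3
    refine h1.trans (Eq.trans ?_ (h3.trans (Eq.trans ?_ h2.symm)))
    · refine lintegral_congr fun x => ?_
      have := tsum_sub_bi {y | (x, y) ∈ {p : X × X | S.E p.1 p.2} ∩ A} (fun _ => 1)
      refine Eq.trans ?_ this.symm
      refine tsum_congr fun y => ?_
      rw [mul_one, ← bi_and]; rfl
    · refine lintegral_congr fun x => ?_
      have := tsum_sub_bi {y | (y, x) ∈ {p : X × X | S.E p.1 p.2} ∩ A} (fun y => w (y, x))
      refine this.trans ?_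
      refine tsum_congr fun y => ?_
      change bi (S.E y x ∧ (y, x) ∈ A) * w (y, x) = _
      rw [bi_and, bi_congr ⟨fun h => S.sm h, fun h => S.sm h⟩]
      ring
  have h1 := S.NL_int μ hF
  have h2 := hR hF
  rw [← heq, h1] at h2
  refine Eq.trans ?_ (h2.trans ?_)
  · refine lintegral_congr fun x => tsum_congr fun y => ?_
    by_cases h : S.E x y
    · rw [bi_pos h, one_mul]
    · rw [bi_neg h, zero_mul, hF0 _ _ h]
  · refine lintegral_congr fun x => tsum_congr fun y => ?_
    by_cases h : S.E x y
    · rw [bi_pos h, one_mul, mul_comm]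
    · rw [bi_neg h, zero_mul, hF0 _ _ (fun h' => h (S.sm h')), zero_mul]

end CB
end

theorem alg1 {p h : ℝ≥0∞} (h0 : h ≠ 0) (ht : h ≠ ∞) : p * h * h⁻¹ = p := by
  rw [mul_assoc, ENNReal.mul_inv_cancel h0 ht, mul_one]

theorem alg2 {p q x y z : ℝ≥0∞} (h0 : y ≠ 0) (ht : y ≠ ∞) : (p * z * y⁻¹) * (q * y * x⁻¹) = p * q * z * x⁻¹ := by
  have : (p * z * y⁻¹) * (q * y * x⁻¹) = p * q * z * x⁻¹ * (y * y⁻¹) := by ring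
  rw [this, ENNReal.mul_inv_cancel h0 ht, mul_one]

theorem main_aux {X : Type*} [MeasurableSpace X] [StandardBorelSpace X] [Nonempty X]
    (μ : Measure X) [SigmaFinite μ]
    (G : Set (X × X)) (hGmeas : MeasurableSet G)
    (hGirr : ∀ x : X, (x, x) ∉ G)
    (hGsymm : ∀ x y : X, (x, y) ∈ G → (y, x) ∈ G)
    (hGacyc : AcyclicGraph G)
    (hEG : IsCBER (connRel G)) (hmcp : MCP μ (connRel G))
    (herg : ErgodicRel μ (connRel G)) (hIII : IsTypeIII μ (connRel G))
    (hnonamen : ¬ AmenableGraph μ G)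
    (w : X × X → ℝ≥0∞) (hw : IsRNCocycle μ (connRel G) w)
    (ι : Type) [Countable ι] (a b : ι) (hab : a ≠ b) :
    ∃ φ : FreeGroup ι →* Equiv.Perm X,
      (∀ g : FreeGroup ι, Measurable (φ g)) ∧
      (∀ᵐ x ∂μ, ∀ g : FreeGroup ι, g ≠ 1 → φ g x ≠ x) ∧
      (∀ᵐ x ∂μ, ∀ y : X, ((x, y) ∈ connRel G ↔ ∃ g : FreeGroup ι, φ g x = y)) ∧
      (∀ᵐ x ∂μ, ∀ r : ℕ → X, IsGeodesicRay (schreier φ) r →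
        (x, r 0) ∈ connRel (schreier φ) → ¬ VanishingEnd w (schreier φ) r) := by
  classical
  obtain ⟨hEm, hEe, hEc⟩ := hEG
  obtain ⟨hwm, hw0, hwc, hw1, hwn⟩ := hw
  obtain ⟨h, hpos, hm, hint⟩ := exists_pos_lintegral_lt_of_sigmaFinite μ one_ne_zero
  let H : X → ℝ≥0∞ := fun x => h x
  have hHm : Measurable H := hm.coe_nnreal_ennreal
  have H0 : ∀ x, H x ≠ 0 := fun x => by simpa [H] using (hpos x).ne'
  have Ht : ∀ x, H x ≠ ∞ := fun x => ENNReal.coe_ne_top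
  let m : Measure X := μ.withDensity H
  have : IsFiniteMeasure m := isFiniteMeasure_withDensity (hint.trans ENNReal.one_lt_top).ne
  have hmμ : m ≪ μ := withDensity_absolutelyContinuous _ _
  have hμm : μ ≪ m := withDensity_absolutelyContinuous' hHm.aemeasurable (.of_forall H0)
  obtain ⟨g, hg, hgE⟩ := LN m (connRel G) hEm hEc
  have hgE' : ∀ᵐ x ∂μ, ∀ y, (x, y) ∈ connRel G → ∃ i, g i x = y := hμm.ae_le hgE
  obtain ⟨N, hNm, hBN, hN0, hNi⟩ := nullinv (μ := μ) (E := connRel G) (fun N hN => nullsat hEm hmcp hg hgE' hN)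
    (fun x y h => hEe.symm h) (B := {x | ¬ ∀ y, (x, y) ∈ connRel G → ∃ i, g i x = y}) hgE'
  let X₀ : Set X := Nᶜ
  have hX0m : MeasurableSet X₀ := hNm.compl
  have hX0i : ∀ x y, (x, y) ∈ connRel G → x ∈ X₀ → y ∈ X₀ := fun x y hxy hx hy => hx (hNi _ _ (hEe.symm hxy) hy)
  have hX0g : ∀ x ∈ X₀, ∀ y, (x, y) ∈ connRel G → ∃ i, g i x = y := by
    intro x hx
    by_contra hcon
    exact hx (hBN hcon)
  have hX0μ : ∀ᵐ x ∂μ, x ∈ X₀ := by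
    rw [ae_iff]; simpa [X₀] using hN0
  let G₀ : Set (X × X) := {p | p ∈ G ∧ p.1 ∈ X₀}
  let E₀ : X → X → Prop := fun x y => x = y ∨ (x ∈ X₀ ∧ (x, y) ∈ connRel G)
  have E₀E : ∀ x y, E₀ x y → (x, y) ∈ connRel G := by
    rintro x y (rfl | h)
    · exact hEe.refl x
    · exact h.2
  have E₀G : ∀ x y, E₀ x y ↔ (x, y) ∈ connRel G₀ := by
    intro x y
    constructor
    · rintro (rfl | ⟨hx, hxy⟩)
      · exact Relation.ReflTransGen.refl
      · have h' : Relation.ReflTransGen (fun a b => (a, b) ∈ G) x y := hxy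
        have : Relation.ReflTransGen (fun a b => (a, b) ∈ G₀) x y ∧ y ∈ X₀ := by
          induction h' with
          | refl => exact ⟨.refl, hx⟩
          | tail h1 h2 ih =>
            obtain ⟨k1, k2⟩ := ih h1
            exact ⟨k1.tail ⟨h2, k2⟩, hX0i _ _ (.single h2) k2⟩
        exact this.1
    · intro h
      have h' : Relation.ReflTransGen (fun a b => (a, b) ∈ G₀) x y := h
      rcases Relation.ReflTransGen.cases_head h' with h1 | ⟨c, h1, h2⟩
      · exact Or.inl h1
      · exact Or.inr ⟨h1.2, Cmb.Dat.mono_rtg (fun _ _ h => h.1) h'⟩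
  have E₀e : Equivalence E₀ := by
    refine ⟨fun x => Or.inl rfl, ?_, ?_⟩
    · rintro x y (rfl | ⟨h1, h2⟩)
      · exact Or.inl rfl
      · exact Or.inr ⟨hX0i _ _ h2 h1, hEe.symm h2⟩
    · rintro x y z (rfl | ⟨h1, h2⟩) (rfl | ⟨h3, h4⟩)
      · exact Or.inl rfl
      · exact Or.inr ⟨h3, h4⟩
      · exact Or.inr ⟨h1, h2⟩
      · exact Or.inr ⟨h1, hEe.trans h2 h4⟩
  let g' : ℕ → X → X := fun i x => if x ∈ X₀ ∧ (x, g i x) ∈ connRel G then g i x else x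
  have hg' : ∀ i, Measurable (g' i) := fun i =>
    Measurable.ite (hX0m.inter ((measurable_id.prodMk (hg i)) hEm)) (hg i) measurable_id
  have hEg : ∀ x y, E₀ x y ↔ ∃ i, g' i x = y := by
    intro x y
    constructor
    · intro hxy
      by_cases hx : x ∈ X₀
      · obtain ⟨i, rfl⟩ := hX0g x hx y (E₀E _ _ hxy)
        exact ⟨i, if_pos ⟨hx, E₀E _ _ hxy⟩⟩
      · rcases hxy with rfl | h1
        · exact ⟨0, if_neg fun h => hx h.1⟩
        · exact absurd h1.1 hx
    · rintro ⟨i, rfl⟩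
      simp only [g']
      split_ifs with h1
      · exact Or.inr h1
      · exact Or.inl rfl
  let S0 : CB (0 : Measure X) := {
    E := E₀, g := g', w := fun _ _ => 1, eqv := E₀e, hE := hEg, gm := hg'
    wm := measurable_const
    w0 := by simp
    wt := by simp
    wc := by simp
    mt := by simp }
  have hmt : ∀ {F : X → X → ℝ≥0∞}, Measurable (fun p : X × X => F p.1 p.2) → (∀ x y, ¬ E₀ x y → F x y = 0) →
      ∫⁻ x, ∑' y, F x y ∂μ = ∫⁻ x, ∑' y, F y x * w (y, x) ∂μ := fun {F} hF hF0 =>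
    S0.mt_of_sets hwm (fun A hA hAm => hwn A (fun p hp => E₀E _ _ (hA hp)) hAm) hF hF0
  let S : CB m := {
    E := E₀, g := g', w := fun y x => w (y, x) * H y * (H x)⁻¹, eqv := E₀e, hE := hEg, gm := hg'
    wm := (hwm.mul (hHm.comp measurable_fst)).mul (hHm.comp measurable_snd).inv
    w0 := fun x y hxy => mul_ne_zero (mul_ne_zero (hw0 _ (E₀E _ _ hxy)).1 (H0 x)) (ENNReal.inv_ne_zero.2 (Ht y))
    wt := fun x y hxy => ENNReal.mul_ne_top (ENNReal.mul_ne_top (hw0 _ (E₀E _ _ hxy)).2 (Ht x)) (ENNReal.inv_ne_top.2 (H0 y))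
    wc := fun x y z hxy hyz => by
      rw [alg2 (H0 y) (Ht y), hwc x y z (hEe.symm (E₀E _ _ hxy)) (hEe.symm (E₀E _ _ hyz))]
    mt := fun F hF hF0 => by
      have hFw0 : ∀ x y, ¬ E₀ x y → F y x * (w (y, x) * H y * (H x)⁻¹) = 0 := fun x y hxy => by
        rw [hF0 _ _ (fun h' => hxy (E₀e.symm h')), zero_mul]
      have hFwm : Measurable (fun p : X × X => F p.2 p.1 * (w (p.2, p.1) * H p.2 * (H p.1)⁻¹)) :=
        (hF.comp measurable_swap).mul (((hwm.comp measurable_swap).mul (hHm.comp measurable_snd)).mul (hHm.comp measurable_fst).inv)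
      have m1 : Measurable (fun x => ∑' y, F x y) := S0.tsum_meas hF hF0
      have m2 : Measurable (fun x => ∑' y, F y x * (w (y, x) * H y * (H x)⁻¹)) :=
        S0.tsum_meas (F := fun x y => F y x * (w (y, x) * H y * (H x)⁻¹)) hFwm hFw0
      rw [lintegral_withDensity_eq_lintegral_mul _ hHm m1, lintegral_withDensity_eq_lintegral_mul _ hHm m2]
      have := hmt (F := fun x y => H x * F x y) ((hHm.comp measurable_fst).mul hF) (fun x y hxy => by rw [hF0 _ _ hxy, mul_zero])
      refine Eq.trans ?_ (this.trans ?_)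
      · refine lintegral_congr fun x => ?_
        rw [Pi.mul_apply, ENNReal.tsum_mul_left]
      · refine lintegral_congr fun x => ?_
        rw [Pi.mul_apply, ← ENNReal.tsum_mul_left]
        refine tsum_congr fun y => ?_
        calc H y * F y x * w (y, x) = (H y * F y x * w (y, x)) * H x * (H x)⁻¹ := (alg1 (H0 x) (Ht x)).symm
          _ = _ := by ring }
  have Serg : S.erg := by
    intro Z hZ hZi
    by_cases hZ0 : m Z = 0
    · exact Or.inl hZ0
    · right
      have h1 : μ (Z ∩ X₀) ≠ 0 := by
        intro h1
        apply hZ0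
        apply hmμ
        refine measure_mono_null (t := (Z ∩ X₀) ∪ N) ?_ (measure_union_null h1 hN0)
        intro x hx
        by_cases hx' : x ∈ N
        · exact Or.inr hx'
        · exact Or.inl ⟨hx, hx'⟩
      apply hmμ
      refine measure_mono_null ?_ (herg _ (hZ.inter hX0m) h1)
      intro x hx hx'
      obtain ⟨y, hy, hxy⟩ := hx'
      exact hx (hZi y x (Or.inr ⟨hy.2, hEe.symm hxy⟩) hy.1)
  have hSn : ¬ S.hasS := by
    rintro ⟨s, hs, hs'⟩
    apply hIII
    have es0 : ∀ᵐ x ∂m, s x ≠ 0 := by filter_upwards [hs'] with x hx using hx.1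
    have est : ∀ᵐ x ∂m, s x ≠ ∞ := by filter_upwards [hs'] with x hx using hx.2.1
    have hac1 : m.withDensity s ≪ μ := (withDensity_absolutelyContinuous _ _).trans hmμ
    refine ⟨m.withDensity s, SigmaFinite.withDensity_of_ne_top est, ⟨hac1,
      hμm.trans (withDensity_absolutelyContinuous' hs.aemeasurable es0)⟩, ?_⟩
    have key : ∀ (f : X → X) (A : Set X), Measurable f → MeasurableSet A → Set.InjOn f A →
        (∀ x ∈ A, (x, f x) ∈ connRel G) → m.withDensity s (f '' A) = m.withDensity s A := by
      intro f A hf hA hfi hfE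
      have hA' : MeasurableSet (A ∩ X₀) := hA.inter hX0m
      have hfi' : InjOn f (A ∩ X₀) := hfi.mono inter_subset_left
      have e1 : m.withDensity s (f '' (A ∩ X₀)) = m.withDensity s (A ∩ X₀) := by
        rw [withDensity_apply _ (CB.Einj hf hA' hfi'), withDensity_apply _ hA',
          S.lint_image hf hA' hfi' (fun x hx => Or.inr ⟨hx.2, hfE x hx.1⟩) hs]
        refine setLIntegral_congr_fun_ae hA' ?_
        filter_upwards [hs'] with x hx hxA
        exact hx.2.2 _ (Or.inr ⟨hxA.2, hfE x hxA.1⟩)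
      have hN0' : m.withDensity s N = 0 := hac1 hN0
      have e2 : m.withDensity s (f '' A) = m.withDensity s (f '' (A ∩ X₀)) := by
        refine le_antisymm ?_ (measure_mono (image_mono inter_subset_left))
        calc m.withDensity s (f '' A) ≤ m.withDensity s (f '' (A ∩ X₀) ∪ N) := by
              refine measure_mono ?_
              rintro _ ⟨x, hx, rfl⟩
              by_cases hx' : x ∈ N
              · exact Or.inr (hNi _ _ (hfE x hx) hx')
              · exact Or.inl ⟨x, ⟨hx, hx'⟩, rfl⟩
          _ ≤ _ := measure_union_le _ _
          _ = _ := by rw [hN0', add_zero]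
      have e3 : m.withDensity s A = m.withDensity s (A ∩ X₀) := by
        refine le_antisymm ?_ (measure_mono inter_subset_left)
        calc m.withDensity s A ≤ m.withDensity s ((A ∩ X₀) ∪ N) := by
              refine measure_mono ?_
              intro x hx
              by_cases hx' : x ∈ N
              · exact Or.inr hx'
              · exact Or.inl ⟨hx, hx'⟩
          _ ≤ _ := measure_union_le _ _
          _ = _ := by rw [hN0', add_zero]
      rw [e2, e1, e3]
    intro f A hf hA hfi hfE
    ext B hB
    rw [Measure.map_apply hf hB, Measure.restrict_apply (hf hB), Measure.restrict_apply hB]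
    have h1 := key f (f ⁻¹' B ∩ A) hf ((hf hB).inter hA) (hfi.mono inter_subset_right) (fun x hx => hfE x hx.2)
    rw [← h1]
    congr 1
    ext y
    constructor
    · rintro ⟨x, ⟨hx1, hx2⟩, rfl⟩
      exact ⟨hx1, x, hx2, rfl⟩
    · rintro ⟨hy, x, hx, rfl⟩
      exact ⟨x, ⟨hy, hx⟩, rfl⟩
  have hna : ∀ r : ℕ → X → X, (∀ n, Measurable (r n)) → (∀ n x, S.E x (r n x)) → (∀ n x, r (n+1) (r n x) = r (n+1) x) →
      ¬ ∀ᵐ x ∂m, ∀ y, (x, y) ∈ G₀ → ∃ n, r n x = r n y := by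
    intro r hr hrE hrr hae
    apply hnonamen
    refine ⟨fun n e => if r n e.1 = e.2 then 1 else 0, ?_, ?_, ?_, ?_⟩
    · intro n
      exact Measurable.ite (measurableSet_eq_fun ((hr n).comp measurable_fst) measurable_snd) measurable_const measurable_const
    · intro n e
      dsimp only
      split_ifs <;> norm_num
    · refine .of_forall fun x n => ?_
      rw [tsum_eq_single (⟨r n x, E₀E _ _ (hrE n x)⟩ : {y : X // (x, y) ∈ connRel G})]
      · simp
      · rintro ⟨y, hy⟩ hne
        simp only
        rw [if_neg]
        rintro rfl
        exact hne rfl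
    · unfold nuL lintL
      rw [← lintegral_zero (μ := μ)]
      apply lintegral_congr_ae
      filter_upwards [hX0μ, hμm.ae_le hae] with x hx hx2
      rw [ENNReal.tsum_eq_zero]
      rintro ⟨y, hy, hy2⟩
      exfalso
      apply hy2
      obtain ⟨n0, hn0⟩ := hx2 y ⟨hy, hx⟩
      have hn : ∀ n, n0 ≤ n → r n x = r n y := by
        intro n hn
        induction hn with
        | refl => exact hn0
        | step _ ih => rw [← hrr, ih, hrr]
      refine tendsto_const_nhds.congr' ?_
      filter_upwards [eventually_ge_atTop n0] with n hn'
      simp [hn n hn']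
  obtain ⟨φ, hφm, X₁, hX1, hfree, horb, hray⟩ := S.finish (ι := ι) (a := a) (b := b) hab.symm (G := G₀)
    (hGmeas.inter (measurable_fst hX0m))
    (fun n c hn hc => hGacyc n c hn fun i hi => (hc i hi).1)
    (fun x hx => hGirr x hx.1) (fun x y hxy => ⟨hGsymm _ _ hxy.1, hX0i _ _ (.single hxy.1) hxy.2⟩)
    E₀G Serg hSn hna (k := fun x => (H x)⁻¹) hHm.inv (fun x => ENNReal.inv_ne_zero.2 (Ht x))
  have hX1μ : ∀ᵐ x ∂μ, x ∈ X₁ := by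
    rw [ae_iff]; exact hμm hX1
  refine ⟨φ, hφm, ?_, ?_, ?_⟩
  · filter_upwards [hX1μ] with x hx using hfree x hx
  · filter_upwards [hX1μ, hX0μ] with x hx hx0 y
    rw [← horb x hx y]
    exact ⟨fun h1 => Or.inr ⟨hx0, h1⟩, fun h1 => E₀E _ _ h1⟩
  · filter_upwards [hX1μ] with x hx r hr hxr hvan
    obtain ⟨-, h2⟩ := hray x hx r hr hxr
    have htop : ∀ i, ⨆ y ∈ halfSpace (schreier φ) (r i) (r (i + 1)), w (y, r 0) = ∞ := by
      intro i
      by_contra hne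
      obtain ⟨y, hy, hyE, hlt⟩ := h2 i ((⨆ y ∈ halfSpace (schreier φ) (r i) (r (i + 1)), w (y, r 0)) / H (r 0))
        (ENNReal.div_lt_top hne (H0 _))
      rw [ENNReal.div_lt_iff (Or.inl (H0 _)) (Or.inl (Ht _))] at hlt
      have e : w (y, r 0) * H y * (H (r 0))⁻¹ * (H y)⁻¹ * H (r 0) = w (y, r 0) := by
        have : w (y, r 0) * H y * (H (r 0))⁻¹ * (H y)⁻¹ * H (r 0) =
          (w (y, r 0) * H (r 0) * (H (r 0))⁻¹) * H y * (H y)⁻¹ := by ring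
        rw [this, alg1 (H0 _) (Ht _), alg1 (H0 _) (Ht _)]
      have hlt' : (⨆ y ∈ halfSpace (schreier φ) (r i) (r (i + 1)), w (y, r 0)) <
        w (y, r 0) * H y * (H (r 0))⁻¹ * (H y)⁻¹ * H (r 0) := hlt
      rw [e] at hlt'
      exact absurd (le_iSup₂ (f := fun y (_ : y ∈ halfSpace (schreier φ) (r i) (r (i + 1))) => w (y, r 0)) y hy) (not_le.2 hlt')
    unfold VanishingEnd at hvan
    simp_rw [htop] at hvan
    exact ENNReal.top_ne_zero (tendsto_nhds_unique tendsto_const_nhds hvan)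

/-- **Main theorem.** Let `(X, μ, G)` be an ergodic, type III, non-amenable,
locally countable, acyclic Borel graph, and let `F_d` (for `d ∈ {2, 3, …} ∪ {∞}`) be the free
group on a countable set `ι` with at least two elements. Then there is a Borel action of
`F_d` on `X`, essentially free, with `E_G = E_{F_d}` a.e., such that for a.e. component of
the Schreier graph of the action no end is vanishing. -/
theorem main_theorem {X : Type*} [MeasurableSpace X] [StandardBorelSpace X]
    (μ : Measure X) [SigmaFinite μ]
    (G : Set (X × X)) (hGmeas : MeasurableSet G)
    (hGirr : ∀ x : X, (x, x) ∉ G)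
    (hGsymm : ∀ x y : X, (x, y) ∈ G → (y, x) ∈ G)
    (hGlc : ∀ x : X, {y | (x, y) ∈ G}.Countable)
    (hGacyc : AcyclicGraph G)
    (hEG : IsCBER (connRel G)) (hmcp : MCP μ (connRel G))
    (herg : ErgodicRel μ (connRel G)) (hIII : IsTypeIII μ (connRel G))
    (hnonamen : ¬ AmenableGraph μ G)
    (w : X × X → ℝ≥0∞) (hw : IsRNCocycle μ (connRel G) w)
    (ι : Type) [Countable ι] (a b : ι) (hab : a ≠ b) :
    ∃ φ : FreeGroup ι →* Equiv.Perm X,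
      (∀ g : FreeGroup ι, Measurable (φ g)) ∧
      (∀ᵐ x ∂μ, ∀ g : FreeGroup ι, g ≠ 1 → φ g x ≠ x) ∧
      (∀ᵐ x ∂μ, ∀ y : X, ((x, y) ∈ connRel G ↔ ∃ g : FreeGroup ι, φ g x = y)) ∧
      (∀ᵐ x ∂μ, ∀ r : ℕ → X, IsGeodesicRay (schreier φ) r →
        (x, r 0) ∈ connRel (schreier φ) → ¬ VanishingEnd w (schreier φ) r) := by
  rcases isEmpty_or_nonempty X with hX | hX
  · exact ⟨1, fun g => measurable_id, .of_forall fun x => hX.elim x, .of_forall fun x => hX.elim x, .of_forall fun x => hX.elim x⟩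
  · exact main_aux μ G hGmeas hGirr hGsymm hGacyc hEG hmcp herg hIII hnonamen w hw ι a b hab
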